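/- arXiv:1812.04902 — 2 statements merged into one kernel-verified Lean document; each statement's English description precedes it below -/
import Mathlib

section
/- Pure jump case, off-diagonal regime: there exists a constant C ≥ 1 such that for all t > 0 and x, y ∈ E with Φ(d(x,y)) φ(1/t) ≥ 1: C^{-1} / (t φ(1/t)² V(x, d(x,y)) Φ(d(x,y))) ≤ q(t,x,y) ≤ C / (t φ(1/t)² V(x, d(x,y)) Φ(d(x,y))). -/
open MeasureTheory Filter Set
open scoped ENNReal Topology

theorem ae_mem_Icc_of_compl_null {ρ : Measure ℝ} (h : ρ (Icc 0 1)ᶜ = 0) :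
    ∀ᵐ x ∂ρ, x ∈ Icc (0 : ℝ) 1 := mem_ae_iff.2 h

theorem integrable_pow_of_compl_Icc_null {ρ : Measure ℝ} [IsFiniteMeasure ρ]
    (h : ρ (Icc 0 1)ᶜ = 0) (n : ℕ) : Integrable (fun x => x ^ n) ρ := by
  refine Integrable.of_bound (by fun_prop) 1 ?_
  filter_upwards [ae_mem_Icc_of_compl_null h] with x hx
  rw [Real.norm_eq_abs, abs_of_nonneg (pow_nonneg hx.1 n)]
  exact pow_le_one₀ hx.1 hx.2

theorem integral_polynomial_eval {ρ : Measure ℝ} [IsFiniteMeasure ρ]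
    (h : ρ (Icc 0 1)ᶜ = 0) (p : Polynomial ℝ) :
    ∫ x, p.eval x ∂ρ = ∑ i ∈ Finset.range (p.natDegree + 1), p.coeff i * ∫ x, x ^ i ∂ρ := by
  simp_rw [Polynomial.eval_eq_sum_range, ← integral_const_mul]
  exact integral_finsetSum _ fun i _ => (integrable_pow_of_compl_Icc_null h i).const_mul _

theorem exists_polynomial_tendsto_integral (f : ℝ → ℝ) (hf : Continuous f) :
    ∃ p : ℕ → Polynomial ℝ, ∀ (ρ : Measure ℝ) [IsFiniteMeasure ρ], ρ (Icc 0 1)ᶜ = 0 →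
      Tendsto (fun n => ∫ x, (p n).eval x ∂ρ) atTop (𝓝 (∫ x, f x ∂ρ)) := by
  choose p hp using fun n : ℕ => exists_polynomial_near_of_continuousOn 0 1 f hf.continuousOn
    (1 / ((n : ℝ) + 1)) (by positivity)
  obtain ⟨B, hB⟩ := isCompact_Icc.exists_bound_of_continuousOn (s := Icc (0 : ℝ) 1) hf.continuousOn
  refine ⟨p, fun ρ _ h => tendsto_integral_of_dominated_convergence (fun _ => B + 1)
    (fun n => (p n).continuous.aestronglyMeasurable) (integrable_const _) (fun n => ?_) ?_⟩
  · filter_upwards [ae_mem_Icc_of_compl_null h] with x hx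
    have h1 := (hp n x hx).le
    have h2 : 1 / ((n : ℝ) + 1) ≤ 1 := by
      rw [div_le_one (by positivity)]; linarith [(Nat.cast_nonneg n : (0 : ℝ) ≤ n)]
    have h3 := hB x hx
    rw [Real.norm_eq_abs] at h3 ⊢
    have := abs_sub_abs_le_abs_sub ((p n).eval x) (f x)
    linarith
  · filter_upwards [ae_mem_Icc_of_compl_null h] with x hx
    rw [tendsto_iff_dist_tendsto_zero]
    exact squeeze_zero (fun _ => dist_nonneg) (fun n => (hp n x hx).le)
      tendsto_one_div_add_atTop_nhds_zero_nat

theorem measure_ext_of_moments {ρ ρ' : Measure ℝ} [IsFiniteMeasure ρ] [IsFiniteMeasure ρ']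
    (h : ρ (Icc 0 1)ᶜ = 0) (h' : ρ' (Icc 0 1)ᶜ = 0)
    (hmom : ∀ n : ℕ, ∫ x, x ^ n ∂ρ = ∫ x, x ^ n ∂ρ') : ρ = ρ' := by
  refine ext_of_forall_integral_eq_of_IsFiniteMeasure fun f => ?_
  obtain ⟨p, hp⟩ := exists_polynomial_tendsto_integral f f.continuous
  refine tendsto_nhds_unique (hp ρ h) ((hp ρ' h').congr fun n => ?_)
  rw [integral_polynomial_eval h, integral_polynomial_eval h']
  simp_rw [hmom]

theorem measurable_measure_of_moments {α : Type*} [MeasurableSpace α] {κ : α → Measure ℝ}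
    [∀ a, IsProbabilityMeasure (κ a)] (h : ∀ a, κ a (Icc 0 1)ᶜ = 0)
    (hmom : ∀ n : ℕ, Measurable fun a => ∫ x, x ^ n ∂(κ a)) : Measurable κ := by
  have hinteg : ∀ f : ℝ → ℝ, Continuous f → Measurable fun a => ∫ x, f x ∂(κ a) := by
    intro f hf
    obtain ⟨p, hp⟩ := exists_polynomial_tendsto_integral f hf
    refine measurable_of_tendsto_metrizable (f := fun n a => ∫ x, (p n).eval x ∂(κ a))
      (fun n => ?_) (tendsto_pi_nhds.2 fun a => hp (κ a) (h a))
    simp_rw [integral_polynomial_eval (h _)]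
    exact Finset.measurable_sum _ fun i _ => (hmom i).const_mul _
  refine .measure_of_isPiSystem_of_isProbabilityMeasure (borel_eq_generateFrom_Iic ℝ)
    isPiSystem_Iic ?_
  rintro _ ⟨c, rfl⟩
  refine measurable_of_tendsto_metrizable
    (f := fun n a => ∫⁻ x, (isClosed_Iic (a := c)).apprSeq n x ∂(κ a)) (fun n => ?_)
    (tendsto_pi_nhds.2 fun a => HasOuterApproxClosed.tendsto_lintegral_apprSeq isClosed_Iic (κ a))
  have hc : Continuous fun x => ((isClosed_Iic (a := c)).apprSeq n x : ℝ) := by fun_prop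
  have := (hinteg _ hc).ennreal_ofReal
  convert this with a
  have := ofReal_integral_eq_lintegral_ofReal
    (((isClosed_Iic (a := c)).apprSeq n).integrable_of_nnreal (κ a))
    (ae_of_all _ fun x => NNReal.coe_nonneg _)
  simpa [Function.comp_def] using this.symm

/-- The Laplace transform `l ↦ ∫⁻ exp (-l s) m(ds)` of a measure on the line. -/
noncomputable def laplaceTransform (m : Measure ℝ) (l : ℝ) : ℝ≥0∞ :=
  ∫⁻ s, ENNReal.ofReal (Real.exp (-l * s)) ∂m

theorem ae_nonneg_of_Iio_null {m : Measure ℝ} (h : m (Iio 0) = 0) : ∀ᵐ s ∂m, 0 ≤ s := by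
  rw [ae_iff]; simpa [Iio] using h

theorem map_exp_neg_compl_Icc {m : Measure ℝ} (h : m (Iio 0) = 0) :
    m.map (fun s => Real.exp (-s)) (Icc 0 1)ᶜ = 0 := by
  rw [Measure.map_apply (by fun_prop) measurableSet_Icc.compl]
  refine measure_mono_null (fun s hs => ?_) h
  by_contra hs'
  exact hs ⟨(Real.exp_pos _).le, by simpa using hs'⟩

theorem integral_pow_map_exp_neg (m : Measure ℝ) (n : ℕ) :
    ∫ x, x ^ n ∂(m.map fun s => Real.exp (-s)) = (laplaceTransform m n).toReal := by
  rw [integral_map (by fun_prop) (by fun_prop),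
    integral_eq_lintegral_of_nonneg_ae (ae_of_all _ fun s => by positivity) (by fun_prop),
    laplaceTransform]
  congr 2
  ext s
  rw [← Real.exp_nat_mul]
  congr 2
  ring

theorem laplaceTransform_withDensity (m : Measure ℝ) {g : ℝ → ℝ≥0∞} (hg : Measurable g) (l : ℝ) :
    laplaceTransform (m.withDensity g) l =
      ∫⁻ s, g s * ENNReal.ofReal (Real.exp (-l * s)) ∂m := by
  rw [laplaceTransform, lintegral_withDensity_eq_lintegral_mul _ hg (by fun_prop)]
  rfl

theorem laplaceTransform_withDensity_exp (m : Measure ℝ) (k l : ℝ) :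
    laplaceTransform (m.withDensity fun s => ENNReal.ofReal (Real.exp (-k * s))) l =
      laplaceTransform m (l + k) := by
  rw [laplaceTransform_withDensity _ (by fun_prop), laplaceTransform]
  congr 1
  ext s
  rw [← ENNReal.ofReal_mul (Real.exp_pos _).le, ← Real.exp_add]
  congr 2
  ring

theorem measure_ext_of_laplaceTransform {m m' : Measure ℝ} (h : m (Iio 0) = 0)
    (h' : m' (Iio 0) = 0) (hfin : ∀ l, 0 < l → laplaceTransform m l ≠ ⊤)
    (heq : ∀ l, 0 < l → laplaceTransform m l = laplaceTransform m' l) : m = m' := by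
  set w : ℝ → ℝ≥0∞ := fun s => ENNReal.ofReal (Real.exp (-1 * s)) with hw
  have hwm : Measurable w := by fun_prop
  have fin : ∀ m : Measure ℝ, laplaceTransform m 1 ≠ ⊤ → IsFiniteMeasure (m.withDensity w) :=
    fun m hm => isFiniteMeasure_withDensity hm
  have := fin m (hfin 1 one_pos)
  have := fin m' (heq 1 one_pos ▸ hfin 1 one_pos)
  have key : (m.withDensity w).map (fun s => Real.exp (-s)) =
      (m'.withDensity w).map (fun s => Real.exp (-s)) := by
    refine measure_ext_of_moments (map_exp_neg_compl_Icc (withDensity_absolutelyContinuous _ _ h))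
      (map_exp_neg_compl_Icc (withDensity_absolutelyContinuous _ _ h')) fun n => ?_
    rw [integral_pow_map_exp_neg, integral_pow_map_exp_neg, laplaceTransform_withDensity_exp,
      laplaceTransform_withDensity_exp, heq _ (by positivity)]
  have key2 : m.withDensity w = m'.withDensity w := by
    have := congrArg (Measure.map fun x => -Real.log x) key
    rw [Measure.map_map (by fun_prop) (by fun_prop), Measure.map_map (by fun_prop) (by fun_prop)]
      at this
    simpa [Function.comp_def] using this
  have inv : ∀ m : Measure ℝ,
      (m.withDensity w).withDensity (fun s => ENNReal.ofReal (Real.exp s)) = m := by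
    intro m
    rw [← withDensity_mul _ hwm (by fun_prop)]
    convert withDensity_one (μ := m) using 2
    ext s
    simp only [hw, Pi.mul_apply, Pi.one_apply]
    rw [← ENNReal.ofReal_mul (Real.exp_pos _).le, ← Real.exp_add]
    simp
  rw [← inv m, key2, inv m']

theorem measurable_measure_of_laplaceTransform {α : Type*} [MeasurableSpace α] {κ : α → Measure ℝ}
    [∀ a, IsProbabilityMeasure (κ a)] (h : ∀ a, κ a (Iio 0) = 0)
    (hlap : ∀ l, 0 < l → Measurable fun a => laplaceTransform (κ a) l) : Measurable κ := by
  have : ∀ a, IsProbabilityMeasure ((κ a).map fun s => Real.exp (-s)) :=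
    fun a => Measure.isProbabilityMeasure_map (by fun_prop)
  have h1 : Measurable fun a => (κ a).map fun s => Real.exp (-s) := by
    refine measurable_measure_of_moments (fun a => map_exp_neg_compl_Icc (h a)) fun n => ?_
    rcases Nat.eq_zero_or_pos n with rfl | hn
    · simp
    · simp_rw [integral_pow_map_exp_neg]
      exact (hlap n (by positivity)).ennreal_toReal
  have h2 := (Measure.measurable_map (fun x => -Real.log x) (by fun_prop)).comp h1
  have h3 : κ = fun a => ((κ a).map fun s => Real.exp (-s)).map fun x => -Real.log x := by
    funext a
    rw [Measure.map_map (by fun_prop) (by fun_prop)]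
    simp [Function.comp_def]
  rw [h3]
  exact h2

theorem laplaceTransform_conv (m m' : Measure ℝ) [SFinite m'] (l : ℝ) :
    laplaceTransform (m.conv m') l = laplaceTransform m l * laplaceTransform m' l := by
  rw [laplaceTransform, Measure.lintegral_conv (by fun_prop)]
  simp_rw [mul_add, Real.exp_add, ENNReal.ofReal_mul (Real.exp_pos _).le]
  rw [laplaceTransform, laplaceTransform, ← lintegral_mul_const _ (by fun_prop)]
  congr 1
  ext x
  rw [lintegral_const_mul _ (by fun_prop)]

theorem conv_apply_eq_lintegral (m m' : Measure ℝ) [SFinite m] [SFinite m'] {s : Set ℝ}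
    (hs : MeasurableSet s) :
    m.conv m' s = ∫⁻ y, m ((fun x => x + y) ⁻¹' s) ∂m' := by
  rw [Measure.conv_comm, ← lintegral_indicator_one hs,
    Measure.lintegral_conv (measurable_one.indicator hs)]
  congr 1
  ext y
  rw [← lintegral_indicator_one (hs.preimage (by fun_prop))]
  refine lintegral_congr fun x => ?_
  rw [add_comm y x]
  rfl

theorem conv_Iio_zero {m m' : Measure ℝ} [SFinite m] [SFinite m'] (h : m (Iio 0) = 0)
    (h' : m' (Iio 0) = 0) : m.conv m' (Iio 0) = 0 := by
  rw [conv_apply_eq_lintegral _ _ measurableSet_Iio,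
    lintegral_eq_zero_of_ae_eq_zero]
  filter_upwards [ae_nonneg_of_Iio_null h'] with y hy
  refine measure_mono_null (fun x hx => ?_) h
  simp only [mem_preimage, mem_Iio] at hx ⊢
  linarith

theorem measure_Iic_le_laplaceTransform (m : Measure ℝ) {b : ℝ} (hb : 0 < b) :
    m (Iic b) ≤ ENNReal.ofReal (Real.exp 1) * laplaceTransform m b⁻¹ := by
  rw [laplaceTransform, ← lintegral_const_mul _ (by fun_prop),
    ← lintegral_indicator_one measurableSet_Iic]
  refine lintegral_mono fun s => ?_
  by_cases hs : s ∈ Iic b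
  · rw [indicator_of_mem hs, ← ENNReal.ofReal_mul (Real.exp_pos _).le, ← Real.exp_add, Pi.one_apply,
      ENNReal.one_le_ofReal, Real.one_le_exp_iff]
    have : b⁻¹ * s ≤ 1 := by rw [inv_mul_le_iff₀ hb]; simpa using hs
    linarith
  · simp [hs]

theorem laplaceTransform_volume_Ioi {l : ℝ} (hl : 0 < l) :
    laplaceTransform (volume.restrict (Ioi 0)) l = ENNReal.ofReal l⁻¹ := by
  rw [laplaceTransform, ← ofReal_integral_eq_lintegral_ofReal
    (integrableOn_exp_mul_Ioi (by linarith) 0) (ae_of_all _ fun s => (Real.exp_pos _).le),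
    integral_exp_mul_Ioi (by linarith)]
  simp

theorem setLIntegral_exp_Iio {l x : ℝ} (hl : 0 < l) (hx : 0 ≤ x) :
    ∫⁻ s in Ioi 0, (Iio x).indicator (fun s => ENNReal.ofReal (Real.exp (-l * s))) s =
      ENNReal.ofReal l⁻¹ * ENNReal.ofReal (1 - Real.exp (-l * x)) := by
  rw [setLIntegral_indicator measurableSet_Iio, Iio_inter_Ioi, restrict_Ioo_eq_restrict_Ioc,
    ← ofReal_integral_eq_lintegral_ofReal
      ((Continuous.integrableOn_Icc (by fun_prop)).mono_set Ioc_subset_Icc_self)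
      (ae_of_all _ fun s => (Real.exp_pos _).le),
    ← ENNReal.ofReal_mul (by positivity), ← intervalIntegral.integral_of_le hx,
    intervalIntegral.integral_eq_sub_of_hasDerivAt (f := fun s => -l⁻¹ * Real.exp (-l * s))]
  · congr 1
    simp
    ring
  · intro s _
    have := (((hasDerivAt_id s).const_mul (-l)).exp).const_mul (-l⁻¹)
    refine this.congr_deriv ?_
    simp only [id]
    field_simp
  · exact (Continuous.intervalIntegrable (by fun_prop) _ _)

theorem laplaceTransform_tail {N : Measure ℝ} [SFinite N] (h : N (Iio 0) = 0) {l : ℝ}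
    (hl : 0 < l) :
    laplaceTransform ((volume.restrict (Ioi 0)).withDensity fun s => N (Ioi s)) l =
      ENNReal.ofReal l⁻¹ * ∫⁻ x, ENNReal.ofReal (1 - Real.exp (-l * x)) ∂N := by
  have hanti : Antitone fun s : ℝ => N (Ioi s) := fun a b hab => measure_mono (Ioi_subset_Ioi hab)
  rw [laplaceTransform_withDensity _ hanti.measurable, ← lintegral_const_mul _ (by fun_prop)]
  have h1 : ∀ s : ℝ, N (Ioi s) * ENNReal.ofReal (Real.exp (-l * s)) =
      ∫⁻ x, {p : ℝ × ℝ | p.1 < p.2}.indicator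
        (fun p => ENNReal.ofReal (Real.exp (-l * p.1))) (s, x) ∂N := by
    intro s
    rw [mul_comm, ← lintegral_indicator_const measurableSet_Ioi]
    rfl
  simp_rw [h1]
  have hm : Measurable ({p : ℝ × ℝ | p.1 < p.2}.indicator
      (fun p : ℝ × ℝ => ENNReal.ofReal (Real.exp (-l * p.1)))) :=
    Measurable.indicator (by fun_prop) (measurableSet_lt measurable_fst measurable_snd)
  rw [lintegral_lintegral_swap (f := fun s x => {p : ℝ × ℝ | p.1 < p.2}.indicator
        (fun p => ENNReal.ofReal (Real.exp (-l * p.1))) (s, x)) hm.aemeasurable]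
  refine lintegral_congr_ae ?_
  filter_upwards [ae_nonneg_of_Iio_null h] with x hx
  rw [← setLIntegral_exp_Iio hl hx]
  rfl

/-- `φ` is the Laplace exponent of a driftless subordinator whose Lévy measure has a density `n`
such that `s ↦ s * n s` is non-increasing. -/
structure IsSelfDecomposableExponent (φ n : ℝ → ℝ) : Prop where
  nonneg : ∀ s, 0 ≤ n s
  measurable : Measurable n
  antitoneOn : AntitoneOn (fun s => s * n s) (Ioi 0)
  pos : ∀ l, 0 < l → 0 < φ l
  integrable : ∀ l, 0 < l → IntegrableOn (fun s => (1 - Real.exp (-l * s)) * n s) (Ioi 0)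
  eq_integral : ∀ l, 0 < l → φ l = ∫ s in Ioi 0, (1 - Real.exp (-l * s)) * n s

/-- The Lévy measure with density `n` on `(0, ∞)`. -/
noncomputable def levyMeasure (n : ℝ → ℝ) : Measure ℝ :=
  (volume.restrict (Ioi 0)).withDensity fun s => ENNReal.ofReal (n s)

/-- The measure on `(0, ∞)` with density `s * n s`. -/
noncomputable def kMeasure (n : ℝ → ℝ) : Measure ℝ :=
  (volume.restrict (Ioi 0)).withDensity fun s => ENNReal.ofReal (s * n s)

/-- The measure on `(0, ∞)` whose density is the tail of the Lévy measure. -/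
noncomputable def tailMeasure (n : ℝ → ℝ) : Measure ℝ :=
  (volume.restrict (Ioi 0)).withDensity fun s => levyMeasure n (Ioi s)

theorem withDensity_Ioi_null (g : ℝ → ℝ≥0∞) :
    (volume.restrict (Ioi (0 : ℝ))).withDensity g (Iio 0) = 0 := by
  refine withDensity_absolutelyContinuous _ _ ?_
  rw [Measure.restrict_apply measurableSet_Iio]
  convert measure_empty (μ := (volume : Measure ℝ))
  ext x
  simp only [mem_inter_iff, mem_Iio, mem_Ioi, mem_empty_iff_false, iff_false]
  exact fun h => lt_asymm h.1 h.2

theorem levyMeasure_Iio (n : ℝ → ℝ) : levyMeasure n (Iio 0) = 0 := withDensity_Ioi_null _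

theorem kMeasure_Iio (n : ℝ → ℝ) : kMeasure n (Iio 0) = 0 := withDensity_Ioi_null _

theorem tailMeasure_Iio (n : ℝ → ℝ) : tailMeasure n (Iio 0) = 0 := withDensity_Ioi_null _

instance (n : ℝ → ℝ) : SFinite (levyMeasure n) := by unfold levyMeasure; infer_instance

instance (n : ℝ → ℝ) : SFinite (kMeasure n) := by unfold kMeasure; infer_instance

instance (n : ℝ → ℝ) : SFinite (tailMeasure n) := by unfold tailMeasure; infer_instance

namespace IsSelfDecomposableExponent

variable {φ n : ℝ → ℝ} (h : IsSelfDecomposableExponent φ n)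
include h

theorem ofReal_eq {l : ℝ} (hl : 0 < l) :
    ENNReal.ofReal (φ l) = ∫⁻ s in Ioi 0, ENNReal.ofReal ((1 - Real.exp (-l * s)) * n s) := by
  rw [h.eq_integral l hl, ofReal_integral_eq_lintegral_ofReal (h.integrable l hl)]
  filter_upwards [ae_restrict_mem measurableSet_Ioi] with s hs
  refine mul_nonneg ?_ (h.nonneg s)
  simp only [sub_nonneg, Real.exp_le_one_iff]
  nlinarith [mem_Ioi.1 hs]

theorem lintegral_levyMeasure {l : ℝ} (hl : 0 < l) :
    ∫⁻ s, ENNReal.ofReal (1 - Real.exp (-l * s)) ∂levyMeasure n = ENNReal.ofReal (φ l) := by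
  have := h.measurable
  rw [h.ofReal_eq hl, levyMeasure,
    lintegral_withDensity_eq_lintegral_mul _ (by fun_prop) (by fun_prop)]
  refine lintegral_congr fun s => ?_
  rw [Pi.mul_apply, ← ENNReal.ofReal_mul (h.nonneg s), mul_comm]

theorem laplaceTransform_tailMeasure {l : ℝ} (hl : 0 < l) :
    laplaceTransform (tailMeasure n) l = ENNReal.ofReal l⁻¹ * ENNReal.ofReal (φ l) := by
  rw [tailMeasure, laplaceTransform_tail (levyMeasure_Iio n) hl, h.lintegral_levyMeasure hl]

theorem integrableOn_deriv {l : ℝ} (hl : 0 < l) :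
    IntegrableOn (fun s => s * Real.exp (-l * s) * n s) (Ioi 0) := by
  have := h.measurable
  refine ((h.integrable l hl).const_mul l⁻¹).mono' (by fun_prop) ?_
  filter_upwards [ae_restrict_mem measurableSet_Ioi] with s hs
  have hs : 0 < s := hs
  rw [Real.norm_eq_abs, abs_of_nonneg (mul_nonneg (by positivity) (h.nonneg s)), ← mul_assoc]
  refine mul_le_mul_of_nonneg_right ?_ (h.nonneg s)
  rw [← div_eq_inv_mul, le_div_iff₀ hl]
  have h1 := Real.add_one_le_exp (l * s)
  have h2 : Real.exp (l * s) * Real.exp (-l * s) = 1 := by rw [← Real.exp_add]; simp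
  nlinarith [Real.exp_pos (-l * s)]

theorem hasDerivAt {l : ℝ} (hl : 0 < l) :
    HasDerivAt φ (∫ s in Ioi 0, s * Real.exp (-l * s) * n s) l := by
  have := h.measurable
  have key := (hasDerivAt_integral_of_dominated_loc_of_deriv_le
    (μ := volume.restrict (Ioi (0 : ℝ))) (s := Ioi (l / 2)) (x₀ := l)
    (F := fun l s => (1 - Real.exp (-l * s)) * n s)
    (F' := fun l s => s * Real.exp (-l * s) * n s)
    (bound := fun s => s * Real.exp (-(l / 2) * s) * n s)
    (Ioi_mem_nhds (by linarith)) (Eventually.of_forall fun x => by fun_prop)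
    (h.integrable l hl) (by fun_prop) ?_ (h.integrableOn_deriv (half_pos hl)) ?_).2
  · refine key.congr_of_eventuallyEq ?_
    filter_upwards [Ioi_mem_nhds hl] with x hx using h.eq_integral x hx
  · filter_upwards [ae_restrict_mem measurableSet_Ioi] with s hs x hx
    have hs : 0 < s := hs
    rw [Real.norm_eq_abs, abs_of_nonneg (mul_nonneg (by positivity) (h.nonneg s))]
    refine mul_le_mul_of_nonneg_right (mul_le_mul_of_nonneg_left ?_ hs.le) (h.nonneg s)
    rw [Real.exp_le_exp]
    nlinarith [mem_Ioi.1 hx]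
  · refine ae_of_all _ fun s x _ => ?_
    have := (((((hasDerivAt_id x).neg.mul_const s)).exp).const_sub 1).mul_const (n s)
    refine this.congr_deriv ?_
    simp only [Pi.neg_apply, id]
    ring

theorem laplaceTransform_kMeasure {l : ℝ} (hl : 0 < l) :
    laplaceTransform (kMeasure n) l =
      ENNReal.ofReal (∫ s in Ioi 0, s * Real.exp (-l * s) * n s) := by
  have := h.measurable
  rw [kMeasure, laplaceTransform_withDensity _ (by fun_prop),
    ofReal_integral_eq_lintegral_ofReal (h.integrableOn_deriv hl)]
  · refine setLIntegral_congr_fun measurableSet_Ioi fun s hs => ?_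
    rw [← ENNReal.ofReal_mul (mul_nonneg (le_of_lt hs) (h.nonneg s))]
    congr 1
    ring
  · filter_upwards [ae_restrict_mem measurableSet_Ioi] with s hs
    have hs : 0 < s := hs
    exact mul_nonneg (by positivity) (h.nonneg s)

theorem smul_conv_eq_withDensity {m : Measure ℝ} [IsProbabilityMeasure m] (hm : m (Iio 0) = 0)
    {r : ℝ} (hr : 0 < r)
    (hlap : ∀ l, 0 < l → ∫ s, Real.exp (-l * s) ∂m = Real.exp (-r * φ l)) :
    m.withDensity (fun s => ENNReal.ofReal s) = ENNReal.ofReal r • (kMeasure n).conv m := by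
  have hnn := ae_nonneg_of_Iio_null hm
  have hinteg : ∀ l, 0 < l → Integrable (fun s => Real.exp (-l * s)) m := by
    intro l hl
    by_contra hc
    have := hlap l hl
    rw [integral_undef hc] at this
    exact (Real.exp_pos _).ne this
  have hmem : ∀ l : ℝ, 0 < l → -l ∈ interior (ProbabilityTheory.integrableExpSet id m) := by
    intro l hl
    refine mem_interior.2 ⟨Iio 0, fun x hx => ?_, isOpen_Iio, by simpa using hl⟩
    have := hinteg (-x) (by simpa using hx)
    simpa [ProbabilityTheory.integrableExpSet] using this
  have hlm : ∀ l, 0 < l → laplaceTransform m l = ENNReal.ofReal (Real.exp (-r * φ l)) := by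
    intro l hl
    rw [← hlap l hl, ofReal_integral_eq_lintegral_ofReal (hinteg l hl)
      (ae_of_all _ fun s => (Real.exp_pos _).le)]
    rfl
  have hder : ∀ l, 0 < l → ∫ s, s * Real.exp (-l * s) ∂m =
      r * ((∫ s in Ioi 0, s * Real.exp (-l * s) * n s) * Real.exp (-r * φ l)) := by
    intro l hl
    have h1 := (ProbabilityTheory.hasDerivAt_mgf (hmem l hl)).scomp l (hasDerivAt_neg l)
    have h2 := ((h.hasDerivAt hl).const_mul (-r)).exp
    have h3 := h1.congr_of_eventuallyEq (f₁ := fun l => Real.exp (-r * φ l)) (by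
      filter_upwards [Ioi_mem_nhds hl] with x hx
      rw [← hlap x hx]
      simp [ProbabilityTheory.mgf])
    have h4 := h3.unique h2
    simp only [id, smul_eq_mul] at h4
    linarith
  have hinteg' : ∀ l, 0 < l → Integrable (fun s => s * Real.exp (-l * s)) m := by
    intro l hl
    have := ProbabilityTheory.integrable_pow_mul_exp_of_mem_interior_integrableExpSet (hmem l hl) 1
    simpa using this
  have hL : ∀ l, 0 < l → laplaceTransform (m.withDensity fun s => ENNReal.ofReal s) l =
      ENNReal.ofReal (∫ s, s * Real.exp (-l * s) ∂m) := by
    intro l hl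
    rw [laplaceTransform_withDensity _ (by fun_prop), ofReal_integral_eq_lintegral_ofReal
      (hinteg' l hl) (hnn.mono fun s hs => mul_nonneg hs (Real.exp_pos _).le)]
    exact lintegral_congr fun s => (ENNReal.ofReal_mul' (Real.exp_pos _).le).symm
  refine measure_ext_of_laplaceTransform (withDensity_absolutelyContinuous _ _ hm) ?_
    (fun l hl => by rw [hL l hl]; exact ENNReal.ofReal_ne_top) fun l hl => ?_
  · rw [Measure.smul_apply, conv_Iio_zero (kMeasure_Iio n) hm, smul_zero]
  · rw [hL l hl, hder l hl, laplaceTransform, lintegral_smul_measure, ← laplaceTransform,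
      laplaceTransform_conv, h.laplaceTransform_kMeasure hl, hlm l hl, smul_eq_mul,
      ENNReal.ofReal_mul hr.le, ENNReal.ofReal_mul' (Real.exp_pos _).le]

end IsSelfDecomposableExponent

theorem Real.half_le_one_sub_exp_neg {u : ℝ} (h0 : 0 ≤ u) (h1 : u ≤ 1) :
    u / 2 ≤ 1 - Real.exp (-u) := by
  have h2 := Real.add_one_le_exp u
  have h3 : Real.exp u * Real.exp (-u) = 1 := by rw [← Real.exp_add]; simp
  have h4 := Real.exp_pos (-u)
  nlinarith [mul_nonneg h0 (sub_nonneg.2 h1)]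

theorem levyMeasure_Ioi (n : ℝ → ℝ) {t : ℝ} (ht : 0 < t) :
    levyMeasure n (Ioi t) = ∫⁻ s in Ioi t, ENNReal.ofReal (n s) := by
  rw [levyMeasure, withDensity_apply _ measurableSet_Ioi, Measure.restrict_restrict
    measurableSet_Ioi, Ioi_inter_Ioi, max_eq_left ht.le]

namespace IsSelfDecomposableExponent

variable {φ n : ℝ → ℝ} (h : IsSelfDecomposableExponent φ n)
include h

theorem setLIntegral_mul_density_le {t : ℝ} (ht : 0 < t) :
    ∫⁻ s in Ioc 0 t, ENNReal.ofReal (s * n s) ≤ ENNReal.ofReal (2 * t * φ t⁻¹) := by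
  have := h.measurable
  rw [ENNReal.ofReal_mul (by positivity), h.ofReal_eq (inv_pos.2 ht),
    ← lintegral_const_mul _ (by fun_prop)]
  refine (setLIntegral_mono' measurableSet_Ioc fun s hs => ?_).trans
    (lintegral_mono_set Ioc_subset_Ioi_self)
  rw [← ENNReal.ofReal_mul (by positivity), ← mul_assoc]
  refine ENNReal.ofReal_le_ofReal (mul_le_mul_of_nonneg_right ?_ (h.nonneg s))
  have h1 := Real.half_le_one_sub_exp_neg (u := t⁻¹ * s)
    (mul_nonneg (by positivity) hs.1.le) (by rw [inv_mul_le_iff₀ ht]; linarith [hs.2])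
  have h2 := mul_le_mul_of_nonneg_left h1 (by positivity : 0 ≤ 2 * t)
  rw [neg_mul]
  refine le_trans (le_of_eq ?_) h2
  field_simp

theorem mul_density_le {t : ℝ} (ht : 0 < t) : t * n t ≤ 2 * φ t⁻¹ := by
  have hpos := h.pos _ (inv_pos.2 ht)
  have h1 : ENNReal.ofReal (t * n t) * ENNReal.ofReal t ≤ ENNReal.ofReal (2 * t * φ t⁻¹) := by
    refine le_trans ?_ (h.setLIntegral_mul_density_le ht)
    calc ENNReal.ofReal (t * n t) * ENNReal.ofReal t
        = ∫⁻ s in Ioc 0 t, ENNReal.ofReal (t * n t) := by simp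
      _ ≤ _ := setLIntegral_mono' measurableSet_Ioc fun s hs =>
          ENNReal.ofReal_le_ofReal (h.antitoneOn hs.1 ht hs.2)
  rw [← ENNReal.ofReal_mul (mul_nonneg ht.le (h.nonneg t)),
    ENNReal.ofReal_le_ofReal_iff (by positivity)] at h1
  nlinarith

theorem levyMeasure_Ioi_le {t : ℝ} (ht : 0 < t) :
    levyMeasure n (Ioi t) ≤ ENNReal.ofReal (2 * φ t⁻¹) := by
  have := h.measurable
  rw [levyMeasure_Ioi n ht, ENNReal.ofReal_mul (by positivity), h.ofReal_eq (inv_pos.2 ht),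
    ← lintegral_const_mul _ (by fun_prop)]
  refine (setLIntegral_mono' measurableSet_Ioi fun s hs => ?_).trans
    (lintegral_mono_set (Ioi_subset_Ioi ht.le))
  rw [← ENNReal.ofReal_mul (by positivity), ← mul_assoc]
  refine ENNReal.ofReal_le_ofReal (le_mul_of_one_le_left (h.nonneg s) ?_)
  have h1 := Real.half_le_one_sub_exp_neg (u := 1) (by simp) le_rfl
  have h2 : Real.exp (-t⁻¹ * s) ≤ Real.exp (-1) := by
    rw [Real.exp_le_exp, neg_mul, neg_le_neg_iff, inv_mul_eq_div, one_le_div ht]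
    exact le_of_lt hs
  linarith

theorem le_levyMeasure_Ioi {t : ℝ} (ht : 0 < t) :
    ENNReal.ofReal (2 * t * n (2 * t) / 2) ≤ levyMeasure n (Ioi t) := by
  rw [levyMeasure_Ioi n ht]
  calc ENNReal.ofReal (2 * t * n (2 * t) / 2)
      = ENNReal.ofReal (n (2 * t)) * ENNReal.ofReal t := by
        rw [← ENNReal.ofReal_mul (h.nonneg _)]; congr 1; ring
    _ = ∫⁻ s in Ioc t (2 * t), ENNReal.ofReal (n (2 * t)) := by
        rw [setLIntegral_const, Real.volume_Ioc]; congr 2; ring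
    _ ≤ ∫⁻ s in Ioc t (2 * t), ENNReal.ofReal (n s) := by
        refine setLIntegral_mono' measurableSet_Ioc fun s hs => ENNReal.ofReal_le_ofReal ?_
        have hs0 : 0 < s := ht.trans hs.1
        have h1 : 2 * t * n (2 * t) ≤ s * n s :=
          h.antitoneOn hs0 (by simpa using ht : (0 : ℝ) < 2 * t) hs.2
        have h2 : s * n (2 * t) ≤ 2 * t * n (2 * t) :=
          mul_le_mul_of_nonneg_right hs.2 (h.nonneg _)
        exact le_of_mul_le_mul_left (h2.trans h1) hs0
    _ ≤ _ := lintegral_mono_set Ioc_subset_Ioi_self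

theorem le_add_add {l a b : ℝ} (hl : 0 < l) (ha : 0 < a) (hab : a ≤ b) :
    φ l ≤ 2 * l * a * φ a⁻¹ + n a * b + 2 * φ b⁻¹ := by
  have hm := h.measurable
  have hb := ha.trans_le hab
  have p1 := h.pos _ (inv_pos.2 ha)
  have p2 := h.pos _ (inv_pos.2 hb)
  have p3 := h.nonneg a
  have hu : Ioi (0 : ℝ) = (Ioc 0 a ∪ Ioc a b) ∪ Ioi b := by
    rw [Ioc_union_Ioc_eq_Ioc ha.le hab, Ioc_union_Ioi_eq_Ioi hb.le]
  have e1 : ∫⁻ s in Ioc 0 a, ENNReal.ofReal ((1 - Real.exp (-l * s)) * n s) ≤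
      ENNReal.ofReal (2 * l * a * φ a⁻¹) := by
    calc _ ≤ ∫⁻ s in Ioc 0 a, ENNReal.ofReal l * ENNReal.ofReal (s * n s) := by
          refine setLIntegral_mono' measurableSet_Ioc fun s hs => ?_
          rw [← ENNReal.ofReal_mul hl.le, ← mul_assoc]
          refine ENNReal.ofReal_le_ofReal (mul_le_mul_of_nonneg_right ?_ (h.nonneg s))
          have := Real.add_one_le_exp (-l * s)
          linarith
      _ = ENNReal.ofReal l * ∫⁻ s in Ioc 0 a, ENNReal.ofReal (s * n s) :=
          lintegral_const_mul _ (by fun_prop)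
      _ ≤ ENNReal.ofReal l * ENNReal.ofReal (2 * a * φ a⁻¹) :=
          mul_le_mul_right (h.setLIntegral_mul_density_le ha) _
      _ = _ := by rw [← ENNReal.ofReal_mul hl.le]; congr 1; ring
  have e2 : ∫⁻ s in Ioc a b, ENNReal.ofReal ((1 - Real.exp (-l * s)) * n s) ≤
      ENNReal.ofReal (n a * b) := by
    calc _ ≤ ∫⁻ s in Ioc a b, ENNReal.ofReal (n a) := by
          refine setLIntegral_mono' measurableSet_Ioc fun s hs => ENNReal.ofReal_le_ofReal ?_
          have hs0 : 0 < s := ha.trans hs.1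
          have h1 : s * n s ≤ a * n a := h.antitoneOn ha hs0 hs.1.le
          have h2 : a * n a ≤ s * n a := mul_le_mul_of_nonneg_right hs.1.le p3
          have h3 : n s ≤ n a := le_of_mul_le_mul_left (h1.trans h2) hs0
          have := mul_nonneg (Real.exp_pos (-l * s)).le (h.nonneg s)
          linarith
      _ = ENNReal.ofReal (n a * (b - a)) := by
          rw [setLIntegral_const, Real.volume_Ioc, ENNReal.ofReal_mul p3]
      _ ≤ _ := ENNReal.ofReal_le_ofReal (by nlinarith)
  have e3 : ∫⁻ s in Ioi b, ENNReal.ofReal ((1 - Real.exp (-l * s)) * n s) ≤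
      ENNReal.ofReal (2 * φ b⁻¹) := by
    refine le_trans (setLIntegral_mono' measurableSet_Ioi fun s hs => ?_)
      ((levyMeasure_Ioi n hb).symm.trans_le (h.levyMeasure_Ioi_le hb))
    refine ENNReal.ofReal_le_ofReal ?_
    have := mul_nonneg (Real.exp_pos (-l * s)).le (h.nonneg s)
    linarith
  rw [← ENNReal.ofReal_le_ofReal_iff (by positivity), h.ofReal_eq hl,
    ENNReal.ofReal_add (by positivity) (by positivity),
    ENNReal.ofReal_add (by positivity) (by positivity), hu]
  refine (lintegral_union_le _ _ _).trans (add_le_add ((lintegral_union_le _ _ _).trans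
    (add_le_add e1 e2)) e3)

theorem exists_le_mul_density {β₁ β₂ c c' : ℝ} (hβ₁ : 0 < β₁) (hβ₂ : β₂ < 1) (hc : 0 < c)
    (hc' : 0 < c') (hlow : ∀ l κ, 0 < l → 1 ≤ κ → c * κ ^ β₁ * φ l ≤ φ (κ * l))
    (hup : ∀ l κ, 0 < l → 1 ≤ κ → φ (κ * l) ≤ c' * κ ^ β₂ * φ l) :
    ∃ C, 0 < C ∧ ∀ t, 0 < t → φ t⁻¹ ≤ C * (t * n t) := by
  obtain ⟨E, hE1, hE⟩ : ∃ E : ℝ, 1 ≤ E ∧ 2 * c' * E ^ β₂ / E ≤ 1 / 4 := by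
    have h1 : Tendsto (fun E : ℝ => 2 * c' * E ^ (-(1 - β₂))) atTop (𝓝 (2 * c' * 0)) :=
      (tendsto_rpow_neg_atTop (by linarith)).const_mul _
    rw [mul_zero] at h1
    obtain ⟨E, hE, h2⟩ := ((eventually_ge_atTop (1 : ℝ)).and
      (h1.eventually_le_const (by norm_num : (0 : ℝ) < 1 / 4))).exists
    refine ⟨E, hE, ?_⟩
    rw [neg_sub, Real.rpow_sub_one (by linarith)] at h2
    rwa [mul_div_assoc]
  obtain ⟨A, hA1, hA⟩ : ∃ A : ℝ, 1 ≤ A ∧ 8 ≤ c * A ^ β₁ := by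
    have h1 : Tendsto (fun A : ℝ => c * A ^ β₁) atTop atTop :=
      (tendsto_rpow_atTop hβ₁).const_mul_atTop hc
    obtain ⟨A, hA, h2⟩ := ((eventually_ge_atTop (1 : ℝ)).and (h1.eventually_ge_atTop 8)).exists
    exact ⟨A, hA, h2⟩
  have hE0 : 0 < E := by linarith
  have hA0 : 0 < A := by linarith
  have hEp : 0 < E ^ β₂ := Real.rpow_pos_of_pos hE0 _
  refine ⟨2 * A * E * (c' * E ^ β₂), by positivity, fun t ht => ?_⟩
  have hl : 0 < (E * t)⁻¹ := by positivity
  have hfl := h.pos _ hl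
  have hEt : E * (E * t)⁻¹ = t⁻¹ := by field_simp
  have hAt : A * (E * t * A)⁻¹ = (E * t)⁻¹ := by field_simp
  have s1 := hup (E * t)⁻¹ E hl hE1
  rw [hEt] at s1
  have s2 := hlow (E * t * A)⁻¹ A (by positivity) hA1
  rw [hAt] at s2
  have s3 := h.le_add_add hl ht (b := E * t * A) (by nlinarith [mul_le_mul hE1 hA1 (by simp) hE0.le])
  have q1 : 2 * (E * t)⁻¹ * t * φ t⁻¹ ≤ φ (E * t)⁻¹ / 4 := by
    calc 2 * (E * t)⁻¹ * t * φ t⁻¹ = 2 / E * φ t⁻¹ := by field_simp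
      _ ≤ 2 / E * (c' * E ^ β₂ * φ (E * t)⁻¹) := by gcongr
      _ = 2 * c' * E ^ β₂ / E * φ (E * t)⁻¹ := by ring
      _ ≤ 1 / 4 * φ (E * t)⁻¹ := by gcongr
      _ = _ := by ring
  have q2 : 2 * φ (E * t * A)⁻¹ ≤ φ (E * t)⁻¹ / 4 := by
    have := mul_le_mul_of_nonneg_right hA (h.pos (E * t * A)⁻¹ (by positivity)).le
    linarith
  have q3 : φ (E * t)⁻¹ ≤ 2 * A * E * (t * n t) := by linarith
  calc φ t⁻¹ ≤ c' * E ^ β₂ * φ (E * t)⁻¹ := s1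
    _ ≤ c' * E ^ β₂ * (2 * A * E * (t * n t)) := by gcongr
    _ = _ := by ring

theorem exists_kMeasure_le {c₂ C : ℝ} (hc₂ : 0 < c₂)
    (hup : ∀ l, 0 < l → φ (2 * l) ≤ c₂ * φ l) (hC : 0 < C)
    (hk : ∀ t, 0 < t → φ t⁻¹ ≤ C * (t * n t)) :
    kMeasure n ≤ ENNReal.ofReal (4 * c₂ * C) • tailMeasure n := by
  have hm := h.measurable
  have hanti : Antitone fun s : ℝ => levyMeasure n (Ioi s) :=
    fun a b hab => measure_mono (Ioi_subset_Ioi hab)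
  rw [kMeasure, tailMeasure, ← withDensity_smul _ hanti.measurable]
  refine withDensity_mono ?_
  filter_upwards [ae_restrict_mem measurableSet_Ioi] with s hs
  have hs : 0 < s := hs
  refine le_trans ?_ (mul_le_mul_right (h.le_levyMeasure_Ioi hs) _)
  rw [← ENNReal.ofReal_mul (by positivity)]
  refine ENNReal.ofReal_le_ofReal ?_
  have h1 := h.mul_density_le hs
  have h2 := hup (2 * s)⁻¹ (by positivity)
  have h3 := hk (2 * s) (by positivity)
  have h4 : 2 * (2 * s)⁻¹ = s⁻¹ := by field_simp
  rw [h4] at h2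
  have h5 := mul_le_mul_of_nonneg_left h3 hc₂.le
  linarith

end IsSelfDecomposableExponent

/-- `κ r` is the law at time `r > 0` of a subordinator with Laplace exponent `φ`. -/
structure IsSubordinatorLaw (φ : ℝ → ℝ) (κ : ℝ → Measure ℝ) : Prop where
  measurable : Measurable κ
  isProbabilityMeasure : ∀ r, IsProbabilityMeasure (κ r)
  Iio_zero : ∀ r, κ r (Iio 0) = 0
  laplaceTransform_eq : ∀ r, 0 < r → ∀ l, 0 < l →
    laplaceTransform (κ r) l = ENNReal.ofReal (Real.exp (-r * φ l))

/-- The measure `∫₀^∞ r ^ j κ r dr`. -/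
noncomputable def potentialMeasure (κ : ℝ → Measure ℝ) (j : ℕ) : Measure ℝ :=
  ((volume.restrict (Ioi 0)).withDensity fun r => ENNReal.ofReal (r ^ j)).bind κ

theorem lintegral_pow_mul_exp_neg {c : ℝ} (hc : 0 < c) (j : ℕ) :
    ∫⁻ r in Ioi 0, ENNReal.ofReal (r ^ j) * ENNReal.ofReal (Real.exp (-r * c)) =
      ENNReal.ofReal (j.factorial / c ^ (j + 1)) := by
  have h1 := Real.integral_rpow_mul_exp_neg_mul_Ioi (a := (j : ℝ) + 1) (by positivity) hc
  have h2 : ∀ r ∈ Ioi (0 : ℝ), r ^ ((j : ℝ) + 1 - 1) * Real.exp (-(c * r)) =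
      r ^ j * Real.exp (-r * c) := by
    intro r _
    rw [add_sub_cancel_right, Real.rpow_natCast]
    congr 2
    ring
  rw [setIntegral_congr_fun measurableSet_Ioi h2, Real.Gamma_nat_eq_factorial] at h1
  have h3 : (1 / c) ^ ((j : ℝ) + 1) * (j.factorial : ℝ) = j.factorial / c ^ (j + 1) := by
    rw [show (j : ℝ) + 1 = ((j + 1 : ℕ) : ℝ) by push_cast; ring, Real.rpow_natCast]
    simp [div_eq_mul_inv, mul_comm]
  rw [h3] at h1
  have h4 : IntegrableOn (fun r : ℝ => r ^ j * Real.exp (-r * c)) (Ioi 0) := by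
    by_contra hcon
    rw [integral_undef hcon] at h1
    have : 0 < (j.factorial : ℝ) / c ^ (j + 1) := by positivity
    exact this.ne h1
  rw [← h1, ofReal_integral_eq_lintegral_ofReal h4]
  · exact lintegral_congr fun r => (ENNReal.ofReal_mul' (Real.exp_pos _).le).symm
  · filter_upwards [ae_restrict_mem measurableSet_Ioi] with r hr
    have hr : 0 < r := hr
    positivity

theorem le_liminf_average {g : ℝ → ℝ≥0∞} (hg : Continuous g) (t : ℝ) {δ : ℕ → ℝ}
    (hδ : ∀ i, 0 < δ i) (hδ0 : Tendsto δ atTop (𝓝 0)) :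
    g t ≤ liminf (fun i => ENNReal.ofReal (δ i)⁻¹ * ∫⁻ s in Ioo t (t + δ i), g s) atTop := by
  refine le_of_forall_lt fun c hc => ?_
  obtain ⟨c', hcc', hc'⟩ := exists_between hc
  refine hcc'.trans_le ?_
  obtain ⟨ε, hε, hball⟩ := Metric.eventually_nhds_iff.1 (hg.continuousAt.eventually_const_lt hc')
  refine le_liminf_of_le (by isBoundedDefault) ?_
  filter_upwards [hδ0.eventually_lt_const hε] with i hi
  have h1 : c' * ENNReal.ofReal (δ i) ≤ ∫⁻ s in Ioo t (t + δ i), g s := by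
    calc c' * ENNReal.ofReal (δ i) = ∫⁻ s in Ioo t (t + δ i), c' := by simp
      _ ≤ _ := setLIntegral_mono' measurableSet_Ioo fun s hs => (hball (by
          rw [Real.dist_eq, abs_of_pos (by linarith [hs.1])]; linarith [hs.2])).le
  calc c' = ENNReal.ofReal (δ i)⁻¹ * (c' * ENNReal.ofReal (δ i)) := by
        rw [mul_comm c', ← mul_assoc, ← ENNReal.ofReal_mul (inv_pos.2 (hδ i)).le,
          inv_mul_cancel₀ (hδ i).ne', ENNReal.ofReal_one, one_mul]
    _ ≤ _ := mul_le_mul_right h1 _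

theorem le_of_forall_mul_le_setLIntegral {g : ℝ → ℝ≥0∞} (hg : Continuous g) {t T : ℝ} (hT : 0 < T)
    {c : ℝ≥0∞}
    (hc : ∀ δ, 0 < δ → δ ≤ T → c * ENNReal.ofReal δ ≤ ∫⁻ s in Ioo t (t + δ), g s) : c ≤ g t := by
  refine le_of_forall_gt_imp_ge_of_dense fun c' hc' => ?_
  obtain ⟨ε, hε, hball⟩ := Metric.eventually_nhds_iff.1 (hg.continuousAt.eventually_lt_const hc')
  have hδ : 0 < min ε T := lt_min hε hT
  have h1 : ∫⁻ s in Ioo t (t + min ε T), g s ≤ c' * ENNReal.ofReal (min ε T) := by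
    calc _ ≤ ∫⁻ s in Ioo t (t + min ε T), c' :=
          setLIntegral_mono' measurableSet_Ioo fun s hs => (hball (by
            rw [Real.dist_eq, abs_of_pos (by linarith [hs.1])]
            linarith [hs.2, min_le_left ε T])).le
      _ = _ := by simp
  exact (ENNReal.mul_le_mul_iff_left (ENNReal.ofReal_pos.2 hδ).ne' ENNReal.ofReal_ne_top).1
    ((hc _ hδ (min_le_right _ _)).trans h1)

namespace IsSubordinatorLaw

variable {φ n : ℝ → ℝ} {κ : ℝ → Measure ℝ} (hκ : IsSubordinatorLaw φ κ)
include hκ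

theorem sfinite_potentialMeasure (j : ℕ) : SFinite (potentialMeasure κ j) := by
  have := hκ.isProbabilityMeasure
  let K : ProbabilityTheory.Kernel ℝ ℝ := ⟨κ, hκ.measurable⟩
  have : ProbabilityTheory.IsMarkovKernel K := ⟨this⟩
  exact inferInstanceAs (SFinite (Measure.bind _ K))

theorem lintegral_potentialMeasure (j : ℕ) {g : ℝ → ℝ≥0∞} (hg : Measurable g) :
    ∫⁻ s, g s ∂potentialMeasure κ j =
      ∫⁻ r in Ioi 0, ENNReal.ofReal (r ^ j) * ∫⁻ s, g s ∂κ r := by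
  have hm : Measurable fun r => ∫⁻ s, g s ∂κ r :=
    (Measure.measurable_lintegral hg).comp hκ.measurable
  rw [potentialMeasure, Measure.lintegral_bind hκ.measurable.aemeasurable hg.aemeasurable,
    lintegral_withDensity_eq_lintegral_mul _ (by fun_prop) hm]
  rfl

theorem potentialMeasure_apply (j : ℕ) {s : Set ℝ} (hs : MeasurableSet s) :
    potentialMeasure κ j s = ∫⁻ r in Ioi 0, ENNReal.ofReal (r ^ j) * κ r s := by
  simpa [lintegral_indicator_one hs] using
    hκ.lintegral_potentialMeasure j (measurable_one.indicator hs)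

theorem potentialMeasure_Iio (j : ℕ) : potentialMeasure κ j (Iio 0) = 0 := by
  simp [hκ.potentialMeasure_apply j measurableSet_Iio, hκ.Iio_zero]

theorem laplaceTransform_potentialMeasure (j : ℕ) {l : ℝ} (hl : 0 < l) (hφ : 0 < φ l) :
    laplaceTransform (potentialMeasure κ j) l =
      ENNReal.ofReal (j.factorial / φ l ^ (j + 1)) := by
  rw [laplaceTransform, hκ.lintegral_potentialMeasure j (by fun_prop),
    ← lintegral_pow_mul_exp_neg hφ]
  refine setLIntegral_congr_fun measurableSet_Ioi fun r hr => ?_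
  rw [← hκ.laplaceTransform_eq r hr l hl]
  rfl

theorem conv_potentialMeasure_apply (m : Measure ℝ) [SFinite m] (j : ℕ) {s : Set ℝ}
    (hs : MeasurableSet s) :
    m.conv (potentialMeasure κ j) s =
      ∫⁻ r in Ioi 0, ENNReal.ofReal (r ^ j) * m.conv (κ r) s := by
  have := hκ.isProbabilityMeasure
  have := hκ.sfinite_potentialMeasure j
  rw [conv_apply_eq_lintegral _ _ hs, hκ.lintegral_potentialMeasure j]
  · simp_rw [conv_apply_eq_lintegral m (κ _) hs]
  · have : MeasurableSet {p : ℝ × ℝ | p.2 + p.1 ∈ s} := hs.preimage (by fun_prop)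
    exact measurable_measure_prodMk_left this

theorem tailMeasure_conv_potentialMeasure (h : IsSelfDecomposableExponent φ n) :
    (tailMeasure n).conv (potentialMeasure κ 2) =
      (2 : ℝ≥0∞) • (volume.restrict (Ioi 0)).conv (potentialMeasure κ 1) := by
  have := hκ.sfinite_potentialMeasure
  have hvol : (volume.restrict (Ioi (0 : ℝ))) (Iio 0) = 0 := by
    simpa using withDensity_Ioi_null 1
  have hL : ∀ l, 0 < l → laplaceTransform ((tailMeasure n).conv (potentialMeasure κ 2)) l =
      ENNReal.ofReal (2 * (l⁻¹ * (1 / φ l ^ 2))) := by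
    intro l hl
    have hφ := h.pos l hl
    rw [laplaceTransform_conv, h.laplaceTransform_tailMeasure hl,
      hκ.laplaceTransform_potentialMeasure 2 hl hφ, ← ENNReal.ofReal_mul (by positivity),
      ← ENNReal.ofReal_mul (by positivity)]
    congr 1
    norm_num
    field_simp
  refine measure_ext_of_laplaceTransform
    (conv_Iio_zero (tailMeasure_Iio n) (hκ.potentialMeasure_Iio 2)) ?_
    (fun l hl => by rw [hL l hl]; exact ENNReal.ofReal_ne_top) fun l hl => ?_
  · rw [Measure.smul_apply, conv_Iio_zero hvol (hκ.potentialMeasure_Iio 1), smul_zero]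
  · have hφ := h.pos l hl
    rw [hL l hl, laplaceTransform, lintegral_smul_measure, ← laplaceTransform,
      laplaceTransform_conv, laplaceTransform_volume_Ioi hl,
      hκ.laplaceTransform_potentialMeasure 1 hl hφ, smul_eq_mul,
      ENNReal.ofReal_mul (by positivity), ENNReal.ofReal_mul (by positivity)]
    simp

theorem setLIntegral_eq_conv (h : IsSelfDecomposableExponent φ n) {r : ℝ} (hr : 0 < r) {s : Set ℝ}
    (hs : MeasurableSet s) :
    ∫⁻ u in s, ENNReal.ofReal u ∂κ r = ENNReal.ofReal r * (kMeasure n).conv (κ r) s := by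
  have := hκ.isProbabilityMeasure r
  rw [← withDensity_apply _ hs, h.smul_conv_eq_withDensity (hκ.Iio_zero r) hr, Measure.smul_apply,
    smul_eq_mul]
  intro l hl
  rw [integral_eq_lintegral_of_nonneg_ae (ae_of_all _ fun s => (Real.exp_pos _).le) (by fun_prop)]
  have := hκ.laplaceTransform_eq r hr l hl
  rw [laplaceTransform] at this
  rw [this, ENNReal.toReal_ofReal (Real.exp_pos _).le]

theorem potentialMeasure_Ioo_le (h : IsSelfDecomposableExponent φ n) {C : ℝ} (hC : 0 < C)
    (hk : kMeasure n ≤ ENNReal.ofReal C • tailMeasure n) {a b : ℝ} (ha : 0 < a) (hab : a < b) :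
    potentialMeasure κ 1 (Ioo a b) ≤
      ENNReal.ofReal (2 * Real.exp 1 * C * (b - a) / (a * φ b⁻¹ ^ 2)) := by
  have hsf := hκ.sfinite_potentialMeasure
  have hp := hκ.isProbabilityMeasure
  have hb := ha.trans hab
  have hφ := h.pos _ (inv_pos.2 hb)
  have h1 : ∀ r, 0 < r → ENNReal.ofReal a * κ r (Ioo a b) ≤
      ENNReal.ofReal r * (ENNReal.ofReal C * (tailMeasure n).conv (κ r) (Ioo a b)) := by
    intro r hr
    calc ENNReal.ofReal a * κ r (Ioo a b) = ∫⁻ u in Ioo a b, ENNReal.ofReal a ∂κ r := by simp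
      _ ≤ ∫⁻ u in Ioo a b, ENNReal.ofReal u ∂κ r :=
          setLIntegral_mono' measurableSet_Ioo fun u hu => ENNReal.ofReal_le_ofReal hu.1.le
      _ = ENNReal.ofReal r * (kMeasure n).conv (κ r) (Ioo a b) :=
          hκ.setLIntegral_eq_conv h hr measurableSet_Ioo
      _ ≤ _ := by
          refine mul_le_mul_right ?_ _
          rw [conv_apply_eq_lintegral _ _ measurableSet_Ioo,
            conv_apply_eq_lintegral _ _ measurableSet_Ioo,
            ← lintegral_const_mul' _ _ ENNReal.ofReal_ne_top]
          exact lintegral_mono fun y => hk _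
  have h2 : ENNReal.ofReal a * potentialMeasure κ 1 (Ioo a b) ≤
      ENNReal.ofReal C * (tailMeasure n).conv (potentialMeasure κ 2) (Ioo a b) := by
    rw [hκ.potentialMeasure_apply 1 measurableSet_Ioo,
      hκ.conv_potentialMeasure_apply _ 2 measurableSet_Ioo,
      ← lintegral_const_mul' _ _ ENNReal.ofReal_ne_top,
      ← lintegral_const_mul' _ _ ENNReal.ofReal_ne_top]
    refine setLIntegral_mono' measurableSet_Ioi fun r hr => ?_
    have hr : 0 < r := hr
    calc ENNReal.ofReal a * (ENNReal.ofReal (r ^ 1) * κ r (Ioo a b))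
        = ENNReal.ofReal r * (ENNReal.ofReal a * κ r (Ioo a b)) := by rw [pow_one]; ring
      _ ≤ ENNReal.ofReal r *
          (ENNReal.ofReal r * (ENNReal.ofReal C * (tailMeasure n).conv (κ r) (Ioo a b))) :=
          mul_le_mul_right (h1 r hr) _
      _ = _ := by rw [ENNReal.ofReal_pow hr.le]; ring
  have h3 : (volume.restrict (Ioi 0)).conv (potentialMeasure κ 1) (Ioo a b) ≤
      ENNReal.ofReal (b - a) * potentialMeasure κ 1 (Iic b) := by
    rw [conv_apply_eq_lintegral _ _ measurableSet_Ioo, ← lintegral_indicator_const measurableSet_Iic]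
    refine lintegral_mono fun y => ?_
    rw [preimage_add_const_Ioo]
    by_cases hy : y ∈ Iic b
    · rw [indicator_of_mem hy]
      refine (Measure.restrict_apply_le _ _).trans ?_
      rw [Real.volume_Ioo]
      exact ENNReal.ofReal_le_ofReal (by linarith)
    · rw [indicator_of_notMem hy, Measure.restrict_apply measurableSet_Ioo]
      have he : Ioo (a - y) (b - y) ∩ Ioi 0 = ∅ := by
        refine eq_empty_iff_forall_notMem.2 ?_
        rintro x ⟨⟨_, h6⟩, h7⟩
        simp only [mem_Iic, not_le] at hy
        simp only [mem_Ioi] at h7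
        linarith
      simp [he]
  have h4 := measure_Iic_le_laplaceTransform (potentialMeasure κ 1) hb
  rw [hκ.laplaceTransform_potentialMeasure 1 (inv_pos.2 hb) hφ] at h4
  rw [hκ.tailMeasure_conv_potentialMeasure h, Measure.smul_apply, smul_eq_mul] at h2
  have h5 : ENNReal.ofReal a * potentialMeasure κ 1 (Ioo a b) ≤
      ENNReal.ofReal a * ENNReal.ofReal (2 * Real.exp 1 * C * (b - a) / (a * φ b⁻¹ ^ 2)) := by
    refine h2.trans ?_
    calc _ ≤ ENNReal.ofReal C * (2 * (ENNReal.ofReal (b - a) * (ENNReal.ofReal (Real.exp 1) *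
          ENNReal.ofReal ((Nat.factorial 1 : ℝ) / φ b⁻¹ ^ (1 + 1))))) := by
            gcongr
            exact h3.trans (by gcongr)
      _ = _ := by
        have hba : 0 ≤ b - a := by linarith
        rw [← ENNReal.ofReal_ofNat 2, ← ENNReal.ofReal_mul (by positivity),
          ← ENNReal.ofReal_mul hba, ← ENNReal.ofReal_mul (by positivity),
          ← ENNReal.ofReal_mul (by positivity), ← ENNReal.ofReal_mul (by positivity)]
        congr 1
        simp only [Nat.factorial_one, Nat.cast_one]
        generalize φ b⁻¹ = F at hφ
        field_simp
  exact (ENNReal.mul_le_mul_iff_right (ENNReal.ofReal_pos.2 ha).ne' ENNReal.ofReal_ne_top).1 h5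

end IsSubordinatorLaw

namespace IsSelfDecomposableExponent

variable {φ n : ℝ → ℝ} (h : IsSelfDecomposableExponent φ n)
include h

theorem monotoneOn : MonotoneOn φ (Ioi 0) := by
  intro l hl l' hl' hll'
  rw [h.eq_integral l hl, h.eq_integral l' hl']
  refine setIntegral_mono_on (h.integrable l hl) (h.integrable l' hl') measurableSet_Ioi
    fun s hs => ?_
  have hs : 0 < s := hs
  have := h.nonneg s
  gcongr

end IsSelfDecomposableExponent

namespace IsSubordinatorLaw

variable {φ n : ℝ → ℝ} {κ : ℝ → Measure ℝ} (hκ : IsSubordinatorLaw φ κ)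
include hκ

theorem half_le_measure_Iic {r t : ℝ} (hr : 0 < r) (ht : 0 < t) (hrt : r * φ t⁻¹ ≤ 1 / 4) :
    ENNReal.ofReal (1 / 2) ≤ κ r (Iic t) := by
  have := hκ.isProbabilityMeasure r
  have h1 : ENNReal.ofReal (3 / 4) ≤
      ENNReal.ofReal (1 / 2) * κ r (Iic t) + ENNReal.ofReal (1 / 2) := by
    calc ENNReal.ofReal (3 / 4) ≤ laplaceTransform (κ r) t⁻¹ := by
          rw [hκ.laplaceTransform_eq r hr _ (inv_pos.2 ht)]
          refine ENNReal.ofReal_le_ofReal ?_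
          linarith [Real.add_one_le_exp (-r * φ t⁻¹)]
      _ ≤ ∫⁻ s, ((Iic t).indicator (fun _ => ENNReal.ofReal (1 / 2)) s + ENNReal.ofReal (1 / 2))
            ∂κ r := by
          refine lintegral_mono_ae ?_
          filter_upwards [ae_nonneg_of_Iio_null (hκ.Iio_zero r)] with s hs
          by_cases hst : s ∈ Iic t
          · rw [indicator_of_mem hst, ← ENNReal.ofReal_add (by norm_num) (by norm_num)]
            refine ENNReal.ofReal_le_ofReal ?_
            have : 0 ≤ t⁻¹ * s := by positivity
            have : Real.exp (-t⁻¹ * s) ≤ 1 := by rw [Real.exp_le_one_iff]; linarith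
            linarith
          · rw [indicator_of_notMem hst, zero_add]
            refine ENNReal.ofReal_le_ofReal ?_
            simp only [mem_Iic, not_le] at hst
            have h2 : 1 ≤ t⁻¹ * s := by rw [le_inv_mul_iff₀ ht]; linarith
            have h3 := Real.half_le_one_sub_exp_neg zero_le_one le_rfl
            have h4 : Real.exp (-t⁻¹ * s) ≤ Real.exp (-1) := Real.exp_le_exp.2 (by linarith)
            linarith
      _ = _ := by
          rw [lintegral_add_right _ measurable_const, lintegral_indicator_const measurableSet_Iic]
          simp
  have h2 := measure_ne_top (κ r) (Iic t)
  rw [← ENNReal.ofReal_toReal h2] at h1 ⊢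
  rw [← ENNReal.ofReal_mul (by norm_num), ← ENNReal.ofReal_add (by positivity) (by norm_num),
    ENNReal.ofReal_le_ofReal_iff (by positivity)] at h1
  exact ENNReal.ofReal_le_ofReal (by linarith)

theorem le_density (h : IsSelfDecomposableExponent φ n) {r t : ℝ} (hr : 0 < r) (ht : 0 < t)
    (hrt : r * φ t⁻¹ ≤ 1 / 4) {g : ℝ → ℝ≥0∞} (hg : Continuous g)
    (hgκ : ∀ a b, 0 ≤ a → κ r (Ioo a b) = ∫⁻ s in Ioo a b, g s) :
    ENNReal.ofReal (r * n (2 * t) / 2) ≤ g t := by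
  have := hκ.isProbabilityMeasure r
  have hn := h.nonneg (2 * t)
  refine le_of_forall_mul_le_setLIntegral hg ht fun δ hδ hδt => ?_
  rw [← hgκ _ _ ht.le]
  have h1 : ENNReal.ofReal (2 * t * n (2 * t)) * ENNReal.ofReal δ * κ r (Iic t) ≤
      (kMeasure n).conv (κ r) (Ioo t (t + δ)) := by
    rw [conv_apply_eq_lintegral _ _ measurableSet_Ioo, ← lintegral_indicator_const measurableSet_Iic]
    refine lintegral_mono_ae ?_
    filter_upwards [ae_nonneg_of_Iio_null (hκ.Iio_zero r)] with y hy
    by_cases hyt : y ∈ Iic t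
    · rw [indicator_of_mem hyt, preimage_add_const_Ioo, kMeasure,
        withDensity_apply _ measurableSet_Ioo, Measure.restrict_restrict measurableSet_Ioo]
      simp only [mem_Iic] at hyt
      have he : Ioo (t - y) (t + δ - y) ∩ Ioi 0 = Ioo (t - y) (t + δ - y) :=
        inter_eq_left.2 fun x hx => lt_of_le_of_lt (sub_nonneg.2 hyt) hx.1
      rw [he]
      calc _ = ∫⁻ s in Ioo (t - y) (t + δ - y), ENNReal.ofReal (2 * t * n (2 * t)) := by
            rw [setLIntegral_const, Real.volume_Ioo]
            congr 2
            ring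
        _ ≤ _ := setLIntegral_mono' measurableSet_Ioo fun s hs => ENNReal.ofReal_le_ofReal <|
            h.antitoneOn (show 0 < s by linarith [hs.1]) (show 0 < 2 * t by linarith)
              (by linarith [hs.2])
    · simp [hyt]
  have h2 : ENNReal.ofReal r * (kMeasure n).conv (κ r) (Ioo t (t + δ)) ≤
      ENNReal.ofReal (2 * t) * κ r (Ioo t (t + δ)) := by
    rw [← hκ.setLIntegral_eq_conv h hr measurableSet_Ioo]
    calc _ ≤ ∫⁻ u in Ioo t (t + δ), ENNReal.ofReal (2 * t) ∂κ r :=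
          setLIntegral_mono' measurableSet_Ioo fun u hu =>
            ENNReal.ofReal_le_ofReal (by linarith [hu.2])
      _ = _ := by simp
  have h3 : ENNReal.ofReal (2 * t) * (ENNReal.ofReal (r * n (2 * t) / 2) * ENNReal.ofReal δ) ≤
      ENNReal.ofReal (2 * t) * κ r (Ioo t (t + δ)) := by
    refine le_trans ?_ h2
    calc _ = ENNReal.ofReal r * (ENNReal.ofReal (2 * t * n (2 * t)) * ENNReal.ofReal δ *
          ENNReal.ofReal (1 / 2)) := by
          rw [← ENNReal.ofReal_mul (by positivity), ← ENNReal.ofReal_mul (by positivity),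
            ← ENNReal.ofReal_mul (by positivity), ← ENNReal.ofReal_mul (by positivity),
            ← ENNReal.ofReal_mul (by positivity)]
          congr 1
          ring
      _ ≤ _ := mul_le_mul_right
          ((mul_le_mul_right (hκ.half_le_measure_Iic hr ht hrt) _).trans h1) _
  exact (ENNReal.mul_le_mul_iff_right (ENNReal.ofReal_pos.2 (by positivity)).ne'
    ENNReal.ofReal_ne_top).1 h3

theorem lintegral_mul_density_le (h : IsSelfDecomposableExponent φ n) {c₂ C : ℝ} (hc₂ : 0 < c₂)
    (hup : ∀ l, 0 < l → φ (2 * l) ≤ c₂ * φ l) (hC : 0 < C)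
    (hk : kMeasure n ≤ ENNReal.ofReal C • tailMeasure n) {g : ℝ → ℝ → ℝ≥0∞}
    (hg : ∀ r, 0 < r → Continuous (g r))
    (hgκ : ∀ r, 0 < r → ∀ a b, 0 ≤ a → κ r (Ioo a b) = ∫⁻ s in Ioo a b, g r s)
    {t : ℝ} (ht : 0 < t) :
    ∫⁻ r in Ioi 0, ENNReal.ofReal r * g r t ≤
      ENNReal.ofReal (2 * Real.exp 1 * C * c₂ ^ 2 / (t * φ t⁻¹ ^ 2)) := by
  have hφ := h.pos _ (inv_pos.2 ht)
  let δ : ℕ → ℝ := fun i => t * (1 / ((i : ℝ) + 1))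
  have hδ : ∀ i, 0 < δ i := fun i => by positivity
  have hδt : ∀ i, δ i ≤ t := fun i =>
    mul_le_of_le_one_right ht.le
      (by rw [div_le_one (by positivity)]; linarith [Nat.cast_nonneg (α := ℝ) i])
  have hδ0 : Tendsto δ atTop (𝓝 0) := by
    simpa only [mul_zero] using (tendsto_one_div_add_atTop_nhds_zero_nat (𝕜 := ℝ)).const_mul t
  let G : ℕ → ℝ → ℝ≥0∞ := fun i r =>
    ENNReal.ofReal (δ i)⁻¹ * (ENNReal.ofReal (r ^ 1) * κ r (Ioo t (t + δ i)))
  have hGm : ∀ i, Measurable (G i) := fun i => by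
    have := (Measure.measurable_coe (measurableSet_Ioo (a := t) (b := t + δ i))).comp hκ.measurable
    exact Measurable.const_mul (Measurable.mul (by fun_prop) this) _
  have hG : ∀ i, ∫⁻ r in Ioi 0, G i r ≤
      ENNReal.ofReal (2 * Real.exp 1 * C * c₂ ^ 2 / (t * φ t⁻¹ ^ 2)) := by
    intro i
    have hb : 0 < t + δ i := by linarith [hδ i]
    rw [lintegral_const_mul' _ _ ENNReal.ofReal_ne_top,
      ← hκ.potentialMeasure_apply 1 measurableSet_Ioo]
    refine (mul_le_mul_right (hκ.potentialMeasure_Ioo_le h hC hk ht (b := t + δ i)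
      (by linarith [hδ i])) _).trans ?_
    rw [← ENNReal.ofReal_mul (inv_pos.2 (hδ i)).le]
    refine ENNReal.ofReal_le_ofReal ?_
    have h1 : φ t⁻¹ ≤ c₂ * φ (t + δ i)⁻¹ := by
      have h2 := hup (2 * t)⁻¹ (by positivity)
      rw [show 2 * (2 * t)⁻¹ = t⁻¹ by field_simp] at h2
      refine h2.trans (mul_le_mul_of_nonneg_left ?_ hc₂.le)
      exact h.monotoneOn (show 0 < (2 * t)⁻¹ by positivity) (inv_pos.2 hb)
        (inv_anti₀ hb (by linarith [hδt i]))
    have hφb := h.pos _ (inv_pos.2 hb)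
    have hδi := hδ i
    rw [add_sub_cancel_left]
    generalize φ (t + δ i)⁻¹ = F at h1 hφb ⊢
    generalize φ t⁻¹ = F' at hφ h1 ⊢
    generalize δ i = d at hδi ⊢
    rw [show d⁻¹ * (2 * Real.exp 1 * C * d / (t * F ^ 2)) =
      (2 * Real.exp 1 * C) / (t * F ^ 2) by field_simp]
    rw [div_le_div_iff₀ (by positivity) (by positivity)]
    have h5 : F' ^ 2 ≤ (c₂ * F) ^ 2 := by gcongr
    have h6 := mul_le_mul_of_nonneg_left h5 (by positivity : 0 ≤ 2 * Real.exp 1 * C * t)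
    linarith
  calc ∫⁻ r in Ioi 0, ENNReal.ofReal r * g r t
      ≤ ∫⁻ r in Ioi 0, liminf (fun i => G i r) atTop := by
        refine setLIntegral_mono' measurableSet_Ioi fun r hr => ?_
        have hr : 0 < r := hr
        have h1 := mul_le_mul_right (le_liminf_average (hg r hr) t hδ hδ0) (ENNReal.ofReal r)
        refine h1.trans_eq ?_
        rw [← ENNReal.liminf_const_mul_of_ne_top ENNReal.ofReal_ne_top]
        congr 1
        ext i
        simp only [G]
        rw [← hgκ r hr _ _ ht.le, pow_one]
        ring
    _ ≤ liminf (fun i => ∫⁻ r in Ioi 0, G i r) atTop := lintegral_liminf_le hGm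
    _ ≤ liminf (fun _ : ℕ => ENNReal.ofReal (2 * Real.exp 1 * C * c₂ ^ 2 / (t * φ t⁻¹ ^ 2)))
          atTop := liminf_le_liminf (Eventually.of_forall hG)
    _ = _ := liminf_const _

end IsSubordinatorLaw

theorem isSelfDecomposableExponent_of_levyMeasure {ν : Measure ℝ} {φ n : ℝ → ℝ}
    (hφ : ∀ l : ℝ, 0 < l → φ l = ∫ x in Ioi 0, (1 - Real.exp (-l * x)) ∂ν)
    (hφ0 : ∀ l, 0 < l → φ l ≠ 0) (hn : ∀ t, 0 ≤ n t) (hm : Measurable n)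
    (hν : ∀ A, MeasurableSet A → ν A = ∫⁻ x in A ∩ Ioi 0, ENNReal.ofReal (n x))
    (hanti : AntitoneOn (fun t => t * n t) (Ioi 0)) : IsSelfDecomposableExponent φ n := by
  have hνn : ν.restrict (Ioi 0) = levyMeasure n := by
    ext A hA
    rw [Measure.restrict_apply hA, hν _ (hA.inter measurableSet_Ioi), inter_assoc, inter_self,
      levyMeasure, withDensity_apply _ hA, Measure.restrict_restrict hA]
  have hfin : ∀ᵐ x ∂volume.restrict (Ioi (0 : ℝ)), ENNReal.ofReal (n x) < ⊤ :=
    ae_of_all _ fun _ => ENNReal.ofReal_lt_top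
  have hnn : ∀ l : ℝ, 0 < l → ∀ x ∈ Ioi (0 : ℝ), 0 ≤ 1 - Real.exp (-l * x) := by
    intro l hl x hx
    have : 0 < l * x := mul_pos hl hx
    rw [sub_nonneg, Real.exp_le_one_iff]
    linarith
  have hmul : ∀ l x : ℝ, (ENNReal.ofReal (n x)).toReal • (1 - Real.exp (-l * x)) =
      (1 - Real.exp (-l * x)) * n x := fun l x => by
    rw [ENNReal.toReal_ofReal (hn x), smul_eq_mul, mul_comm]
  have heq : ∀ l, 0 < l → φ l = ∫ s in Ioi 0, (1 - Real.exp (-l * s)) * n s := by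
    intro l hl
    rw [hφ l hl, hνn, levyMeasure, integral_withDensity_eq_integral_toReal_smul (by fun_prop) hfin]
    simp_rw [hmul]
  refine ⟨hn, hm, hanti, fun l hl => ?_, fun l hl => ?_, heq⟩
  · refine lt_of_le_of_ne ?_ (hφ0 l hl).symm
    rw [heq l hl]
    exact setIntegral_nonneg measurableSet_Ioi fun x hx => mul_nonneg (hnn l hl x hx) (hn x)
  · by_contra hcon
    exact hφ0 l hl (by rw [heq l hl, integral_undef hcon])

theorem isSubordinatorLaw_ite {φ : ℝ → ℝ} {m : ℝ → Measure ℝ}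
    (hprob : ∀ r, 0 < r → IsProbabilityMeasure (m r)) (hm : ∀ r, 0 < r → m r (Iio 0) = 0)
    (hlap : ∀ r, 0 < r → ∀ l, 0 < l → ∫ s, Real.exp (-l * s) ∂m r = Real.exp (-r * φ l)) :
    IsSubordinatorLaw φ fun r => if 0 < r then m r else Measure.dirac 0 := by
  have h1 : ∀ r, IsProbabilityMeasure (if 0 < r then m r else Measure.dirac 0) := by
    intro r
    split_ifs with hr
    · exact hprob r hr
    · infer_instance
  have h2 : ∀ r, (if 0 < r then m r else Measure.dirac 0) (Iio (0 : ℝ)) = 0 := by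
    intro r
    split_ifs with hr
    · exact hm r hr
    · simp
  have h3 : ∀ r, 0 < r → ∀ l, 0 < l →
      laplaceTransform (m r) l = ENNReal.ofReal (Real.exp (-r * φ l)) := by
    intro r hr l hl
    have hinteg : Integrable (fun s => Real.exp (-l * s)) (m r) := by
      by_contra hcon
      have := hlap r hr l hl
      rw [integral_undef hcon] at this
      exact (Real.exp_pos _).ne this
    rw [← hlap r hr l hl, ofReal_integral_eq_lintegral_ofReal hinteg
      (ae_of_all _ fun s => (Real.exp_pos _).le)]
    rfl
  refine ⟨measurable_measure_of_laplaceTransform h2 fun l hl => ?_, h1, h2, fun r hr l hl => ?_⟩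
  · have : (fun r => laplaceTransform (if 0 < r then m r else Measure.dirac 0) l) =
        fun r => if 0 < r then ENNReal.ofReal (Real.exp (-r * φ l)) else 1 := by
      ext r
      split_ifs with hr
      · exact h3 r hr l hl
      · simp [laplaceTransform]
    rw [this]
    exact Measurable.ite measurableSet_Ioi (by fun_prop) measurable_const
  · rw [if_pos hr, h3 r hr l hl]

/-- Theorem 4.9(ii): pure jump case, off-diagonal regime.  Under
Assumption 4.1 on the subordinator and with `p⁰` enjoying two-sided jump-type heat kernel
estimates, there is `C ≥ 1` such that whenever `Φ(d(x,y)) φ(1/t) ≥ 1`,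
`q(t,x,y) ≍ 1 / (t φ(1/t)² V(x,d(x,y)) Φ(d(x,y)))` with constant `C`. -/
theorem time_frac_stmt15
    {E : Type*} [MetricSpace E] [MeasurableSpace E] [BorelSpace E]
    [TopologicalSpace.SeparableSpace E] [LocallyCompactSpace E]
    (μ : Measure E)
    -- the volume function and its uniform weak scaling
    (V : E → ℝ → ℝ)
    (hV : ∀ (x : E) (r : ℝ), V x r = (μ (Metric.ball x r)).toReal)
    (hVpos : ∀ (x : E) (r : ℝ), 0 < r → 0 < V x r)
    (d₁ d₂ cV cV' : ℝ) (hd : 0 < d₁ ∧ d₁ ≤ d₂) (hcV : 0 < cV ∧ 0 < cV')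
    (hVscale : ∀ (x : E) (r R : ℝ), 0 < r → r ≤ R →
      cV * (R / r) ^ d₁ * V x r ≤ V x R ∧ V x R ≤ cV' * (R / r) ^ d₂ * V x r)
    -- the space scaling function Φ and its inverse
    (Φ : ℝ → ℝ) (hΦ0 : Φ 0 = 0) (hΦmono : StrictMonoOn Φ (Set.Ici (0:ℝ)))
    (hΦpos : ∀ r : ℝ, 0 < r → 0 < Φ r)
    (α₁ α₂ cΦ cΦ' : ℝ) (hα : 0 < α₁ ∧ α₁ ≤ α₂) (hcΦ : 0 < cΦ ∧ 0 < cΦ')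
    (hΦscale : ∀ r R : ℝ, 0 < r → r ≤ R →
      cΦ * (R / r) ^ α₁ * Φ r ≤ Φ R ∧ Φ R ≤ cΦ' * (R / r) ^ α₂ * Φ r)
    (Φinv : ℝ → ℝ)
    (hΦinv : ∀ s : ℝ, 0 < s → 0 < Φinv s ∧ Φ (Φinv s) = s)
    -- the two-sided jump-type heat kernel estimate for p⁰
    (p0 : ℝ → E → E → ℝ)
    (hp0_nn : ∀ (r : ℝ) (x y : E), 0 ≤ p0 r x y)
    (hp0_meas : Measurable (fun z : ℝ × E × E => p0 z.1 z.2.1 z.2.2))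
    (K : ℝ → E → E → ℝ≥0∞)
    (hK : ∀ (t : ℝ) (x y : E), K t x y =
      min (ENNReal.ofReal (1 / V x (Φinv t)))
        (ENNReal.ofReal t /
          (ENNReal.ofReal (V x (dist x y)) * ENNReal.ofReal (Φ (dist x y)))))
    (C₀ : ℝ) (hC₀ : 1 ≤ C₀)
    (hp0 : ∀ t : ℝ, 0 < t → ∀ x y : E,
      K t x y / ENNReal.ofReal C₀ ≤ ENNReal.ofReal (p0 t x y) ∧
      ENNReal.ofReal (p0 t x y) ≤ ENNReal.ofReal C₀ * K t x y)
    -- Assumption 4.1 for the subordinator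
    (ν : Measure ℝ)
    (hν_loc : ∫⁻ x in Set.Ioi (0:ℝ), ENNReal.ofReal (min 1 x) ∂ν ≠ ⊤)
    (φ : ℝ → ℝ)
    (hφ : ∀ l : ℝ, 0 < l → φ l = ∫ x in Set.Ioi (0:ℝ), (1 - Real.exp (-l * x)) ∂ν)
    (β₁ β₂ cφ cφ' : ℝ)
    (hβ : 0 < β₁ ∧ β₁ < β₂ ∧ β₂ < 1) (hcφ : 0 < cφ ∧ 0 < cφ')
    (hφscale : ∀ l : ℝ, 0 < l → ∀ κ : ℝ, 1 ≤ κ →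
      cφ * κ ^ β₁ ≤ φ (κ * l) / φ l ∧ φ (κ * l) / φ l ≤ cφ' * κ ^ β₂)
    (νd : ℝ → ℝ)
    (hνd_nn : ∀ t : ℝ, 0 ≤ νd t)
    (hνd_meas : Measurable νd)
    (hν_dens : ∀ A : Set ℝ, MeasurableSet A →
      ν A = ∫⁻ x in A ∩ Set.Ioi 0, ENNReal.ofReal (νd x))
    (hself : AntitoneOn (fun t => t * νd t) (Set.Ioi (0:ℝ)))
    (μr : ℝ → Measure ℝ)
    (hprob : ∀ r : ℝ, 0 < r → IsProbabilityMeasure (μr r))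
    (hlap : ∀ r : ℝ, 0 < r → ∀ l : ℝ, 0 < l →
      ∫ s, Real.exp (-l * s) ∂(μr r) = Real.exp (-r * φ l))
    (pbar : ℝ → ℝ → ℝ)
    (hpbar_nn : ∀ r t : ℝ, 0 ≤ pbar r t)
    (hpbar_cont : ∀ r : ℝ, 0 < r → Continuous (pbar r))
    (hdens : ∀ r : ℝ, 0 < r → ∀ A : Set ℝ, MeasurableSet A →
      μr r A = ∫⁻ t in A ∩ Set.Ici 0, ENNReal.ofReal (pbar r t))
    -- the fundamental solution q of the time fractional Poisson equation
    (q : ℝ → E → E → ℝ≥0∞)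
    (hq : ∀ (t : ℝ) (x y : E),
      q t x y = ∫⁻ r in Set.Ioi (0:ℝ), ENNReal.ofReal (p0 r x y * pbar r t)) :
    ∃ C : ℝ, 1 ≤ C ∧
      ∀ t : ℝ, 0 < t → ∀ x y : E, 1 ≤ Φ (dist x y) * φ t⁻¹ →
        ENNReal.ofReal (C⁻¹ * (1 / (t * (φ t⁻¹) ^ 2 * V x (dist x y) * Φ (dist x y))))
          ≤ q t x y ∧
        q t x y ≤ ENNReal.ofReal
            (C * (1 / (t * (φ t⁻¹) ^ 2 * V x (dist x y) * Φ (dist x y)))) := by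

  obtain ⟨hβ₁, -, hβ₂⟩ := hβ
  have hφne : ∀ l, 0 < l → φ l ≠ 0 := by
    intro l hl h0
    have h1 := (hφscale l hl 1 le_rfl).1
    simp only [h0, Real.one_rpow, div_zero, mul_one] at h1
    exact hcφ.1.not_ge h1
  have h := isSelfDecomposableExponent_of_levyMeasure hφ hφne hνd_nn hνd_meas hν_dens hself
  have hlow : ∀ l κ, 0 < l → 1 ≤ κ → cφ * κ ^ β₁ * φ l ≤ φ (κ * l) := fun l κ hl hκ =>
    (le_div_iff₀ (h.pos l hl)).1 (hφscale l hl κ hκ).1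
  have hup : ∀ l κ, 0 < l → 1 ≤ κ → φ (κ * l) ≤ cφ' * κ ^ β₂ * φ l := fun l κ hl hκ =>
    (div_le_iff₀ (h.pos l hl)).1 (hφscale l hl κ hκ).2
  obtain ⟨C₁, hC₁, hk⟩ := h.exists_le_mul_density hβ₁ hβ₂ hcφ.1 hcφ.2 hlow hup
  obtain ⟨c₂, hc₂, hdouble⟩ : ∃ c₂ : ℝ, 0 < c₂ ∧ ∀ l, 0 < l → φ (2 * l) ≤ c₂ * φ l :=
    ⟨cφ' * 2 ^ β₂, mul_pos hcφ.2 (by positivity), fun l hl => hup l 2 hl one_le_two⟩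
  have hkm := h.exists_kMeasure_le hc₂ hdouble hC₁ hk
  have hlaw := isSubordinatorLaw_ite hprob
    (fun r hr => by
      rw [hdens r hr _ measurableSet_Iio, Iio_inter_Ici, Ico_self]
      simp) hlap
  have hpc : ∀ r, 0 < r → Continuous fun t => ENNReal.ofReal (pbar r t) := fun r hr =>
    ENNReal.continuous_ofReal.comp (hpbar_cont r hr)
  have hpd : ∀ r, 0 < r → ∀ a b, 0 ≤ a → (if 0 < r then μr r else Measure.dirac 0) (Ioo a b) =
      ∫⁻ s in Ioo a b, ENNReal.ofReal (pbar r s) := by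
    intro r hr a b ha
    rw [if_pos hr, hdens r hr _ measurableSet_Ioo,
      inter_eq_left.2 (show Ioo a b ⊆ Ici 0 from fun s hs => ha.trans hs.1.le)]
  have hC₀' : 0 < C₀ := zero_lt_one.trans_le hC₀
  set A := 2 * Real.exp 1 * (4 * c₂ * C₁) * c₂ ^ 2 
  have hA0 : 0 < A := by positivity
  refine ⟨1 + C₀ * A + 2048 * c₂ * C₁ * C₀, by
    have h1 : 0 < C₀ * A := by positivity
    have h2 : 0 < 2048 * c₂ * C₁ * C₀ := by positivity
    linarith, fun t ht x y hxy => ?_⟩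
  have hF := h.pos _ (inv_pos.2 ht)
  have hD : 0 < dist x y := by
    refine lt_of_le_of_ne dist_nonneg fun h0 => ?_
    rw [← h0, hΦ0, zero_mul] at hxy
    exact zero_lt_one.not_ge hxy
  have hΦD := hΦpos _ hD
  have hVD := hVpos x _ hD
  rw [hq]
  constructor
  · have hn : φ t⁻¹ / (4 * t * c₂ * C₁) ≤ νd (2 * t) / 2 := by
      have h1 := hk (2 * t) (by positivity)
      have h2 := hdouble (2 * t)⁻¹ (by positivity)
      rw [show 2 * (2 * t)⁻¹ = t⁻¹ by field_simp] at h2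
      have h3 := h2.trans (mul_le_mul_of_nonneg_left h1 hc₂.le)
      rw [div_le_div_iff₀ (by positivity) (by norm_num)]
      linarith
    have hVle : ∀ r, 0 < r → r ≤ Φ (dist x y) → V x (Φinv r) ≤ V x (dist x y) := by
      intro r hr hrD
      obtain ⟨h1, h2⟩ := hΦinv r hr
      rw [← h2, hΦmono.le_iff_le h1.le hD.le] at hrD
      rw [hV, hV]
      refine ENNReal.toReal_mono (fun htop => ?_) (measure_mono (Metric.ball_subset_ball hrD))
      rw [hV, htop, ENNReal.toReal_top] at hVD
      exact lt_irrefl _ hVD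
    have hp0le : ∀ r, 0 < r → r ≤ Φ (dist x y) →
        r / (V x (dist x y) * Φ (dist x y)) / C₀ ≤ p0 r x y := by
      intro r hr hrD
      rw [← ENNReal.ofReal_le_ofReal_iff (hp0_nn r x y)]
      refine le_trans ?_ (hp0 r hr x y).1
      rw [ENNReal.ofReal_div_of_pos hC₀']
      refine ENNReal.div_le_div_right ?_ _
      rw [hK]
      refine le_min (ENNReal.ofReal_le_ofReal ?_) ?_
      · have h1 := hVpos x _ (hΦinv r hr).1
        rw [div_le_div_iff₀ (by positivity) h1]
        calc r * V x (Φinv r) ≤ Φ (dist x y) * V x (dist x y) := by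
              gcongr
              exact hVle r hr hrD
          _ = _ := by ring
      · rw [ENNReal.ofReal_div_of_pos (by positivity), ENNReal.ofReal_mul hVD.le]
    set R := 1 / (4 * φ t⁻¹) with hR
    have hR0 : 0 < R := by positivity
    have hRD : R ≤ Φ (dist x y) := by
      rw [hR, div_le_iff₀ (by positivity)]
      linarith
    have hpoint : ∀ r ∈ Ioc (R / 2) R,
        ENNReal.ofReal ((R / 2 / (V x (dist x y) * Φ (dist x y)) / C₀) *
          (R / 2 * (φ t⁻¹ / (4 * t * c₂ * C₁)))) ≤ ENNReal.ofReal (p0 r x y * pbar r t) := by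
      rintro r ⟨hr1, hr2⟩
      have hr : 0 < r := by linarith
      have hrt : r * φ t⁻¹ ≤ 1 / 4 := by
        rw [hR, le_div_iff₀ (by positivity)] at hr2
        linarith
      have h1 := hlaw.le_density h hr ht hrt (hpc r hr) (hpd r hr)
      rw [ENNReal.ofReal_le_ofReal_iff (hpbar_nn r t)] at h1
      refine ENNReal.ofReal_le_ofReal (mul_le_mul ?_ ?_ (by positivity) (hp0_nn r x y))
      · refine le_trans ?_ (hp0le r hr (hr2.trans hRD))
        gcongr
      · refine le_trans ?_ h1
        rw [mul_div_assoc]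
        gcongr
    calc _ ≤ ENNReal.ofReal ((R / 2 / (V x (dist x y) * Φ (dist x y)) / C₀) *
          (R / 2 * (φ t⁻¹ / (4 * t * c₂ * C₁)))) * ENNReal.ofReal (R / 2) := by
          rw [← ENNReal.ofReal_mul (by positivity)]
          refine ENNReal.ofReal_le_ofReal ?_
          have h1 : R / 2 / (V x (dist x y) * Φ (dist x y)) / C₀ *
              (R / 2 * (φ t⁻¹ / (4 * t * c₂ * C₁))) * (R / 2) = (2048 * c₂ * C₁ * C₀)⁻¹ *
                (1 / (t * φ t⁻¹ ^ 2 * V x (dist x y) * Φ (dist x y))) := by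
            rw [hR]
            generalize φ t⁻¹ = F at hF
            field_simp
            norm_num
          rw [h1]
          gcongr
          linarith [mul_pos hC₀' hA0]
      _ = ∫⁻ r in Ioc (R / 2) R, ENNReal.ofReal ((R / 2 / (V x (dist x y) * Φ (dist x y)) / C₀) *
          (R / 2 * (φ t⁻¹ / (4 * t * c₂ * C₁)))) := by
          rw [setLIntegral_const, Real.volume_Ioc]
          congr 2
          ring
      _ ≤ ∫⁻ r in Ioc (R / 2) R, ENNReal.ofReal (p0 r x y * pbar r t) :=
          setLIntegral_mono' measurableSet_Ioc hpoint
      _ ≤ _ := lintegral_mono_set fun r hr => lt_trans (by positivity) hr.1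
  · have hupper := hlaw.lintegral_mul_density_le h hc₂ hdouble (by positivity) hkm hpc hpd ht
    calc _ ≤ ∫⁻ r in Ioi 0, ENNReal.ofReal (C₀ / (V x (dist x y) * Φ (dist x y))) *
          (ENNReal.ofReal r * ENNReal.ofReal (pbar r t)) := by
          refine setLIntegral_mono' measurableSet_Ioi fun r hr => ?_
          rw [ENNReal.ofReal_mul (hp0_nn r x y), ← mul_assoc]
          refine mul_le_mul_left ((hp0 r hr x y).2.trans ?_) _
          rw [hK]
          refine (mul_le_mul_right (min_le_right _ _) _).trans_eq ?_
          rw [← ENNReal.ofReal_mul hVD.le, ← ENNReal.ofReal_div_of_pos (by positivity),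
            ← ENNReal.ofReal_mul hC₀'.le, ← ENNReal.ofReal_mul (by positivity)]
          congr 1
          ring
      _ ≤ ENNReal.ofReal (C₀ / (V x (dist x y) * Φ (dist x y))) *
          ENNReal.ofReal (A / (t * φ t⁻¹ ^ 2)) := by
          rw [lintegral_const_mul' _ _ ENNReal.ofReal_ne_top]
          exact mul_le_mul_right hupper _
      _ ≤ _ := by
          rw [← ENNReal.ofReal_mul (by positivity)]
          refine ENNReal.ofReal_le_ofReal ?_
          have h1 : C₀ / (V x (dist x y) * Φ (dist x y)) * (A / (t * φ t⁻¹ ^ 2)) =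
              C₀ * A * (1 / (t * φ t⁻¹ ^ 2 * V x (dist x y) * Φ (dist x y))) := by
            generalize φ t⁻¹ = F at hF
            field_simp
          rw [h1]
          gcongr
          have : 0 < 2048 * c₂ * C₁ * C₀ := by positivity
          linarith
end

section
/- Diffusion case, off-diagonal regime: let n(t,r) > 0 be non-increasing in t for each fixed r > 0 and satisfy the two-sided comparison 1/φ(n(t,r)/t) ≃ Φ(r/n(t,r)) with uniform constants for all t, r > 0. Then there exist constants c₁, c₂, c₃, c₄ > 0 such that for all t > 0 and x, y ∈ E with Φ(d(x,y)) φ(1/t) ≥ 1, writing n = n(t, d(x,y)): c₁ (n / (t φ(n/t) V(x, Φ^{-1}(1/φ(1/t))))) exp(−c₂ n) ≤ q(t,x,y) ≤ c₃ (n / (t φ(n/t) V(x, Φ^{-1}(1/φ(1/t))))) exp(−c₄ n). -/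
open MeasureTheory Filter Set
open scoped ENNReal Topology

/-- The moment generating function of the exponential tilt of a measure. -/
lemma lintegral_exp_tilt (A : Measure ℝ) (x : ℝ) :
    ∫⁻ s, ENNReal.ofReal (Real.exp (x * s)) ∂(A.withDensity fun s => ENNReal.ofReal (Real.exp (-s)))
      = ∫⁻ s, ENNReal.ofReal (Real.exp (-(1 - x) * s)) ∂A := by
  rw [lintegral_withDensity_eq_lintegral_mul _ (by fun_prop) (by fun_prop)]
  refine lintegral_congr fun s => ?_
  simp only [Pi.mul_apply]
  rw [← ENNReal.ofReal_mul (Real.exp_pos _).le, ← Real.exp_add]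
  congr 2
  ring

/-- A measure on the line is determined by its Laplace transform on `(0, ∞)`, when finite. -/
lemma measure_ext_of_laplace (A B : Measure ℝ)
    (hA : ∀ l : ℝ, 0 < l → ∫⁻ s, ENNReal.ofReal (Real.exp (-l * s)) ∂A ≠ ⊤)
    (h : ∀ l : ℝ, 0 < l → ∫⁻ s, ENNReal.ofReal (Real.exp (-l * s)) ∂A =
      ∫⁻ s, ENNReal.ofReal (Real.exp (-l * s)) ∂B) : A = B := by
  set w : ℝ → ℝ≥0∞ := fun s => ENNReal.ofReal (Real.exp (-s)) with hw
  have hwm : Measurable w := by fun_prop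
  set A' := A.withDensity w with hA'
  set B' := B.withDensity w with hB'
  have key : ∀ (D : Measure ℝ),
      (∀ l : ℝ, 0 < l → ∫⁻ s, ENNReal.ofReal (Real.exp (-l * s)) ∂D ≠ ⊤) →
      ∀ x : ℝ, x < 1 → x ∈ ProbabilityTheory.integrableExpSet id (D.withDensity w) := by
    intro D hD x hx
    have h1 := hD (1 - x) (by linarith)
    rw [← lintegral_exp_tilt] at h1
    simp only [ProbabilityTheory.integrableExpSet, Set.mem_ofPred_eq, id]
    refine ⟨by fun_prop, ?_⟩
    rw [hasFiniteIntegral_iff_norm]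
    simpa [Real.norm_eq_abs, Real.abs_exp] using h1.lt_top
  have hB : ∀ l : ℝ, 0 < l → ∫⁻ s, ENNReal.ofReal (Real.exp (-l * s)) ∂B ≠ ⊤ :=
    fun l hl => h l hl ▸ hA l hl
  have hInt : ∀ D : Measure ℝ,
      (∀ l : ℝ, 0 < l → ∫⁻ s, ENNReal.ofReal (Real.exp (-l * s)) ∂D ≠ ⊤) →
      {z : ℂ | z.re < 1} ⊆
        {z | z.re ∈ interior (ProbabilityTheory.integrableExpSet id (D.withDensity w))} := by
    intro D hD z hz
    exact (interior_maximal (fun x hx => key D hD x hx) isOpen_Iio) hz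
  have hfin : ∀ D : Measure ℝ,
      (∀ l : ℝ, 0 < l → ∫⁻ s, ENNReal.ofReal (Real.exp (-l * s)) ∂D ≠ ⊤) →
      IsFiniteMeasure (D.withDensity w) := by
    intro D hD
    refine isFiniteMeasure_withDensity ?_
    simpa [hw] using hD 1 one_pos
  have := hfin A hA
  have := hfin B hB
  have heq : EqOn (ProbabilityTheory.complexMGF id A') (ProbabilityTheory.complexMGF id B')
      {z : ℂ | z.re < 1} := by
    refine AnalyticOnNhd.eqOn_of_preconnected_of_frequently_eq (z₀ := (0 : ℂ))
      (ProbabilityTheory.analyticOnNhd_complexMGF.mono (hInt A hA))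
      (ProbabilityTheory.analyticOnNhd_complexMGF.mono (hInt B hB))
      (convex_halfSpace_re_lt 1).isPreconnected (by simp) ?_
    have h_real : ∃ᶠ x : ℝ in 𝓝[<] (0 : ℝ), ProbabilityTheory.complexMGF id A' (x : ℂ) =
        ProbabilityTheory.complexMGF id B' (x : ℂ) := by
      refine Eventually.frequently ?_
      filter_upwards [self_mem_nhdsWithin] with x hx
      rw [ProbabilityTheory.complexMGF_ofReal, ProbabilityTheory.complexMGF_ofReal]
      congr 1
      simp only [ProbabilityTheory.mgf, id]
      rw [integral_eq_lintegral_of_nonneg_ae (ae_of_all _ fun s => (Real.exp_pos _).le)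
          (by fun_prop),
        integral_eq_lintegral_of_nonneg_ae (ae_of_all _ fun s => (Real.exp_pos _).le)
          (by fun_prop), hA', hB', hw, lintegral_exp_tilt, lintegral_exp_tilt]
      rw [h (1 - x) (by have := mem_Iio.1 hx; linarith)]
    have ht : Tendsto (fun x : ℝ => (x : ℂ)) (𝓝[<] (0 : ℝ)) (𝓝[≠] (0 : ℂ)) := by
      refine tendsto_nhdsWithin_iff.2 ⟨?_, ?_⟩
      · exact (Complex.continuous_ofReal.tendsto' 0 0 (by simp)).mono_left nhdsWithin_le_nhds
      · filter_upwards [self_mem_nhdsWithin] with x hx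
        simpa using (mem_Iio.1 hx).ne
    exact ht.frequently h_real
  have hAB : A' = B' := by
    refine Measure.ext_of_charFun (funext fun t => ?_)
    rw [← ProbabilityTheory.complexMGF_id_mul_I, ← ProbabilityTheory.complexMGF_id_mul_I]
    exact heq (by simp)
  have h0 : ∀ s, w s ≠ 0 := fun s => by simp [hw, Real.exp_pos]
  have h1 : ∀ s, w s ≠ ⊤ := fun s => by simp [hw]
  rw [← withDensity_inv_same (μ := A) hwm (ae_of_all _ h0) (ae_of_all _ h1),
    ← withDensity_inv_same (μ := B) hwm (ae_of_all _ h0) (ae_of_all _ h1), ← hA', ← hB', hAB]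

/-- Differentiation of `l ↦ ∫ (1 - exp (-l x)) D(dx)` for a Lévy measure `D` on `[0, ∞)`. -/
lemma hasDerivAt_integral_one_sub_exp (D : Measure ℝ) (hD0 : ∀ᵐ x ∂D, 0 ≤ x)
    (hD : ∫⁻ x, ENNReal.ofReal (min 1 x) ∂D ≠ ⊤) {l : ℝ} (hl : 0 < l) :
    Integrable (fun x => 1 - Real.exp (-l * x)) D ∧
    Integrable (fun x => x * Real.exp (-l * x)) D ∧
      HasDerivAt (fun l => ∫ x, (1 - Real.exp (-l * x)) ∂D) (∫ x, x * Real.exp (-l * x) ∂D) l := by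
  have hmin : Integrable (fun x : ℝ => min 1 x) D := by
    refine ⟨by fun_prop, ?_⟩
    rw [hasFiniteIntegral_iff_ofReal]
    · exact hD.lt_top
    · filter_upwards [hD0] with x hx
      exact le_min zero_le_one hx
  have h1 : Integrable (fun x => 1 - Real.exp (-l * x)) D := by
    refine (hmin.const_mul (1 + l)).mono' (by fun_prop) ?_
    filter_upwards [hD0] with x hx
    have e1 : Real.exp (-l * x) ≤ 1 := Real.exp_le_one_iff.2 (by nlinarith)
    have e2 := Real.add_one_le_exp (-l * x)
    rw [Real.norm_eq_abs, abs_of_nonneg (by linarith)]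
    rcases le_total 1 x with h | h
    · rw [min_eq_left h]
      have := Real.exp_pos (-l * x)
      linarith
    · rw [min_eq_right h]
      nlinarith
  refine ⟨h1, ?_⟩
  refine hasDerivAt_integral_of_dominated_loc_of_deriv_le (Ioi_mem_nhds (half_lt_self hl))
    (F := fun l x => 1 - Real.exp (-l * x)) (F' := fun l x => x * Real.exp (-l * x))
    (bound := fun x => (1 + 2 / l) * min 1 x)
    (Eventually.of_forall fun y => by fun_prop) h1 (by fun_prop) ?_ (hmin.const_mul _) ?_
  · filter_upwards [hD0] with x hx y hy
    have hy : l / 2 < y := hy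
    have e0 := Real.exp_pos (-y * x)
    have e1 : Real.exp (-y * x) ≤ 1 := Real.exp_le_one_iff.2 (by nlinarith)
    rw [Real.norm_eq_abs, abs_of_nonneg (by positivity)]
    have hl' : 0 < 2 / l := by positivity
    rcases le_total 1 x with h | h
    · rw [min_eq_left h]
      have e2 := Real.add_one_le_exp (y * x)
      have e3 : Real.exp (y * x) * Real.exp (-y * x) = 1 := by
        rw [← Real.exp_add]; simp
      have e4 : y * (x * Real.exp (-y * x)) ≤ 1 := by nlinarith
      have e5 : x * Real.exp (-y * x) ≤ 2 / l := by
        rw [le_div_iff₀ hl]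
        have : 0 ≤ x * Real.exp (-y * x) := by positivity
        nlinarith
      linarith
    · rw [min_eq_right h]
      nlinarith [mul_nonneg hl'.le hx]
  · refine ae_of_all _ fun x y _ => ?_
    have h : HasDerivAt (fun y : ℝ => -y * x) (-1 * x) y := (hasDerivAt_neg y).mul_const x
    convert h.exp.const_sub 1 using 1
    ring

lemma lintegral_id_mul_exp (D : Measure ℝ) (hD0 : ∀ᵐ x ∂D, 0 ≤ x) {l : ℝ}
    (hi : Integrable (fun x => x * Real.exp (-l * x)) D) :
    ∫⁻ s, ENNReal.ofReal (Real.exp (-l * s)) ∂(D.withDensity fun s => ENNReal.ofReal s) =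
      ENNReal.ofReal (∫ x, x * Real.exp (-l * x) ∂D) := by
  rw [lintegral_withDensity_eq_lintegral_mul _ (by fun_prop) (by fun_prop),
    ofReal_integral_eq_lintegral_ofReal hi]
  · refine lintegral_congr fun s => ?_
    simp only [Pi.mul_apply]
    rw [ENNReal.ofReal_mul' (Real.exp_pos _).le]
  · filter_upwards [hD0] with x hx
    positivity

/-- The integral equation `s f(s) = r ∫₀ˢ u ν(u) f(s - u) du` for the density `f` of a
subordinator with Lévy density `ν` at time `r`. -/
lemma subordinator_density_equation (νd f : ℝ → ℝ) (hνm : Measurable νd)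
    (hfm : Measurable f) (hf0 : ∀ s, 0 ≤ f s) (N P : Measure ℝ)
    (hN : N = (volume.restrict (Ioi 0)).withDensity fun x => ENNReal.ofReal (νd x))
    (hP : P = (volume.restrict (Ici 0)).withDensity fun x => ENNReal.ofReal (f x))
    [IsProbabilityMeasure P]
    (hNfin : ∫⁻ x, ENNReal.ofReal (min 1 x) ∂N ≠ ⊤) (φ : ℝ → ℝ)
    (hφ : ∀ l : ℝ, 0 < l → φ l = ∫ x, (1 - Real.exp (-l * x)) ∂N)
    (r : ℝ) (hr : 0 < r)
    (hlap : ∀ l : ℝ, 0 < l → ∫ s, Real.exp (-l * s) ∂P = Real.exp (-r * φ l)) :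
    ∀ᵐ s : ℝ, 0 < s → ENNReal.ofReal (s * f s) =
      ENNReal.ofReal r * ∫⁻ u in Ioc 0 s, ENNReal.ofReal (u * νd u * f (s - u)) := by
  have hN0 : ∀ᵐ x ∂N, 0 ≤ x := by
    rw [hN]
    refine (withDensity_absolutelyContinuous _ _).ae_le ?_
    filter_upwards [ae_restrict_mem measurableSet_Ioi] with x hx using (mem_Ioi.1 hx).le
  have hP0 : ∀ᵐ x ∂P, 0 ≤ x := by
    rw [hP]
    refine (withDensity_absolutelyContinuous _ _).ae_le ?_
    filter_upwards [ae_restrict_mem measurableSet_Ici] with x hx using hx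
  have hPfin : ∫⁻ x, ENNReal.ofReal (min 1 x) ∂P ≠ ⊤ := by
    refine ne_top_of_le_ne_top ENNReal.one_ne_top ?_
    calc ∫⁻ x, ENNReal.ofReal (min 1 x) ∂P ≤ ∫⁻ _, 1 ∂P :=
          lintegral_mono fun x => by
            simp
      _ = 1 := by simp
  have hPexp : ∀ l : ℝ, 0 < l → Integrable (fun s => Real.exp (-l * s)) P := by
    intro l hl
    refine (integrable_const (1 : ℝ)).mono' (by fun_prop) ?_
    filter_upwards [hP0] with x hx
    rw [Real.norm_eq_abs, Real.abs_exp]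
    exact Real.exp_le_one_iff.2 (by nlinarith)
  have hderiv : ∀ l : ℝ, 0 < l → ∫ x, x * Real.exp (-l * x) ∂P =
      r * (∫ x, x * Real.exp (-l * x) ∂N) * Real.exp (-r * φ l) := by
    intro l hl
    have h1 := (hasDerivAt_integral_one_sub_exp P hP0 hPfin hl).2.2
    have h2 := (hasDerivAt_integral_one_sub_exp N hN0 hNfin hl).2.2
    have h3 : HasDerivAt φ (∫ x, x * Real.exp (-l * x) ∂N) l := by
      refine h2.congr_of_eventuallyEq ?_
      filter_upwards [Ioi_mem_nhds hl] with y hy using hφ y hy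
    have h4 := ((h3.const_mul (-r)).exp).const_sub 1
    have h5 : (fun l => ∫ x, (1 - Real.exp (-l * x)) ∂P) =ᶠ[𝓝 l]
        fun l => 1 - Real.exp (-r * φ l) := by
      filter_upwards [Ioi_mem_nhds hl] with y hy
      rw [integral_sub (integrable_const _) (hPexp y hy), hlap y hy]
      simp
    rw [h1.unique (h4.congr_of_eventuallyEq h5)]
    ring
  set κ : Measure ℝ := N.withDensity fun s => ENNReal.ofReal s with hκ
  set K : ℝ → ℝ≥0∞ := (Ioi (0 : ℝ)).indicator fun u => ENNReal.ofReal (u * νd u) with hK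
  set F : ℝ → ℝ≥0∞ := (Ici (0 : ℝ)).indicator fun u => ENNReal.ofReal (f u) with hF
  have hKm : Measurable K := Measurable.indicator (by fun_prop) measurableSet_Ioi
  have hFm : Measurable F := Measurable.indicator (by fun_prop) measurableSet_Ici
  have hκK : κ = volume.withDensity K := by
    rw [hκ, hN, ← withDensity_mul _ (by fun_prop) (by fun_prop),
      ← withDensity_indicator measurableSet_Ioi] 
    congr 1
    ext u
    simp only [hK, indicator_apply, mem_Ioi, Pi.mul_apply]
    split_ifs with hu
    · rw [ENNReal.ofReal_mul hu.le, mul_comm]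
    · rfl
  have hPF : P = volume.withDensity F := by
    rw [hP, ← withDensity_indicator measurableSet_Ici]
  have hAF : P.withDensity (fun s => ENNReal.ofReal s) =
      volume.withDensity (F * fun s => ENNReal.ofReal s) := by
    rw [withDensity_mul _ hFm (by fun_prop), ← hPF]
  have hconv : ENNReal.ofReal r • (κ ∗ P) =
      volume.withDensity (ENNReal.ofReal r • (K ⋆ₗ F)) := by
    rw [withDensity_smul _ (measurable_lconvolution _ hKm hFm),
      ← conv_withDensity_eq_lconvolution hKm hFm, ← hκK, ← hPF]
  have hA : ∀ l : ℝ, 0 < l → ∫⁻ s, ENNReal.ofReal (Real.exp (-l * s))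
      ∂(P.withDensity fun s => ENNReal.ofReal s) =
      ENNReal.ofReal (∫ x, x * Real.exp (-l * x) ∂P) := fun l hl =>
    lintegral_id_mul_exp P hP0 (hasDerivAt_integral_one_sub_exp P hP0 hPfin hl).2.1
  have heq : P.withDensity (fun s => ENNReal.ofReal s) = ENNReal.ofReal r • (κ ∗ P) := by
    refine measure_ext_of_laplace _ _ (fun l hl => by rw [hA l hl]; simp) fun l hl => ?_
    rw [hA l hl, hderiv l hl, lintegral_smul_measure, Measure.lintegral_conv (by fun_prop)]
    have h1 : ∀ x : ℝ, ∫⁻ y, ENNReal.ofReal (Real.exp (-l * (x + y))) ∂P =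
        ENNReal.ofReal (Real.exp (-l * x)) * ENNReal.ofReal (Real.exp (-r * φ l)) := by
      intro x
      rw [← hlap l hl, ofReal_integral_eq_lintegral_ofReal (hPexp l hl)
        (ae_of_all _ fun s => (Real.exp_pos _).le), ← lintegral_const_mul _ (by fun_prop)]
      refine lintegral_congr fun y => ?_
      rw [← ENNReal.ofReal_mul (Real.exp_pos _).le, ← Real.exp_add]
      congr 2
      ring
    simp_rw [h1]
    rw [lintegral_mul_const _ (by fun_prop), hκ, lintegral_id_mul_exp N hN0
      (hasDerivAt_integral_one_sub_exp N hN0 hNfin hl).2.1, mul_assoc,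
      ENNReal.ofReal_mul hr.le, ENNReal.ofReal_mul' (Real.exp_pos _).le, smul_eq_mul]
  rw [hAF, hconv, withDensity_eq_iff_of_sigmaFinite (by fun_prop)
    ((measurable_lconvolution _ hKm hFm).const_smul _).aemeasurable] at heq
  filter_upwards [heq] with s hs hs0
  simp only [Pi.mul_apply, Pi.smul_apply, smul_eq_mul, lconvolution_def] at hs
  rw [hF, indicator_of_mem (mem_Ici.2 hs0.le), mul_comm, ← ENNReal.ofReal_mul hs0.le] at hs
  rw [hs, ← lintegral_indicator measurableSet_Ioc]
  congr 1
  refine lintegral_congr fun u => ?_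
  simp only [hK, indicator_apply, mem_Ioi, mem_Ici, mem_Ioc]
  by_cases h0 : 0 < u
  · by_cases h1 : u ≤ s
    · rw [if_pos h0, if_pos (by linarith), if_pos ⟨h0, h1⟩, neg_add_eq_sub,
        ENNReal.ofReal_mul' (hf0 _)]
    · rw [if_neg (by linarith : ¬ 0 ≤ -u + s), if_neg (fun h : 0 < u ∧ u ≤ s => h1 h.2), mul_zero]
  · rw [if_neg h0, if_neg (fun h : 0 < u ∧ u ≤ s => h0 h.1), zero_mul]

lemma half_le_one_sub_exp_neg {y : ℝ} (hy : 0 ≤ y) (hy1 : y ≤ 1) : y / 2 ≤ 1 - Real.exp (-y) := by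
  have h1 := Real.add_one_le_exp y
  have h2 : Real.exp y * Real.exp (-y) = 1 := by rw [← Real.exp_add]; simp
  have h3 := Real.exp_pos (-y)
  nlinarith [mul_le_mul_of_nonneg_right h1 h3.le]

lemma half_le_one_sub_exp_neg_of_one_le {y : ℝ} (hy : 1 ≤ y) : 1 / 2 ≤ 1 - Real.exp (-y) := by
  have h := half_le_one_sub_exp_neg zero_le_one le_rfl
  have : Real.exp (-y) ≤ Real.exp (-1) := Real.exp_le_exp.2 (by linarith)
  linarith

section LevyDensity

variable {νd φ : ℝ → ℝ} (hν0 : ∀ t, 0 ≤ νd t)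
  (hφi : ∀ l : ℝ, 0 < l → IntegrableOn (fun x => (1 - Real.exp (-l * x)) * νd x) (Ioi 0))
  (hφe : ∀ l : ℝ, 0 < l → φ l = ∫ x in Ioi (0 : ℝ), (1 - Real.exp (-l * x)) * νd x)

include hν0 hφi hφe

lemma laplaceExponent_mono {a b : ℝ} (ha : 0 < a) (hab : a ≤ b) : φ a ≤ φ b := by
  rw [hφe a ha, hφe b (ha.trans_le hab)]
  refine setIntegral_mono_on (hφi a ha) (hφi b (ha.trans_le hab)) measurableSet_Ioi fun x hx => ?_
  have hx : 0 < x := hx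
  refine mul_le_mul_of_nonneg_right ?_ (hν0 x)
  have : Real.exp (-b * x) ≤ Real.exp (-a * x) := Real.exp_le_exp.2 (by nlinarith)
  linarith

lemma lintegral_mul_levyDensity_le {δ : ℝ} (hδ : 0 < δ) :
    ∫⁻ u in Ioc 0 δ, ENNReal.ofReal (u * νd u) ≤ ENNReal.ofReal (2 * δ * φ (1 / δ)) := by
  have hδ' : 0 < 1 / δ := by positivity
  calc ∫⁻ u in Ioc 0 δ, ENNReal.ofReal (u * νd u)
      ≤ ∫⁻ u in Ioc 0 δ, ENNReal.ofReal (2 * δ * ((1 - Real.exp (-(1 / δ) * u)) * νd u)) := by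
        refine setLIntegral_mono' measurableSet_Ioc fun u hu => ENNReal.ofReal_le_ofReal ?_
        have h := half_le_one_sub_exp_neg (y := u / δ) (div_nonneg hu.1.le hδ.le)
          ((div_le_one hδ).2 hu.2)
        have e : -(1 / δ) * u = -(u / δ) := by ring
        rw [e, ← mul_assoc]
        refine mul_le_mul_of_nonneg_right ?_ (hν0 u)
        calc u = 2 * δ * (u / δ / 2) := by field_simp
          _ ≤ _ := mul_le_mul_of_nonneg_left h (by positivity)
    _ ≤ ∫⁻ u in Ioi 0, ENNReal.ofReal (2 * δ * ((1 - Real.exp (-(1 / δ) * u)) * νd u)) :=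
        lintegral_mono_set Ioc_subset_Ioi_self
    _ = ENNReal.ofReal (2 * δ * φ (1 / δ)) := by
        rw [hφe _ hδ', ← integral_const_mul, ofReal_integral_eq_lintegral_ofReal
          ((hφi _ hδ').const_mul _)]
        filter_upwards [ae_restrict_mem measurableSet_Ioi] with x hx
        have hx : 0 < x := hx
        have : Real.exp (-(1 / δ) * x) ≤ 1 := Real.exp_le_one_iff.2 (by
          have := mul_pos hδ' hx; linarith)
        have := hν0 x
        have : 0 ≤ (1 - Real.exp (-(1 / δ) * x)) * νd x := mul_nonneg (by linarith) this
        positivity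

variable (hk : AntitoneOn (fun t => t * νd t) (Ioi (0 : ℝ)))

include hk

lemma mul_levyDensity_le {δ : ℝ} (hδ : 0 < δ) (hφpos : 0 < φ (1 / δ)) :
    δ * νd δ ≤ 2 * φ (1 / δ) := by
  have h := lintegral_mul_levyDensity_le hν0 hφi hφe hδ
  have h2 : ENNReal.ofReal (δ * νd δ * δ) ≤ ∫⁻ u in Ioc 0 δ, ENNReal.ofReal (u * νd u) := by
    calc ENNReal.ofReal (δ * νd δ * δ) = ∫⁻ _ in Ioc 0 δ, ENNReal.ofReal (δ * νd δ) := by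
          rw [setLIntegral_const, Real.volume_Ioc, sub_zero,
            ENNReal.ofReal_mul (mul_nonneg hδ.le (hν0 _))]
      _ ≤ _ := setLIntegral_mono' measurableSet_Ioc fun u hu =>
          ENNReal.ofReal_le_ofReal (hk hu.1 hδ hu.2)
  have h3 := (ENNReal.ofReal_le_ofReal_iff (by positivity)).1 (h2.trans h)
  nlinarith

lemma laplaceExponent_le_of_levyDensity {t M R : ℝ} (ht : 0 < t) (hM : 1 ≤ M) (hR : 1 ≤ R) :
    φ (1 / (M * t)) ≤ 2 / M * φ (1 / t) + (R - 1) * (t * νd t) + 2 * φ (1 / (R * t)) := by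
  have hM0 : 0 < M := by linarith
  have hR0 : 0 < R := by linarith
  have l1 : 0 < 1 / (M * t) := by positivity
  have l2 : 0 < 1 / t := by positivity
  have l3 : 0 < 1 / (R * t) := by positivity
  have hconst : IntegrableOn ((Ioc t (R * t)).indicator fun _ => νd t) (Ioi 0) := by
    refine Integrable.integrableOn ?_
    rw [integrable_indicator_iff measurableSet_Ioc]
    exact integrableOn_const (by simp)
  have hI : ∫ x in Ioi (0 : ℝ), (Ioc t (R * t)).indicator (fun _ => νd t) x =
      (R - 1) * (t * νd t) := by
    rw [setIntegral_indicator measurableSet_Ioc, inter_eq_right.2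
      (fun x (hx : x ∈ Ioc t (R * t)) => mem_Ioi.2 (ht.trans hx.1)), setIntegral_const]
    have : t ≤ R * t := by nlinarith
    simp only [Real.volume_real_Ioc_of_le this, smul_eq_mul]
    ring
  have hsum : IntegrableOn (fun x => 2 / M * ((1 - Real.exp (-(1 / t) * x)) * νd x) +
      (Ioc t (R * t)).indicator (fun _ => νd t) x) (Ioi 0) := ((hφi _ l2).const_mul _).add hconst
  rw [hφe _ l1, hφe _ l2, hφe _ l3, ← hI, ← integral_const_mul, ← integral_const_mul,
    ← integral_add ((hφi _ l2).const_mul _) hconst,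
    ← integral_add hsum ((hφi _ l3).const_mul _)]
  refine setIntegral_mono_on (hφi _ l1)
    (hsum.add ((hφi _ l3).const_mul _)) measurableSet_Ioi
    fun x hx => ?_
  have hx : 0 < x := hx
  have hle : ∀ l : ℝ, 0 < l → 0 ≤ (1 - Real.exp (-l * x)) * νd x := fun l hl => by
    have : Real.exp (-l * x) ≤ 1 := Real.exp_le_one_iff.2 (by nlinarith)
    exact mul_nonneg (by linarith) (hν0 x)
  have h2 := hle _ l2
  have h3 := hle _ l3
  have hind : 0 ≤ (Ioc t (R * t)).indicator (fun _ => νd t) x :=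
    indicator_nonneg (fun _ _ => hν0 t) x
  have hM2 : 0 < 2 / M := by positivity
  have hexp := Real.exp_pos (-(1 / (M * t)) * x)
  rcases le_or_gt x t with hxt | hxt
  · have ha : (1 - Real.exp (-(1 / (M * t)) * x)) * νd x ≤
        2 / M * ((1 - Real.exp (-(1 / t) * x)) * νd x) := by
      rw [← mul_assoc]
      refine mul_le_mul_of_nonneg_right ?_ (hν0 x)
      have e1 := Real.add_one_le_exp (-(1 / (M * t)) * x)
      have e2 := half_le_one_sub_exp_neg (y := x / t) (by positivity) ((div_le_one ht).2 hxt)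
      have e3 : -(1 / t) * x = -(x / t) := by ring
      rw [e3]
      calc 1 - Real.exp (-(1 / (M * t)) * x) ≤ 1 / (M * t) * x := by linarith
        _ = 2 / M * (x / t / 2) := by field_simp
        _ ≤ _ := mul_le_mul_of_nonneg_left e2 hM2.le
    nlinarith
  · rcases le_or_gt x (R * t) with hxR | hxR
    · rw [indicator_of_mem (mem_Ioc.2 ⟨hxt, hxR⟩)]
      have hkx : x * νd x ≤ t * νd t := hk ht hx hxt.le
      have : νd x ≤ νd t := by
        by_contra hcon
        push Not at hcon
        nlinarith [hν0 t]
      nlinarith [mul_nonneg hexp.le (hν0 x), mul_nonneg hM2.le h2]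
    · have e2 := half_le_one_sub_exp_neg_of_one_le (y := x / (R * t))
        ((one_le_div (by positivity)).2 hxR.le)
      have e3 : -(1 / (R * t)) * x = -(x / (R * t)) := by ring
      rw [e3] at h3 ⊢
      nlinarith [mul_nonneg hexp.le (hν0 x), mul_nonneg hM2.le h2,
        mul_le_mul_of_nonneg_right e2 (hν0 x)]

/-- Under weak scaling of the Laplace exponent, `φ (1 / t) ≲ t ν(t)`. -/
lemma exists_le_mul_levyDensity {β₁ β₂ cφ cφ' : ℝ} (hβ1 : 0 < β₁) (hβ2 : β₂ < 1)
    (hcφ : 0 < cφ) (hφpos : ∀ l : ℝ, 0 < l → 0 < φ l)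
    (hφs : ∀ l : ℝ, 0 < l → ∀ κ : ℝ, 1 ≤ κ →
      cφ * κ ^ β₁ * φ l ≤ φ (κ * l) ∧ φ (κ * l) ≤ cφ' * κ ^ β₂ * φ l) :
    ∃ c : ℝ, 0 < c ∧ ∀ t : ℝ, 0 < t → c * φ (1 / t) ≤ t * νd t := by
  obtain ⟨M, hM1, hM⟩ : ∃ M : ℝ, 1 ≤ M ∧ 8 * cφ' ≤ M ^ (1 - β₂) :=
    ((eventually_ge_atTop 1).and ((tendsto_rpow_atTop (by linarith : 0 < 1 - β₂)).eventually_ge_atTop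
      (8 * cφ'))).exists
  have hM0 : 0 < M := by linarith
  obtain ⟨R, hR1, hR⟩ : ∃ R : ℝ, 1 < R ∧ 4 * M / cφ ≤ R ^ β₁ :=
    ((eventually_gt_atTop 1).and ((tendsto_rpow_atTop hβ1).eventually_ge_atTop
      (4 * M / cφ))).exists
  have hR0 : 0 < R := by linarith
  refine ⟨1 / (M * (R - 1)), by have : 0 < R - 1 := by linarith
                                positivity, fun t ht => ?_⟩
  have h := laplaceExponent_le_of_levyDensity hν0 hφi hφe hk ht hM1 hR1.le
  have hp := hφpos (1 / t) (by positivity)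
  have h1 := (hφs (1 / (M * t)) (by positivity) M hM1).2
  have h2 := (hφs (1 / (R * t)) (by positivity) R hR1.le).1
  have e1 : M * (1 / (M * t)) = 1 / t := by field_simp
  have e2 : R * (1 / (R * t)) = 1 / t := by field_simp
  rw [e1] at h1
  rw [e2] at h2
  have hq := hφpos (1 / (M * t)) (by positivity)
  have hw := hφpos (1 / (R * t)) (by positivity)
  have h3 : 8 * cφ' * M ^ β₂ ≤ M := by
    calc 8 * cφ' * M ^ β₂ ≤ M ^ (1 - β₂) * M ^ β₂ :=
          mul_le_mul_of_nonneg_right hM (by positivity)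
      _ = M := by rw [← Real.rpow_add hM0]; simp
  have h4 : 8 * φ (1 / t) ≤ M * φ (1 / (M * t)) := by
    nlinarith [mul_le_mul_of_nonneg_right h3 hq.le]
  have h5 : 4 * M * φ (1 / (R * t)) ≤ φ (1 / t) := by
    rw [div_le_iff₀ hcφ] at hR
    nlinarith [mul_le_mul_of_nonneg_right hR hw.le]
  have h6 : M * φ (1 / (M * t)) ≤ 2 * φ (1 / t) + M * (R - 1) * (t * νd t)
      + 2 * M * φ (1 / (R * t)) := by
    calc M * φ (1 / (M * t)) ≤ M * (2 / M * φ (1 / t) + (R - 1) * (t * νd t)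
          + 2 * φ (1 / (R * t))) := mul_le_mul_of_nonneg_left h hM0.le
      _ = _ := by field_simp
  have hRM : 0 < M * (R - 1) := mul_pos hM0 (by linarith)
  rw [div_mul_eq_mul_div, div_le_iff₀ hRM]
  linarith

end LevyDensity

/-- One step of the iteration: near the diagonal the kernel is controlled by its mass,
away from it by its monotonicity. -/
lemma lintegral_mul_comp_sub_le {k g : ℝ → ℝ} {s δ A B D G : ℝ} (hδ : 0 < δ) (hδs : δ ≤ s)
    (hkanti : AntitoneOn k (Ioi 0)) (hk0 : ∀ u, 0 < u → 0 ≤ k u)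
    (hg0 : ∀ s, 0 ≤ g s) (hkA : ∫⁻ u in Ioc 0 δ, ENNReal.ofReal (k u) ≤ ENNReal.ofReal A)
    (hA : 0 ≤ A) (hD : k δ ≤ D) (hB : ∀ u ∈ Ioc 0 δ, g (s - u) ≤ B) (hB0 : 0 ≤ B) (hG : 0 ≤ G)
    (hgG : ∫⁻ u in Ici 0, ENNReal.ofReal (g u) ≤ ENNReal.ofReal G) :
    ∫⁻ u in Ioc 0 s, ENNReal.ofReal (k u * g (s - u)) ≤ ENNReal.ofReal (B * A + D * G) := by
  have hD0 : 0 ≤ D := (hk0 δ hδ).trans hD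
  rw [← Ioc_union_Ioc_eq_Ioc hδ.le hδs]
  refine (lintegral_union_le _ _ _).trans ?_
  rw [ENNReal.ofReal_add (by positivity) (by positivity)]
  refine add_le_add ?_ ?_
  · calc ∫⁻ u in Ioc 0 δ, ENNReal.ofReal (k u * g (s - u))
        ≤ ∫⁻ u in Ioc 0 δ, ENNReal.ofReal B * ENNReal.ofReal (k u) := by
          refine setLIntegral_mono' measurableSet_Ioc fun u hu => ?_
          rw [← ENNReal.ofReal_mul hB0, mul_comm B]
          exact ENNReal.ofReal_le_ofReal (mul_le_mul_of_nonneg_left (hB u hu) (hk0 u hu.1))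
      _ = ENNReal.ofReal B * ∫⁻ u in Ioc 0 δ, ENNReal.ofReal (k u) :=
          lintegral_const_mul' _ _ ENNReal.ofReal_ne_top
      _ ≤ ENNReal.ofReal B * ENNReal.ofReal A := by gcongr
      _ = _ := (ENNReal.ofReal_mul hB0).symm
  · calc ∫⁻ u in Ioc δ s, ENNReal.ofReal (k u * g (s - u))
        ≤ ∫⁻ u in Ioc δ s, ENNReal.ofReal D *
            (Ici 0).indicator (fun u => ENNReal.ofReal (g u)) (s - u) := by
          refine setLIntegral_mono' measurableSet_Ioc fun u hu => ?_
          rw [indicator_of_mem (mem_Ici.2 (sub_nonneg.2 hu.2)), ← ENNReal.ofReal_mul hD0]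
          exact ENNReal.ofReal_le_ofReal (mul_le_mul_of_nonneg_right
            ((hkanti hδ (hδ.trans hu.1) hu.1.le).trans hD) (hg0 _))
      _ ≤ ∫⁻ u, ENNReal.ofReal D *
            (Ici 0).indicator (fun u => ENNReal.ofReal (g u)) (s - u) := setLIntegral_le_lintegral _ _
      _ = ENNReal.ofReal D * ∫⁻ u in Ici 0, ENNReal.ofReal (g u) := by
          rw [lintegral_const_mul' _ _ ENNReal.ofReal_ne_top, lintegral_sub_left_eq_self
            (fun u => (Ici 0).indicator (fun u => ENNReal.ofReal (g u)) u),
            lintegral_indicator measurableSet_Ici]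
      _ ≤ ENNReal.ofReal D * ENNReal.ofReal G := by gcongr
      _ = _ := (ENNReal.ofReal_mul hD0).symm

/-- Pointwise upper bound for nonnegative solutions of `s g(s) ≤ r ∫₀ˢ k(u) g(s - u) du`. -/
lemma exists_le_of_convolution_inequality {k φ : ℝ → ℝ} {β₂ cφ' : ℝ} (hβ0 : 0 < β₂) (hβ2 : β₂ < 1)
    (hcφ' : 0 < cφ') (hφpos : ∀ l : ℝ, 0 < l → 0 < φ l)
    (hφs : ∀ l : ℝ, 0 < l → ∀ κ : ℝ, 1 ≤ κ → φ (κ * l) ≤ cφ' * κ ^ β₂ * φ l)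
    (hkanti : AntitoneOn k (Ioi 0)) (hk0 : ∀ u, 0 < u → 0 ≤ k u)
    (hk2 : ∀ δ, 0 < δ → k δ ≤ 2 * φ (1 / δ))
    (hkint : ∀ δ, 0 < δ → ∫⁻ u in Ioc 0 δ, ENNReal.ofReal (k u) ≤
      ENNReal.ofReal (2 * δ * φ (1 / δ))) :
    ∃ C : ℝ, 0 < C ∧ ∀ r : ℝ, 0 < r → ∀ g : ℝ → ℝ, Continuous g → (∀ s, 0 ≤ g s) →
      ∀ G : ℝ, 0 ≤ G → ∫⁻ u in Ici 0, ENNReal.ofReal (g u) ≤ ENNReal.ofReal G →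
      (∀ᵐ s : ℝ, 0 < s → ENNReal.ofReal (s * g s) ≤
        ENNReal.ofReal r * ∫⁻ u in Ioc 0 s, ENNReal.ofReal (k u * g (s - u))) →
      ∀ t : ℝ, 0 < t → g t ≤ C / t * (1 + (r * φ (1 / t)) ^ (1 / (1 - β₂))) * G := by
  have hb : 0 < 1 - β₂ := by linarith
  set a : ℝ := 1 / (1 - β₂) with ha
  have ha0 : 0 < a := by positivity
  have ha1 : a = 1 + β₂ * a := by rw [ha]; field_simp; ring
  set L : ℝ := 2 ^ (a + 2) * cφ' with hL
  have hL0 : 0 < L := by positivity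
  refine ⟨4 + 2 * (L * cφ') ^ a, by positivity, ?_⟩
  intro r hr g hgc hg0 G hG hgG hae t ht
  have hhc : Continuous fun s : ℝ => s ^ a * g s :=
    (Real.continuous_rpow_const ha0.le).mul hgc
  obtain ⟨s₀, hs₀, hmax⟩ := isCompact_Icc.exists_isMaxOn (nonempty_Icc.2 ht.le) hhc.continuousOn
  set M := s₀ ^ a * g s₀ with hM
  have hM0 : 0 ≤ M := mul_nonneg (Real.rpow_nonneg hs₀.1 _) (hg0 _)
  have hpt := hφpos (1 / t) (by positivity)
  set Q : ℝ := 2 + (L * cφ' * (r * φ (1 / t))) ^ a with hQ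
  have hbound : ∀ s, 0 < s → s ≤ t → ENNReal.ofReal (s * g s) ≤
        ENNReal.ofReal r * ∫⁻ u in Ioc 0 s, ENNReal.ofReal (k u * g (s - u)) →
        s ^ a * g s ≤ M / 2 + t ^ (a - 1) * Q * G := by
    intro s hs hst hInt
    have hps := hφpos (1 / s) (by positivity)
    set K : ℝ := 2 + (L * (r * φ (1 / s))) ^ a with hK
    have hK2 : 2 ≤ K := by
      have : 0 ≤ (L * (r * φ (1 / s))) ^ a := by positivity
      linarith
    have hK0 : 0 < K := by linarith
    have hδ : 0 < s / K := by positivity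
    have hδ2 : s / K ≤ s / 2 := div_le_div_of_nonneg_left hs.le two_pos hK2
    have e1 : 1 / (s / K) = K / s := by field_simp
    have hpK := hφpos (K / s) (by positivity)
    have hKpow : L * (r * φ (1 / s)) ≤ K ^ (1 - β₂) := by
      calc L * (r * φ (1 / s)) = ((L * (r * φ (1 / s))) ^ a) ^ (1 - β₂) := by
            rw [← Real.rpow_mul (by positivity), ha, one_div_mul_cancel hb.ne', Real.rpow_one]
        _ ≤ K ^ (1 - β₂) := Real.rpow_le_rpow (by positivity) (by linarith) hb.le
    have hcond : 2 ^ (a + 2) * (r * φ (K / s)) ≤ K := by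
      have h1 := hφs (1 / s) (by positivity) K (by linarith)
      rw [mul_one_div] at h1
      calc 2 ^ (a + 2) * (r * φ (K / s)) ≤ 2 ^ (a + 2) * (r * (cφ' * K ^ β₂ * φ (1 / s))) := by
            gcongr
        _ = L * (r * φ (1 / s)) * K ^ β₂ := by rw [hL]; ring
        _ ≤ K ^ (1 - β₂) * K ^ β₂ := by gcongr
        _ = K := by rw [← Real.rpow_add hK0]; simp
    have hconv := lintegral_mul_comp_sub_le (k := k) (g := g) (s := s) (δ := s / K)
      (A := 2 * (s / K) * φ (K / s)) (B := M * (s / 2) ^ (-a)) (D := 2 * φ (K / s)) (G := G)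
      hδ (by linarith) hkanti hk0 hg0 (by simpa only [e1] using hkint _ hδ) (by positivity)
      (by simpa only [e1] using hk2 _ hδ) ?_ (by positivity) hG hgG
    swap
    · intro u hu
      have hsu : s / 2 ≤ s - u := by linarith [hu.2]
      have hsu0 : 0 < s - u := by linarith
      have h1 : (s - u) ^ a * g (s - u) ≤ M :=
        hmax (show s - u ∈ Icc 0 t from ⟨hsu0.le, by linarith [hu.1]⟩)
      have h2 : (s / 2) ^ a ≤ (s - u) ^ a := Real.rpow_le_rpow (by positivity) hsu ha0.le
      rw [Real.rpow_neg (by positivity), ← div_eq_mul_inv, le_div_iff₀ (by positivity), mul_comm]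
      exact (mul_le_mul_of_nonneg_right h2 (hg0 _)).trans h1
    have hreal : s * g s ≤ r * (M * (s / 2) ^ (-a) * (2 * (s / K) * φ (K / s)) +
        2 * φ (K / s) * G) := by
      refine (ENNReal.ofReal_le_ofReal_iff (by positivity)).1 (hInt.trans ?_)
      rw [ENNReal.ofReal_mul hr.le]
      gcongr
    have hs2 : s ^ a * (s / 2) ^ (-a) = 2 ^ a := by
      rw [Real.div_rpow hs.le two_pos.le, Real.rpow_neg hs.le, Real.rpow_neg two_pos.le]
      field_simp
    have h2a : (2 : ℝ) ^ (a + 2) = 4 * 2 ^ a := by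
      rw [Real.rpow_add two_pos]; norm_num; ring
    have h2a1 : (1 : ℝ) ≤ 2 ^ a := Real.one_le_rpow one_le_two ha0.le
    rw [h2a] at hcond
    have hsa : 0 < s ^ a := by positivity
    have hmain : s * (s ^ a * g s) ≤ s * (M / 2) + K * s ^ a * G := by
      calc s * (s ^ a * g s) = s ^ a * (s * g s) := by ring
        _ ≤ s ^ a * (r * (M * (s / 2) ^ (-a) * (2 * (s / K) * φ (K / s)) +
              2 * φ (K / s) * G)) := by gcongr
        _ = (4 * (s ^ a * (s / 2) ^ (-a)) * (r * φ (K / s))) / K * (s * (M / 2)) +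
              2 * (r * φ (K / s)) * s ^ a * G := by field_simp; ring
        _ ≤ 1 * (s * (M / 2)) + K * s ^ a * G := by
            rw [hs2]
            have : 2 * (r * φ (K / s)) ≤ K := by
              have : 0 < r * φ (K / s) := by positivity
              nlinarith
            gcongr
            exact (div_le_one hK0).2 hcond
        _ = _ := by ring
    have hKQ : K * s ^ a ≤ s * (t ^ (a - 1) * Q) := by
      have hsa' : s ^ a = s * s ^ (a - 1) := by
        rw [Real.rpow_sub_one hs.ne']; field_simp
      have h1 : s ^ (a - 1) ≤ t ^ (a - 1) :=
        Real.rpow_le_rpow hs.le hst (by rw [ha1]; have := mul_pos hβ0 ha0; linarith)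
      have h2 : (L * (r * φ (1 / s))) ^ a * s ^ (a - 1) ≤
          t ^ (a - 1) * (L * cφ' * (r * φ (1 / t))) ^ a := by
        have h3 := hφs (1 / t) (by positivity) (t / s) ((one_le_div hs).2 hst)
        have e3 : t / s * (1 / t) = 1 / s := by field_simp
        rw [e3] at h3
        calc (L * (r * φ (1 / s))) ^ a * s ^ (a - 1)
            ≤ (L * (r * (cφ' * (t / s) ^ β₂ * φ (1 / t)))) ^ a * s ^ (a - 1) := by gcongr
          _ = ((t / s) ^ β₂ * (L * cφ' * (r * φ (1 / t)))) ^ a * s ^ (a - 1) := by ring_nf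
          _ = (t / s) ^ (a - 1) * s ^ (a - 1) * (L * cφ' * (r * φ (1 / t))) ^ a := by
              rw [Real.mul_rpow (by positivity) (by positivity), ← Real.rpow_mul (by positivity)]
              have : β₂ * a = a - 1 := by linarith
              rw [this]; ring
          _ = _ := by rw [← Real.mul_rpow (by positivity) hs.le, div_mul_cancel₀ _ hs.ne']
      rw [hsa']
      calc K * (s * s ^ (a - 1)) = s * (2 * s ^ (a - 1) +
            (L * (r * φ (1 / s))) ^ a * s ^ (a - 1)) := by rw [hK]; ring
        _ ≤ s * (2 * t ^ (a - 1) + t ^ (a - 1) * (L * cφ' * (r * φ (1 / t))) ^ a) := by gcongr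
        _ = _ := by rw [hQ]; ring
    have : s * (s ^ a * g s) ≤ s * (M / 2 + t ^ (a - 1) * Q * G) := by
      have := mul_le_mul_of_nonneg_right hKQ hG
      linarith
    exact le_of_mul_le_mul_left this hs
  have hMle : M ≤ M / 2 + t ^ (a - 1) * Q * G := by
    by_contra hcon
    push Not at hcon
    have hopen : IsOpen ({s : ℝ | M / 2 + t ^ (a - 1) * Q * G < s ^ a * g s} ∩ Ioo 0 t) :=
      (isOpen_lt continuous_const hhc).inter isOpen_Ioo
    have hne : ({s : ℝ | M / 2 + t ^ (a - 1) * Q * G < s ^ a * g s} ∩ Ioo 0 t).Nonempty := by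
      have hcl : s₀ ∈ closure (Ioo 0 t) := by rw [closure_Ioo ht.ne]; exact hs₀
      exact mem_closure_iff.1 hcl _ (isOpen_lt continuous_const hhc) hcon
    obtain ⟨s, ⟨hs1, hs2⟩, hs3⟩ := (Measure.dense_of_ae hae).inter_open_nonempty _ hopen hne
    exact absurd (hbound s hs2.1 hs2.2.le (hs3 hs2.1)) (not_le.2 hs1)
  have htM : t ^ a * g t ≤ M := hmax (show t ∈ Icc 0 t from ⟨ht.le, le_rfl⟩)
  have hta : t ^ a = t * t ^ (a - 1) := by
    rw [Real.rpow_sub_one ht.ne']; field_simp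
  have hta1 : 0 < t ^ (a - 1) := by positivity
  have hfin : t * g t ≤ 2 * Q * G := by
    have : t ^ (a - 1) * (t * g t) ≤ t ^ (a - 1) * (2 * Q * G) := by
      rw [hta] at htM
      nlinarith
    exact le_of_mul_le_mul_left this hta1
  have hQ2 : 2 * Q ≤ (4 + 2 * (L * cφ') ^ a) * (1 + (r * φ (1 / t)) ^ a) := by
    rw [hQ, Real.mul_rpow (by positivity) (by positivity)]
    have h1 : 0 ≤ (r * φ (1 / t)) ^ a := by positivity
    have h2 : 0 ≤ (L * cφ') ^ a := by positivity
    nlinarith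
  rw [div_mul_eq_mul_div, div_mul_eq_mul_div, le_div_iff₀ ht, mul_comm]
  exact hfin.trans (mul_le_mul_of_nonneg_right hQ2 hG)


/-- Upper bound for the subordinator density, with an exponential tilt of free rate `l`. -/
lemma exists_density_le {k φ : ℝ → ℝ} {f : ℝ → ℝ → ℝ} {β₂ cφ' : ℝ} (hβ0 : 0 < β₂) (hβ2 : β₂ < 1)
    (hcφ' : 0 < cφ') (hφpos : ∀ l : ℝ, 0 < l → 0 < φ l)
    (hφs : ∀ l : ℝ, 0 < l → ∀ κ : ℝ, 1 ≤ κ → φ (κ * l) ≤ cφ' * κ ^ β₂ * φ l)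
    (hkanti : AntitoneOn k (Ioi 0)) (hk0 : ∀ u, 0 < u → 0 ≤ k u)
    (hk2 : ∀ δ, 0 < δ → k δ ≤ 2 * φ (1 / δ))
    (hkint : ∀ δ, 0 < δ → ∫⁻ u in Ioc 0 δ, ENNReal.ofReal (k u) ≤
      ENNReal.ofReal (2 * δ * φ (1 / δ)))
    (hfc : ∀ r, 0 < r → Continuous (f r)) (hf0 : ∀ r s, 0 ≤ f r s)
    (hlap : ∀ r, 0 < r → ∀ l, 0 < l → ∫⁻ u in Ici 0, ENNReal.ofReal (Real.exp (-l * u) * f r u) =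
      ENNReal.ofReal (Real.exp (-r * φ l)))
    (hconv : ∀ r, 0 < r → ∀ᵐ s : ℝ, 0 < s → ENNReal.ofReal (s * f r s) =
      ENNReal.ofReal r * ∫⁻ u in Ioc 0 s, ENNReal.ofReal (k u * f r (s - u))) :
    ∃ C : ℝ, 0 < C ∧ ∀ r, 0 < r → ∀ t, 0 < t → ∀ l, 0 < l →
      f r t ≤ C / t * (1 + (r * φ (1 / t)) ^ (1 / (1 - β₂))) * Real.exp (l * t - r * φ l) := by
  obtain ⟨C, hC, h⟩ := exists_le_of_convolution_inequality hβ0 hβ2 hcφ' hφpos hφs hkanti hk0 hk2 hkint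
  refine ⟨C, hC, fun r hr t ht l hl => ?_⟩
  have hfc' := hfc r hr
  have key := h r hr (fun s => Real.exp (-l * s) * f r s) (by fun_prop)
    (fun s => mul_nonneg (Real.exp_pos _).le (hf0 r s)) (Real.exp (-r * φ l)) (Real.exp_pos _).le
    (hlap r hr l hl).le ?_ t ht
  · have e : f r t = Real.exp (l * t) * (Real.exp (-l * t) * f r t) := by
      rw [← mul_assoc, ← Real.exp_add]; simp
    have e2 : Real.exp (l * t - r * φ l) = Real.exp (l * t) * Real.exp (-r * φ l) := by
      rw [← Real.exp_add]; ring_nf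
    rw [e, e2]
    calc _ ≤ Real.exp (l * t) * _ := mul_le_mul_of_nonneg_left key (Real.exp_pos _).le
      _ = _ := by ring
  · filter_upwards [hconv r hr] with s hs hs0
    have hexp := Real.exp_pos (-l * s)
    calc ENNReal.ofReal (s * (Real.exp (-l * s) * f r s))
        = ENNReal.ofReal (Real.exp (-l * s)) * ENNReal.ofReal (s * f r s) := by
          rw [← ENNReal.ofReal_mul hexp.le]; ring_nf
      _ = ENNReal.ofReal r * ∫⁻ u in Ioc 0 s,
            ENNReal.ofReal (Real.exp (-l * s)) * ENNReal.ofReal (k u * f r (s - u)) := by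
          rw [hs hs0, lintegral_const_mul' _ _ ENNReal.ofReal_ne_top]; ring
      _ ≤ _ := by
          refine mul_le_mul_right (setLIntegral_mono' measurableSet_Ioc fun u hu => ?_) _
          rw [← ENNReal.ofReal_mul hexp.le]
          refine ENNReal.ofReal_le_ofReal ?_
          have h1 : Real.exp (-l * s) ≤ Real.exp (-l * (s - u)) :=
            Real.exp_le_exp.2 (by nlinarith [hu.1])
          calc Real.exp (-l * s) * (k u * f r (s - u))
              ≤ Real.exp (-l * (s - u)) * (k u * f r (s - u)) :=
                mul_le_mul_of_nonneg_right h1 (mul_nonneg (hk0 u hu.1) (hf0 _ _))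
            _ = _ := by ring

/-- The mass a density gives to `[0, t)`, in terms of its Laplace transform. -/
lemma half_exp_le_lintegral_Ico {f : ℝ → ℝ} {t l A : ℝ} (hl : 0 < l)
    (hf0 : ∀ s, 0 ≤ f s)
    (hlap : ∫⁻ u in Ici 0, ENNReal.ofReal (Real.exp (-l * u) * f u) = ENNReal.ofReal (Real.exp (-A)))
    (hlap' : ∫⁻ u in Ici 0, ENNReal.ofReal (Real.exp (-(l / 2) * u) * f u) ≤ 1)
    (hA : A ≤ l * t / 2 - Real.log 2) (ht : 0 ≤ t) :
    ENNReal.ofReal (Real.exp (-A) / 2) ≤ ∫⁻ u in Ico 0 t, ENNReal.ofReal (f u) := by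
  have h1 : ∫⁻ u in Ico 0 t, ENNReal.ofReal (Real.exp (-l * u) * f u) ≤
      ∫⁻ u in Ico 0 t, ENNReal.ofReal (f u) := by
    refine setLIntegral_mono' measurableSet_Ico fun u hu => ENNReal.ofReal_le_ofReal ?_
    exact mul_le_of_le_one_left (hf0 u) (Real.exp_le_one_iff.2 (by nlinarith [hu.1]))
  have h2 : ∫⁻ u in Ici t, ENNReal.ofReal (Real.exp (-l * u) * f u) ≤
      ENNReal.ofReal (Real.exp (-A) / 2) := by
    calc ∫⁻ u in Ici t, ENNReal.ofReal (Real.exp (-l * u) * f u)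
        ≤ ∫⁻ u in Ici t, ENNReal.ofReal (Real.exp (-(l * t / 2))) *
            ENNReal.ofReal (Real.exp (-(l / 2) * u) * f u) := by
          refine setLIntegral_mono' measurableSet_Ici fun u hu => ?_
          rw [← ENNReal.ofReal_mul (Real.exp_pos _).le, ← mul_assoc, ← Real.exp_add]
          refine ENNReal.ofReal_le_ofReal (mul_le_mul_of_nonneg_right ?_ (hf0 u))
          have hu : t ≤ u := hu
          exact Real.exp_le_exp.2 (by nlinarith)
      _ ≤ ENNReal.ofReal (Real.exp (-(l * t / 2))) * 1 := by
          rw [lintegral_const_mul' _ _ ENNReal.ofReal_ne_top]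
          gcongr
          exact (lintegral_mono_set (Ici_subset_Ici.2 ht)).trans hlap'
      _ ≤ _ := by
          rw [mul_one]
          refine ENNReal.ofReal_le_ofReal ?_
          calc Real.exp (-(l * t / 2)) ≤ Real.exp (-A - Real.log 2) :=
                Real.exp_le_exp.2 (by linarith)
            _ = _ := by rw [Real.exp_sub, Real.exp_log two_pos]
  have h3 : ENNReal.ofReal (Real.exp (-A) / 2) + ENNReal.ofReal (Real.exp (-A) / 2) ≤
      (∫⁻ u in Ico 0 t, ENNReal.ofReal (f u)) + ENNReal.ofReal (Real.exp (-A) / 2) := by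
    have hp := Real.exp_pos (-A)
    rw [← ENNReal.ofReal_add (by positivity) (by positivity), add_halves, ← hlap,
      ← Ico_union_Ici_eq_Ici ht]
    exact (lintegral_union_le _ _ _).trans (add_le_add h1 h2)
  exact (ENNReal.add_le_add_iff_right ENNReal.ofReal_ne_top).1 h3

/-- Lower bound for solutions of `s f(s) = r ∫₀ˢ k(u) f(s - u) du` by their mass near `0`. -/
lemma mul_mass_le_of_convolution {k f : ℝ → ℝ} {r t M : ℝ} (hr : 0 < r) (ht : 0 < t)
    (hkanti : AntitoneOn k (Ioi 0)) (hk0 : ∀ u, 0 < u → 0 ≤ k u) (hfc : Continuous f)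
    (hf0 : ∀ s, 0 ≤ f s)
    (hM : ENNReal.ofReal M ≤ ∫⁻ u in Ico 0 (t / 2), ENNReal.ofReal (f u))
    (hconv : ∀ᵐ s : ℝ, 0 < s → ENNReal.ofReal (s * f s) =
      ENNReal.ofReal r * ∫⁻ u in Ioc 0 s, ENNReal.ofReal (k u * f (s - u))) :
    r * k t * M ≤ t * f t := by
  have hkt := hk0 t ht
  have hclosed : IsClosed {s | r * k t * M ≤ s * f s} :=
    isClosed_le continuous_const (continuous_id.mul hfc)
  have hsub : Ioo (t / 2) t ∩ {s | 0 < s → ENNReal.ofReal (s * f s) =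
      ENNReal.ofReal r * ∫⁻ u in Ioc 0 s, ENNReal.ofReal (k u * f (s - u))} ⊆
      {s | r * k t * M ≤ s * f s} := by
    rintro s ⟨⟨hs1, hs2⟩, hs⟩
    have hs0 : 0 < s := by linarith
    have hfs := hf0 s
    rw [mem_ofPred_eq, ← ENNReal.ofReal_le_ofReal_iff (by positivity), hs hs0, mul_assoc,
      ENNReal.ofReal_mul hr.le, ENNReal.ofReal_mul hkt]
    refine mul_le_mul_right ?_ _
    calc ENNReal.ofReal (k t) * ENNReal.ofReal M
        ≤ ENNReal.ofReal (k t) * ∫⁻ u in Ico 0 (t / 2), ENNReal.ofReal (f u) := by gcongr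
      _ ≤ ENNReal.ofReal (k t) * ∫⁻ u in Ico 0 s, ENNReal.ofReal (f u) := by
          gcongr
      _ = ENNReal.ofReal (k t) * ∫⁻ u in Ioc 0 s, ENNReal.ofReal (f (s - u)) := by
          rw [← lintegral_indicator measurableSet_Ioc, ← lintegral_indicator measurableSet_Ico,
            ← lintegral_sub_left_eq_self _ s]
          congr 2 with u
          simp only [indicator, mem_Ico, mem_Ioc]
          congr 1
          simp only [sub_nonneg, sub_lt_self_iff, eq_iff_iff]
          tauto
      _ = ∫⁻ u in Ioc 0 s, ENNReal.ofReal (k t) * ENNReal.ofReal (f (s - u)) :=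
          (lintegral_const_mul' _ _ ENNReal.ofReal_ne_top).symm
      _ ≤ _ := by
          refine setLIntegral_mono' measurableSet_Ioc fun u hu => ?_
          rw [← ENNReal.ofReal_mul hkt]
          exact ENNReal.ofReal_le_ofReal (mul_le_mul_of_nonneg_right
            (hkanti hu.1 ht (hu.2.trans hs2.le)) (hf0 _))
  have hd := (Measure.dense_of_ae hconv).open_subset_closure_inter (isOpen_Ioo (a := t / 2) (b := t))
  have hmem : t ∈ closure (Ioo (t / 2) t) := by
    rw [closure_Ioo (by linarith)]; exact right_mem_Icc.2 (by linarith)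
  exact closure_minimal hsub hclosed ((closure_minimal hd isClosed_closure) hmem)

/-- Positivity and multiplicative form of the weak scaling of a Laplace exponent. -/
lemma laplaceExponent_pos_and_scaling {ν : Measure ℝ} {φ : ℝ → ℝ} {β₁ β₂ cφ cφ' : ℝ}
    (hφ : ∀ l : ℝ, 0 < l → φ l = ∫ x in Ioi (0:ℝ), (1 - Real.exp (-l * x)) ∂ν) (hcφ : 0 < cφ)
    (hφscale : ∀ l : ℝ, 0 < l → ∀ κ : ℝ, 1 ≤ κ →
      cφ * κ ^ β₁ ≤ φ (κ * l) / φ l ∧ φ (κ * l) / φ l ≤ cφ' * κ ^ β₂) :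
    (∀ l, 0 < l → 0 < φ l) ∧ ∀ l, 0 < l → ∀ κ, 1 ≤ κ →
      cφ * κ ^ β₁ * φ l ≤ φ (κ * l) ∧ φ (κ * l) ≤ cφ' * κ ^ β₂ * φ l := by
  have hpos : ∀ l, 0 < l → 0 < φ l := fun l hl => by
    refine lt_of_le_of_ne ?_ fun h0 => ?_
    · rw [hφ l hl]
      refine setIntegral_nonneg measurableSet_Ioi fun x (hx : 0 < x) => ?_
      have : Real.exp (-l * x) ≤ 1 := Real.exp_le_one_iff.2 (by nlinarith)
      linarith
    · have h := (hφscale l hl 1 le_rfl).1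
      rw [← h0, div_zero, Real.one_rpow] at h
      linarith
  refine ⟨hpos, fun l hl κ hκ => ?_⟩
  have h := hφscale l hl κ hκ
  exact ⟨(le_div_iff₀ (hpos l hl)).1 h.1, (div_le_iff₀ (hpos l hl)).1 h.2⟩

/-- Two-sided bounds for the density of a subordinator with weakly scaling Laplace exponent. -/
lemma subordinator_density_bounds {ν : Measure ℝ}
    (hν_loc : ∫⁻ x in Ioi (0:ℝ), ENNReal.ofReal (min 1 x) ∂ν ≠ ⊤) {φ : ℝ → ℝ}
    (hφ : ∀ l : ℝ, 0 < l → φ l = ∫ x in Ioi (0:ℝ), (1 - Real.exp (-l * x)) ∂ν)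
    {β₁ β₂ cφ cφ' : ℝ} (hβ : 0 < β₁ ∧ β₁ < β₂ ∧ β₂ < 1) (hcφ : 0 < cφ ∧ 0 < cφ')
    (hφscale : ∀ l : ℝ, 0 < l → ∀ κ : ℝ, 1 ≤ κ →
      cφ * κ ^ β₁ ≤ φ (κ * l) / φ l ∧ φ (κ * l) / φ l ≤ cφ' * κ ^ β₂)
    {νd : ℝ → ℝ} (hνd_nn : ∀ t : ℝ, 0 ≤ νd t) (hνd_meas : Measurable νd)
    (hν_dens : ∀ A : Set ℝ, MeasurableSet A →
      ν A = ∫⁻ x in A ∩ Ioi 0, ENNReal.ofReal (νd x))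
    (hself : AntitoneOn (fun t => t * νd t) (Ioi (0:ℝ)))
    {μr : ℝ → Measure ℝ} (hprob : ∀ r : ℝ, 0 < r → IsProbabilityMeasure (μr r))
    (hlap : ∀ r : ℝ, 0 < r → ∀ l : ℝ, 0 < l →
      ∫ s, Real.exp (-l * s) ∂(μr r) = Real.exp (-r * φ l))
    {pbar : ℝ → ℝ → ℝ} (hpbar_nn : ∀ r t : ℝ, 0 ≤ pbar r t)
    (hpbar_cont : ∀ r : ℝ, 0 < r → Continuous (pbar r))
    (hdens : ∀ r : ℝ, 0 < r → ∀ A : Set ℝ, MeasurableSet A →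
      μr r A = ∫⁻ t in A ∩ Ici 0, ENNReal.ofReal (pbar r t)) :
    (∀ a b, 0 < a → a ≤ b → φ a ≤ φ b) ∧
    (∃ C : ℝ, 0 < C ∧ ∀ r, 0 < r → ∀ t, 0 < t → ∀ l, 0 < l →
      pbar r t ≤ C / t * (1 + (r * φ (1 / t)) ^ (1 / (1 - β₂))) * Real.exp (l * t - r * φ l)) ∧
    ∃ c : ℝ, 0 < c ∧ ∀ r, 0 < r → ∀ t, 0 < t → ∀ l, 0 < l →
      r * φ l ≤ l * t / 4 - Real.log 2 →
      c / t * (r * φ (1 / t)) * Real.exp (-(r * φ l)) ≤ pbar r t := by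
  obtain ⟨hφpos, hφs⟩ := laplaceExponent_pos_and_scaling hφ hcφ.1 hφscale
  have hβ0 : 0 < β₂ := hβ.1.trans hβ.2.1
  set N := ν.restrict (Ioi 0) with hNdef
  have hN : N = (volume.restrict (Ioi 0)).withDensity fun x => ENNReal.ofReal (νd x) := by
    ext A hA
    rw [hNdef, Measure.restrict_apply hA, hν_dens _ (hA.inter measurableSet_Ioi),
      withDensity_apply _ hA, Measure.restrict_restrict hA, inter_assoc, inter_self]
  have hN0 : ∀ᵐ x ∂N, 0 ≤ x := by
    filter_upwards [ae_restrict_mem measurableSet_Ioi] with x hx using le_of_lt hx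
  have hφi : ∀ l : ℝ, 0 < l →
      IntegrableOn (fun x => (1 - Real.exp (-l * x)) * νd x) (Ioi 0) := by
    intro l hl
    have h := (hasDerivAt_integral_one_sub_exp N hN0 hν_loc hl).1
    rw [hN, integrable_withDensity_iff (by fun_prop) (by simp)] at h
    simp only [ENNReal.toReal_ofReal (hνd_nn _)] at h
    exact h
  have hφe : ∀ l : ℝ, 0 < l → φ l = ∫ x in Ioi (0:ℝ), (1 - Real.exp (-l * x)) * νd x := by
    intro l hl
    rw [hφ l hl, hN, integral_withDensity_eq_integral_toReal_smul (by fun_prop) (by simp)]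
    refine integral_congr_ae (Eventually.of_forall fun x => ?_)
    simp only [ENNReal.toReal_ofReal (hνd_nn _), smul_eq_mul, mul_comm]
  have hP : ∀ r, 0 < r →
      μr r = (volume.restrict (Ici 0)).withDensity fun x => ENNReal.ofReal (pbar r x) := by
    intro r hr
    ext A hA
    rw [hdens r hr A hA, withDensity_apply _ hA, Measure.restrict_restrict hA]
  have hconv : ∀ r, 0 < r → ∀ᵐ s : ℝ, 0 < s → ENNReal.ofReal (s * pbar r s) =
      ENNReal.ofReal r * ∫⁻ u in Ioc 0 s, ENNReal.ofReal (u * νd u * pbar r (s - u)) := by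
    intro r hr
    have := hprob r hr
    exact subordinator_density_equation νd (pbar r) hνd_meas (hpbar_cont r hr).measurable
      (hpbar_nn r) N (μr r) hN (hP r hr) hν_loc φ hφ r hr (hlap r hr)
  have hlap' : ∀ r, 0 < r → ∀ l, 0 < l →
      ∫⁻ u in Ici 0, ENNReal.ofReal (Real.exp (-l * u) * pbar r u) =
        ENNReal.ofReal (Real.exp (-r * φ l)) := by
    intro r hr l hl
    have hm := (hpbar_cont r hr).measurable
    have hInt : Integrable (fun s => Real.exp (-l * s)) (μr r) :=
      not_imp_comm.1 integral_undef (by rw [hlap r hr l hl]; exact (Real.exp_pos _).ne')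
    rw [← hlap r hr l hl, ofReal_integral_eq_lintegral_ofReal hInt
      (Eventually.of_forall fun _ => (Real.exp_pos _).le), hP r hr,
      lintegral_withDensity_eq_lintegral_mul _ (by fun_prop) (by fun_prop)]
    refine lintegral_congr fun u => ?_
    rw [Pi.mul_apply, ← ENNReal.ofReal_mul (hpbar_nn r u), mul_comm]
  have hk0 : ∀ u, 0 < u → 0 ≤ u * νd u := fun u hu => mul_nonneg hu.le (hνd_nn u)
  have hφ1 : ∀ t : ℝ, 0 < t → 0 < φ (1 / t) := fun t ht => hφpos _ (by positivity)
  refine ⟨fun a b ha hab => laplaceExponent_mono hνd_nn hφi hφe ha hab, ?_, ?_⟩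
  · exact exists_density_le hβ0 hβ.2.2 hcφ.2 hφpos (fun l hl κ hκ => (hφs l hl κ hκ).2) hself hk0
      (fun δ hδ => mul_levyDensity_le hνd_nn hφi hφe hself hδ (hφ1 δ hδ))
      (fun δ hδ => lintegral_mul_levyDensity_le hνd_nn hφi hφe hδ) hpbar_cont hpbar_nn hlap' hconv
  · obtain ⟨c, hc, h⟩ := exists_le_mul_levyDensity hνd_nn hφi hφe hself hβ.1 hβ.2.2 hcφ.1 hφpos hφs
    refine ⟨c / 2, by positivity, fun r hr t ht l hl hA => ?_⟩
    have hM : ENNReal.ofReal (Real.exp (-(r * φ l)) / 2) ≤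
        ∫⁻ u in Ico 0 (t / 2), ENNReal.ofReal (pbar r u) := by
      refine half_exp_le_lintegral_Ico hl (hpbar_nn r) ?_ ?_ (by linarith) (by positivity)
      · rw [hlap' r hr l hl, neg_mul]
      · rw [hlap' r hr _ (half_pos hl)]
        have := mul_pos hr (hφpos _ (half_pos hl))
        simpa using this.le
    have h1 := mul_mass_le_of_convolution hr ht hself hk0 (hpbar_cont r hr) (hpbar_nn r)
      hM (hconv r hr)
    have h2 := h t ht
    rw [div_mul_eq_mul_div, div_mul_eq_mul_div, div_le_iff₀ ht, mul_comm (pbar r t)]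
    refine le_trans ?_ h1
    calc c / 2 * (r * φ (1 / t)) * Real.exp (-(r * φ l))
        = r * (c * φ (1 / t)) * (Real.exp (-(r * φ l)) / 2) := by ring
      _ ≤ _ := by gcongr

lemma exists_rpow_le_exp {κ c : ℝ} (hκ : 0 ≤ κ) (hc : 0 < c) :
    ∃ C : ℝ, 0 < C ∧ ∀ v : ℝ, 0 ≤ v → v ^ κ ≤ C * Real.exp (c * v) := by
  obtain ⟨k, hk⟩ := exists_nat_ge κ
  refine ⟨1 + k.factorial / c ^ k, by positivity, fun v hv => ?_⟩
  have h1 : v ^ κ ≤ 1 + v ^ k := by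
    rcases le_total v 1 with h | h
    · have := Real.rpow_le_one hv h hκ
      have := pow_nonneg hv k
      linarith
    · have := Real.rpow_le_rpow_of_exponent_le h hk
      rw [Real.rpow_natCast] at this
      linarith
  have h2 := Real.pow_div_factorial_le_exp (c * v) (by positivity) k
  have h3 : 1 ≤ Real.exp (c * v) := Real.one_le_exp (by positivity)
  calc v ^ κ ≤ 1 + v ^ k := h1
    _ = 1 + k.factorial / c ^ k * ((c * v) ^ k / k.factorial) := by
        rw [mul_pow]; field_simp
    _ ≤ Real.exp (c * v) + k.factorial / c ^ k * Real.exp (c * v) := by gcongr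
    _ = _ := by ring

lemma le_rpow_one_div_of_rpow_le {a b c : ℝ} (ha : 0 ≤ a) (hc : 0 < c)
    (h : a ^ c ≤ b) : a ≤ b ^ (1 / c) := by
  calc a = (a ^ c) ^ (1 / c) := by
        rw [← Real.rpow_mul ha, mul_one_div_cancel hc.ne', Real.rpow_one]
    _ ≤ _ := by gcongr

section Balance

variable {Φ : ℝ → ℝ} {α₁ α₂ cΦ cΦ' : ℝ}

lemma mul_rpow_le_of_balance (hcΦ : 0 < cΦ)
    (hΦs : ∀ r R : ℝ, 0 < r → r ≤ R → cΦ * (R / r) ^ α₁ * Φ r ≤ Φ R)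
    {c c' d a b s S : ℝ} (hc : 0 < c) (hc' : 0 < c') (hd : 0 < d) (hb : 0 < b) (hba : b ≤ a)
    (h1 : c * Φ (d / b) ≤ s / b) (h2 : S / a ≤ c' * Φ (d / a)) :
    S * (a / b) ^ (α₁ - 1) ≤ c' / (c * cΦ) * s := by
  have ha := hb.trans_le hba
  have h := hΦs (d / a) (d / b) (by positivity) (by gcongr)
  have e : d / b / (d / a) = a / b := by field_simp
  rw [e] at h
  rw [div_le_iff₀ ha] at h2
  rw [le_div_iff₀ hb] at h1
  rw [Real.rpow_sub_one (by positivity)]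
  have hab : 0 < (a / b) ^ α₁ := by positivity
  calc S * ((a / b) ^ α₁ / (a / b)) ≤ c' * Φ (d / a) * a * ((a / b) ^ α₁ / (a / b)) := by gcongr
    _ = c' * b / cΦ * (cΦ * (a / b) ^ α₁ * Φ (d / a)) := by field_simp
    _ ≤ c' * b / cΦ * Φ (d / b) := by gcongr
    _ = c' / (c * cΦ) * (c * Φ (d / b) * b) := by field_simp
    _ ≤ _ := by gcongr

lemma le_mul_rpow_of_balance (hcΦ' : 0 < cΦ')
    (hΦs : ∀ r R : ℝ, 0 < r → r ≤ R → Φ R ≤ cΦ' * (R / r) ^ α₂ * Φ r)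
    {c c' d a b s S : ℝ} (hc : 0 < c) (hc' : 0 < c') (hd : 0 < d) (hb : 0 < b) (hba : b ≤ a)
    (h1 : S / b ≤ c' * Φ (d / b)) (h2 : c * Φ (d / a) ≤ s / a) :
    S ≤ c' * cΦ' / c * (a / b) ^ (α₂ - 1) * s := by
  have ha := hb.trans_le hba
  have h := hΦs (d / a) (d / b) (by positivity) (by gcongr)
  have e : d / b / (d / a) = a / b := by field_simp
  rw [e] at h
  rw [div_le_iff₀ hb] at h1
  rw [le_div_iff₀ ha] at h2
  rw [Real.rpow_sub_one (by positivity)]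
  have hab : 0 < (a / b) ^ α₂ := by positivity
  calc S ≤ c' * Φ (d / b) * b := h1
    _ ≤ c' * (cΦ' * (a / b) ^ α₂ * Φ (d / a)) * b := by gcongr
    _ = c' * cΦ' / c * ((a / b) ^ α₂ / (a / b)) * (c * Φ (d / a) * a) := by field_simp
    _ ≤ _ := by gcongr

/-- Below the scale `n / F`, the rate `m` dominates a power of `n / (r F)` times `n`. -/
lemma exists_mul_rpow_le_rate (hα : 1 < α₁ ∧ α₁ ≤ α₂) (hcΦ : 0 < cΦ ∧ 0 < cΦ')
    (hΦs : ∀ r R : ℝ, 0 < r → r ≤ R →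
      cΦ * (R / r) ^ α₁ * Φ r ≤ Φ R ∧ Φ R ≤ cΦ' * (R / r) ^ α₂ * Φ r)
    {c c' : ℝ} (hc : 0 < c) (hc' : 0 < c') :
    ∃ k ε : ℝ, 0 < k ∧ 0 < ε ∧ ∀ d n F r m : ℝ, 0 < d → 0 < n → 0 < F → 0 < r → 0 < m →
      1 / F ≤ c' * Φ (d / n) → c * Φ (d / m) ≤ r / m → r * F ≤ n →
      k * n * (n / (r * F)) ^ ε ≤ m := by
  have hb1 : 0 < α₁ - 1 := by linarith [hα.1]
  have hb2 : 0 < α₂ - 1 := by linarith [hα.1, hα.2]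
  set C₀ := c' / (c * cΦ) with hC₀
  set C₁ := c' * cΦ' / c with hC₁
  set ε := 1 / (α₂ - 1) with hε
  have hcΦ1 := hcΦ.1
  have hcΦ2 := hcΦ.2
  have hC₀p : 0 < C₀ := by positivity
  have hC₁p : 0 < C₁ := by positivity
  have hεp : 0 < ε := by positivity
  refine ⟨1 / (C₀ ^ (1 / (α₁ - 1)) * C₀ ^ ε + C₁ ^ ε), ε, by positivity, hεp, ?_⟩
  intro d n F r m hd hn hF hr hm h1 h2 hrF
  have hS : n / F / n ≤ c' * Φ (d / n) := by rwa [div_div, mul_comm F n, ← div_div, div_self hn.ne']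
  have hρ : 1 ≤ n / (r * F) := (one_le_div (by positivity)).2 hrF
  have hρe : n / F = n / (r * F) * r := by field_simp
  rw [mul_assoc, one_div_mul_eq_div, div_le_iff₀ (by positivity)]
  rcases le_total m n with hmn | hnm
  · have h := mul_rpow_le_of_balance hcΦ.1 (fun r R hr hR => (hΦs r R hr hR).1) hc hc' hd hm hmn h2 hS
    have h' : n / (r * F) * (n / m) ^ (α₁ - 1) ≤ C₀ := by
      refine le_of_mul_le_mul_right ?_ hr
      calc _ = n / F * (n / m) ^ (α₁ - 1) := by rw [hρe]; ring
        _ ≤ _ := h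
    have hnm1 : 1 ≤ n / m := (one_le_div hm).2 hmn
    have hpow1 : 1 ≤ (n / m) ^ (α₁ - 1) := Real.one_le_rpow hnm1 hb1.le
    have hρ0 : n / (r * F) ≤ C₀ := by nlinarith
    have hnm0 : n / m ≤ C₀ ^ (1 / (α₁ - 1)) :=
      le_rpow_one_div_of_rpow_le (by positivity) hb1 (by nlinarith)
    have : (n / (r * F)) ^ ε ≤ C₀ ^ ε := by gcongr
    have hC1e : 0 < C₁ ^ ε := by positivity
    calc n * (n / (r * F)) ^ ε = m * (n / m * (n / (r * F)) ^ ε) := by field_simp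
      _ ≤ m * (C₀ ^ (1 / (α₁ - 1)) * C₀ ^ ε) := by gcongr
      _ ≤ _ := by gcongr; linarith
  · have h := le_mul_rpow_of_balance hcΦ.2 (fun r R hr hR => (hΦs r R hr hR).2) hc hc' hd hn hnm hS h2
    have h' : n / (r * F) ≤ C₁ * (m / n) ^ (α₂ - 1) := by
      refine le_of_mul_le_mul_right ?_ hr
      rw [← hρe]; exact h
    have h3 : (n / (r * F)) ^ ε ≤ C₁ ^ ε * (m / n) := by
      calc (n / (r * F)) ^ ε ≤ (C₁ * (m / n) ^ (α₂ - 1)) ^ ε := by gcongr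
        _ = _ := by
          rw [Real.mul_rpow (by positivity) (by positivity), ← Real.rpow_mul (by positivity),
            hε, mul_one_div_cancel hb2.ne', Real.rpow_one]
    calc n * (n / (r * F)) ^ ε ≤ n * (C₁ ^ ε * (m / n)) := by gcongr
      _ = m * C₁ ^ ε := by field_simp
      _ ≤ _ := by gcongr; have : 0 < C₀ ^ (1 / (α₁ - 1)) * C₀ ^ ε := by positivity
                  linarith

lemma exists_rate_le (hα : 1 < α₁) (hcΦ : 0 < cΦ)
    (hΦs : ∀ r R : ℝ, 0 < r → r ≤ R → cΦ * (R / r) ^ α₁ * Φ r ≤ Φ R)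
    {c c' : ℝ} (hc : 0 < c) (hc' : 0 < c') :
    ∃ k : ℝ, 0 < k ∧ ∀ d n F m : ℝ, 0 < d → 0 < n → 0 < F → 0 < m →
      c * Φ (d / n) ≤ 1 / F → n / F / m ≤ c' * Φ (d / m) → m ≤ k * n := by
  have hb1 : 0 < α₁ - 1 := by linarith
  refine ⟨1 + (c' / (c * cΦ)) ^ (1 / (α₁ - 1)), by positivity, ?_⟩
  intro d n F m hd hn hF hm h1 h2
  have hp : 0 < (c' / (c * cΦ)) ^ (1 / (α₁ - 1)) := by positivity
  rcases le_total m n with hmn | hnm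
  · nlinarith
  · have hS : c * Φ (d / n) ≤ n / F / n := by
      rwa [div_div, mul_comm F n, ← div_div, div_self hn.ne']
    have h := mul_rpow_le_of_balance hcΦ hΦs hc hc' hd hn hnm hS h2
    have hnF : 0 < n / F := by positivity
    rw [mul_comm, mul_le_mul_iff_left₀ hnF] at h
    have := le_rpow_one_div_of_rpow_le (by positivity) hb1 h
    rw [div_le_iff₀ hn] at this
    linarith

end Balance

/-- In the off-diagonal regime the rate `n` is bounded below, and `φ (n / t)` is comparable
with `φ (1 / t)` up to a factor between constants and multiples of `n`. -/
lemma exists_offDiagonal_bounds {Φ φ : ℝ → ℝ} {α₁ β₂ cΦ cφ' cn : ℝ} (hα : 1 < α₁) (hcΦ : 0 < cΦ)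
    (hΦs : ∀ r R : ℝ, 0 < r → r ≤ R → cΦ * (R / r) ^ α₁ * Φ r ≤ Φ R)
    (hβ0 : 0 < β₂) (hβ2 : β₂ < 1) (hcφ' : 0 < cφ') (hφpos : ∀ l : ℝ, 0 < l → 0 < φ l)
    (hφmono : ∀ a b, 0 < a → a ≤ b → φ a ≤ φ b)
    (hφs : ∀ l : ℝ, 0 < l → ∀ κ : ℝ, 1 ≤ κ → φ (κ * l) ≤ cφ' * κ ^ β₂ * φ l) (hcn : 0 < cn) :
    ∃ n₀ K : ℝ, 0 < n₀ ∧ 0 < K ∧ ∀ t d n : ℝ, 0 < t → 0 < d → 0 < n → 1 ≤ Φ d * φ (1 / t) →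
      cn * Φ (d / n) ≤ 1 / φ (n / t) →
      n₀ ≤ n ∧ φ (n / t) ≤ K * n * φ (1 / t) ∧ φ (1 / t) ≤ K * φ (n / t) := by
  have hδ : 0 < α₁ - β₂ := by linarith
  set n₀ := min 1 ((cn * cΦ / cφ') ^ (1 / (α₁ - β₂))) with hn₀
  have hn₀p : 0 < n₀ := by positivity
  refine ⟨n₀, 1 + cφ' + 1 / n₀ + cφ' / n₀, hn₀p, by positivity, ?_⟩
  intro t d n ht hd hn h1 h2
  have hp1 := hφpos (1 / t) (by positivity)
  have hpn := hφpos (n / t) (by positivity)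
  have hi1 : 0 < 1 / n₀ := by positivity
  have hi2 : 0 < cφ' / n₀ := by positivity
  rcases le_total 1 n with hn1 | hn1
  · refine ⟨(min_le_left _ _).trans hn1, ?_, ?_⟩
    · have h := hφs (1 / t) (by positivity) n hn1
      rw [mul_one_div] at h
      have hnb : n ^ β₂ ≤ n := by
        calc n ^ β₂ ≤ n ^ (1 : ℝ) := Real.rpow_le_rpow_of_exponent_le hn1 hβ2.le
          _ = n := Real.rpow_one n
      calc φ (n / t) ≤ cφ' * n ^ β₂ * φ (1 / t) := h
        _ ≤ (1 + cφ' + 1 / n₀ + cφ' / n₀) * n * φ (1 / t) := by gcongr; linarith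
    · have h := hφmono (1 / t) (n / t) (by positivity) (by gcongr)
      nlinarith
  · have hφn := hφs (n / t) (by positivity) (1 / n) ((one_le_div hn).2 hn1)
    have e1 : 1 / n * (n / t) = 1 / t := by field_simp
    rw [e1] at hφn
    have hΦn := hΦs d (d / n) hd (by rw [le_div_iff₀ hn]; nlinarith)
    have e2 : d / n / d = 1 / n := by field_simp
    rw [e2] at hΦn
    have hinv : ∀ a : ℝ, (1 / n) ^ a = 1 / n ^ a := fun a => by
      rw [one_div, Real.inv_rpow hn.le, one_div]
    rw [hinv] at hφn hΦn
    have hna : 0 < n ^ α₁ := by positivity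
    have hnb : 0 < n ^ β₂ := by positivity
    have hlow : cn * cΦ / cφ' ≤ n ^ (α₁ - β₂) := by
      rw [Real.rpow_sub hn, div_le_div_iff₀ hcφ' hnb]
      rw [le_div_iff₀ hpn] at h2
      have h3 : cn * (cΦ * (1 / n ^ α₁) * Φ d) * φ (n / t) ≤ 1 := by
        refine le_trans ?_ h2
        gcongr
      have hΦd : 0 < Φ d := by
        by_contra hcon
        nlinarith
      calc cn * cΦ * n ^ β₂ ≤ cn * cΦ * n ^ β₂ * (Φ d * φ (1 / t)) :=
            le_mul_of_one_le_right (by positivity) h1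
        _ ≤ cn * cΦ * n ^ β₂ * (Φ d * (cφ' * (1 / n ^ β₂) * φ (n / t))) := by gcongr
        _ = n ^ α₁ * cφ' * (cn * (cΦ * (1 / n ^ α₁) * Φ d) * φ (n / t)) := by field_simp
        _ ≤ n ^ α₁ * cφ' * 1 := by gcongr
        _ = _ := by ring
    have hn₀n : n₀ ≤ n := by
      refine (min_le_right _ _).trans ?_
      calc (cn * cΦ / cφ') ^ (1 / (α₁ - β₂)) ≤ (n ^ (α₁ - β₂)) ^ (1 / (α₁ - β₂)) := by gcongr
        _ = n := by rw [← Real.rpow_mul hn.le, mul_one_div_cancel hδ.ne', Real.rpow_one]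
    refine ⟨hn₀n, ?_, ?_⟩
    · have h := hφmono (n / t) (1 / t) (by positivity) (by gcongr)
      have h5 : 1 ≤ 1 / n₀ * n := by rw [one_div_mul_eq_div]; exact (one_le_div hn₀p).2 hn₀n
      calc φ (n / t) ≤ 1 * φ (1 / t) := by linarith
        _ ≤ 1 / n₀ * n * φ (1 / t) := by gcongr
        _ ≤ _ := by gcongr; linarith
    · have hnle : 1 / n ^ β₂ ≤ 1 / n₀ := by
        refine one_div_le_one_div_of_le hn₀p (hn₀n.trans ?_)
        calc n = n ^ (1 : ℝ) := (Real.rpow_one n).symm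
          _ ≤ n ^ β₂ := Real.rpow_le_rpow_of_exponent_ge hn hn1 hβ2.le
      calc φ (1 / t) ≤ cφ' * (1 / n ^ β₂) * φ (n / t) := hφn
        _ ≤ cφ' * (1 / n₀) * φ (n / t) := by gcongr
        _ = cφ' / n₀ * φ (n / t) := by ring
        _ ≤ _ := by gcongr; linarith

lemma exists_volume_le {E : Type*} {V : E → ℝ → ℝ} {Φ Φinv : ℝ → ℝ} {d₁ d₂ cV cV' α₁ cΦ : ℝ}
    (hVpos : ∀ (x : E) (r : ℝ), 0 < r → 0 < V x r) (hd : 0 < d₁ ∧ d₁ ≤ d₂)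
    (hcV : 0 < cV ∧ 0 < cV')
    (hVs : ∀ (x : E) (r R : ℝ), 0 < r → r ≤ R →
      cV * (R / r) ^ d₁ * V x r ≤ V x R ∧ V x R ≤ cV' * (R / r) ^ d₂ * V x r)
    (hΦmono : StrictMonoOn Φ (Ici (0:ℝ))) (hα : 1 < α₁) (hcΦ : 0 < cΦ)
    (hΦs : ∀ r R : ℝ, 0 < r → r ≤ R → cΦ * (R / r) ^ α₁ * Φ r ≤ Φ R)
    (hΦinv : ∀ s : ℝ, 0 < s → 0 < Φinv s ∧ Φ (Φinv s) = s) :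
    ∃ K : ℝ, 0 < K ∧ ∀ (x : E) (r s : ℝ), 0 < r → 0 < s →
      V x (Φinv r) ≤ K * (1 + (r / s) ^ (d₂ / α₁)) * V x (Φinv s) := by
  obtain ⟨hcV1, hcV2⟩ := hcV
  have hd2 : 0 < d₂ := hd.1.trans_le hd.2
  have hα0 : 0 < α₁ := by linarith
  refine ⟨1 / cV + cV' * (1 / cΦ) ^ (d₂ / α₁), by positivity, fun x r s hr hs => ?_⟩
  obtain ⟨hr1, hr2⟩ := hΦinv r hr
  obtain ⟨hs1, hs2⟩ := hΦinv s hs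
  have hVs1 := hVpos x _ hs1
  have hrs : 0 < (r / s) ^ (d₂ / α₁) := by positivity
  have hc : 0 < cV' * (1 / cΦ) ^ (d₂ / α₁) := by positivity
  have hcV3 : 0 < 1 / cV := by positivity
  have hmono : ∀ a b, 0 < a → a ≤ b → Φinv a ≤ Φinv b := fun a b ha hab => by
    obtain ⟨ha1, ha2⟩ := hΦinv a ha
    obtain ⟨hb1, hb2⟩ := hΦinv b (ha.trans_le hab)
    refine (hΦmono.le_iff_le ha1.le hb1.le).1 ?_
    rwa [ha2, hb2]
  rcases le_total r s with h | h
  · have hle := hmono r s hr h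
    have h1 := (hVs x _ _ hr1 hle).1
    have h2 : 1 ≤ (Φinv s / Φinv r) ^ d₁ := Real.one_le_rpow ((one_le_div hr1).2 hle) hd.1.le
    have h3 : cV * V x (Φinv r) ≤ V x (Φinv s) := by
      refine le_trans ?_ h1
      have := hVpos x _ hr1
      gcongr
      exact le_mul_of_one_le_right hcV1.le h2
    calc V x (Φinv r) = 1 / cV * (cV * V x (Φinv r)) := by field_simp
      _ ≤ 1 / cV * 1 * V x (Φinv s) := by rw [mul_one]; gcongr
      _ ≤ _ := by gcongr <;> linarith
  · have hle := hmono s r hs h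
    have h1 := (hVs x _ _ hs1 hle).2
    have h2 := hΦs _ _ hs1 hle
    rw [hr2, hs2] at h2
    have h3 : Φinv r / Φinv s ≤ (1 / cΦ * (r / s)) ^ (1 / α₁) := by
      refine le_rpow_one_div_of_rpow_le (by positivity) hα0 ?_
      rw [one_div_mul_eq_div, le_div_iff₀ hcΦ, le_div_iff₀ hs]
      linarith
    have h4 : (Φinv r / Φinv s) ^ d₂ ≤ (1 / cΦ) ^ (d₂ / α₁) * (r / s) ^ (d₂ / α₁) := by
      calc (Φinv r / Φinv s) ^ d₂ ≤ ((1 / cΦ * (r / s)) ^ (1 / α₁)) ^ d₂ := by gcongr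
        _ = _ := by
          rw [← Real.rpow_mul (by positivity), Real.mul_rpow (by positivity) (by positivity),
            one_div_mul_eq_div α₁]
    calc V x (Φinv r) ≤ cV' * (Φinv r / Φinv s) ^ d₂ * V x (Φinv s) := h1
      _ ≤ cV' * ((1 / cΦ) ^ (d₂ / α₁) * (r / s) ^ (d₂ / α₁)) * V x (Φinv s) := by gcongr
      _ = cV' * (1 / cΦ) ^ (d₂ / α₁) * (r / s) ^ (d₂ / α₁) * V x (Φinv s) := by ring
      _ ≤ _ := by gcongr <;> linarith

lemma exists_ge_mul_rpow_le {β c M : ℝ} (hβ : β < 1) (hc : 0 < c) :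
    ∃ A : ℝ, 1 ≤ A ∧ M ≤ A ∧ c * A ^ β ≤ A := by
  have h1 : 0 < 1 - β := by linarith
  set A := max (max 1 M) (c ^ (1 / (1 - β))) with hA
  have hA1 : 1 ≤ A := (le_max_left _ _).trans (le_max_left _ _)
  have hA0 : 0 < A := by linarith
  refine ⟨A, hA1, (le_max_right _ _).trans (le_max_left _ _), ?_⟩
  have h2 : c ≤ A ^ (1 - β) := by
    calc c = (c ^ (1 / (1 - β))) ^ (1 - β) := by
          rw [← Real.rpow_mul hc.le, one_div_mul_cancel h1.ne', Real.rpow_one]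
      _ ≤ A ^ (1 - β) := by gcongr; exact le_max_right _ _
  rw [Real.rpow_sub hA0, Real.rpow_one, le_div_iff₀ (by positivity)] at h2
  exact h2

section Density

variable {φ : ℝ → ℝ} {p : ℝ → ℝ → ℝ} {β₂ cφ' γ C₀ K : ℝ}

lemma exists_density_le_exp (hφpos : ∀ l : ℝ, 0 < l → 0 < φ l) (hγ : 0 ≤ γ) (hC₀ : 0 < C₀)
    (hK : 0 < K)
    (hp : ∀ r, 0 < r → ∀ t, 0 < t → ∀ l, 0 < l →
      p r t ≤ C₀ / t * (1 + (r * φ (1 / t)) ^ γ) * Real.exp (l * t - r * φ l))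
    {δ : ℝ} (hδ : 0 < δ) :
    ∃ C : ℝ, 0 < C ∧ ∀ r t n : ℝ, 0 < r → 0 < t → 0 < n → r * φ (1 / t) ≤ K * n →
      p r t ≤ C / t * Real.exp (δ * n) := by
  obtain ⟨C, hC, h⟩ := exists_rpow_le_exp hγ hδ
  refine ⟨C₀ * (1 + K ^ γ * C) * Real.exp 1, by positivity, fun r t n hr ht hn hrn => ?_⟩
  have hφt := hφpos (1 / t) (by positivity)
  have h1 := hp r hr t ht (1 / t) (by positivity)
  have h2 : (r * φ (1 / t)) ^ γ ≤ K ^ γ * (C * Real.exp (δ * n)) := by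
    calc (r * φ (1 / t)) ^ γ ≤ (K * n) ^ γ := by gcongr
      _ = K ^ γ * n ^ γ := Real.mul_rpow hK.le hn.le
      _ ≤ _ := by gcongr; exact h n hn.le
  have h3 : 1 ≤ Real.exp (δ * n) := Real.one_le_exp (by positivity)
  have h4 : Real.exp (1 / t * t - r * φ (1 / t)) ≤ Real.exp 1 := by
    refine Real.exp_le_exp.2 ?_
    have : 0 < r * φ (1 / t) := by positivity
    rw [one_div_mul_cancel ht.ne']; linarith
  calc p r t ≤ C₀ / t * (1 + (r * φ (1 / t)) ^ γ) * Real.exp (1 / t * t - r * φ (1 / t)) := h1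
    _ ≤ C₀ / t * (Real.exp (δ * n) + K ^ γ * (C * Real.exp (δ * n))) * Real.exp 1 := by gcongr
    _ = _ := by ring

lemma exists_density_le_exp_neg (hβ2 : β₂ < 1) (hcφ' : 0 < cφ') (hφpos : ∀ l : ℝ, 0 < l → 0 < φ l)
    (hφs : ∀ l : ℝ, 0 < l → ∀ κ : ℝ, 1 ≤ κ → φ (κ * l) ≤ cφ' * κ ^ β₂ * φ l)
    (hγ : 0 ≤ γ) (hC₀ : 0 < C₀) (hK : 0 < K)
    (hp : ∀ r, 0 < r → ∀ t, 0 < t → ∀ l, 0 < l →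
      p r t ≤ C₀ / t * (1 + (r * φ (1 / t)) ^ γ) * Real.exp (l * t - r * φ l)) :
    ∃ C c : ℝ, 0 < C ∧ 0 < c ∧ ∀ r t n : ℝ, 0 < r → 0 < t → 0 < n →
      φ (1 / t) ≤ K * φ (n / t) → n ≤ r * φ (n / t) →
      p r t ≤ C / t * Real.exp (-(c * (r * φ (n / t)))) := by
  obtain ⟨A, hA1, -, hA⟩ := exists_ge_mul_rpow_le (M := 1) hβ2 (c := 2 * cφ') (by positivity)
  have hA0 : 0 < A := by linarith
  obtain ⟨C, hC, h⟩ := exists_rpow_le_exp hγ (c := 1 / (2 * A)) (by positivity)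
  refine ⟨C₀ * (1 + K ^ γ * C), 1 / (2 * A), by positivity, by positivity,
    fun r t n hr ht hn hφn hrn => ?_⟩
  have hφt := hφpos (1 / t) (by positivity)
  have hφnt := hφpos (n / t) (by positivity)
  have hφA := hφpos (1 / A * (n / t)) (by positivity)
  set u := r * φ (n / t) with hu
  have hu0 : 0 < u := by positivity
  have h1 := hp r hr t ht (1 / A * (n / t)) (by positivity)
  have hs := hφs (1 / A * (n / t)) (by positivity) A hA1
  rw [← mul_assoc, mul_one_div_cancel hA0.ne', one_mul] at hs
  have h2 : (r * φ (1 / t)) ^ γ ≤ K ^ γ * (C * Real.exp (1 / (2 * A) * u)) := by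
    calc (r * φ (1 / t)) ^ γ ≤ (K * u) ^ γ := by
          gcongr ?_ ^ γ
          calc r * φ (1 / t) ≤ r * (K * φ (n / t)) := by gcongr
            _ = K * u := by ring
      _ = K ^ γ * u ^ γ := Real.mul_rpow hK.le hu0.le
      _ ≤ _ := by gcongr; exact h u hu0.le
  have h3 : 1 ≤ Real.exp (1 / (2 * A) * u) := Real.one_le_exp (by positivity)
  have h4 : 1 / A * (n / t) * t - r * φ (1 / A * (n / t)) ≤ -(1 / A * u) := by
    have h5 : 2 * φ (n / t) ≤ A * φ (1 / A * (n / t)) := by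
      have := mul_le_mul_of_nonneg_right hA hφA.le
      linarith
    have h6 : 2 * (1 / A * u) ≤ r * φ (1 / A * (n / t)) := by
      calc 2 * (1 / A * u) = 1 / A * r * (2 * φ (n / t)) := by rw [hu]; ring
        _ ≤ 1 / A * r * (A * φ (1 / A * (n / t))) := by gcongr
        _ = _ := by field_simp
    have h7 : 1 / A * (n / t) * t ≤ 1 / A * u := by
      rw [mul_assoc, div_mul_cancel₀ _ ht.ne']; gcongr
    linarith
  calc p r t ≤ C₀ / t * (1 + (r * φ (1 / t)) ^ γ) *
        Real.exp (1 / A * (n / t) * t - r * φ (1 / A * (n / t))) := h1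
    _ ≤ C₀ / t * (Real.exp (1 / (2 * A) * u) + K ^ γ * (C * Real.exp (1 / (2 * A) * u))) *
        Real.exp (-(1 / A * u)) := by gcongr
    _ = C₀ * (1 + K ^ γ * C) / t *
        (Real.exp (1 / (2 * A) * u) * Real.exp (-(1 / A * u))) := by ring
    _ = _ := by rw [← Real.exp_add]; congr 2; field_simp; ring

lemma exists_le_density (hβ2 : β₂ < 1) (hcφ' : 0 < cφ') (hφpos : ∀ l : ℝ, 0 < l → 0 < φ l)
    (hφs : ∀ l : ℝ, 0 < l → ∀ κ : ℝ, 1 ≤ κ → φ (κ * l) ≤ cφ' * κ ^ β₂ * φ l)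
    (hC₀ : 0 < C₀) (hK : 0 < K)
    (hp : ∀ r, 0 < r → ∀ t, 0 < t → ∀ l, 0 < l → r * φ l ≤ l * t / 4 - Real.log 2 →
      C₀ / t * (r * φ (1 / t)) * Real.exp (-(r * φ l)) ≤ p r t) {n₀ : ℝ} (hn₀ : 0 < n₀) :
    ∃ C c : ℝ, 0 < C ∧ 0 < c ∧ ∀ r t n : ℝ, 0 < r → 0 < t → n₀ ≤ n →
      φ (n / t) ≤ K * n * φ (1 / t) → n ≤ r * φ (n / t) → r * φ (n / t) ≤ 2 * n →
      C / t * Real.exp (-(c * n)) ≤ p r t := by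
  obtain ⟨A, hA1, hAn, hA⟩ := exists_ge_mul_rpow_le (M := 8 * Real.log 2 / n₀) hβ2
    (c := 16 * cφ') (by positivity)
  have hA0 : 0 < A := by linarith
  refine ⟨C₀ / K, A / 8, by positivity, by positivity, fun r t n hr ht hnn hφn hrn hrn2 => ?_⟩
  have hn : 0 < n := hn₀.trans_le hnn
  have hφt := hφpos (1 / t) (by positivity)
  have hφnt := hφpos (n / t) (by positivity)
  have hs := hφs (n / t) (by positivity) A hA1
  have h1 : r * φ (A * (n / t)) ≤ A / 8 * n := by
    calc r * φ (A * (n / t)) ≤ r * (cφ' * A ^ β₂ * φ (n / t)) := by gcongr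
      _ = cφ' * A ^ β₂ * (r * φ (n / t)) := by ring
      _ ≤ cφ' * A ^ β₂ * (2 * n) := by gcongr
      _ = 16 * cφ' * A ^ β₂ * (n / 8) := by ring
      _ ≤ A * (n / 8) := by gcongr
      _ = _ := by ring
  have h2 : Real.log 2 ≤ A * n / 8 := by
    rw [div_le_iff₀ hn₀] at hAn
    have := mul_le_mul_of_nonneg_left hnn hA0.le
    linarith
  have h3 := hp r hr t ht (A * (n / t)) (by positivity) (by
    have : A * (n / t) * t = A * n := by field_simp
    rw [this]; linarith)
  have h4 : 1 / K ≤ r * φ (1 / t) := by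
    rw [div_le_iff₀ hK]
    have : n * 1 ≤ n * (r * φ (1 / t) * K) := by
      calc n * 1 ≤ r * φ (n / t) := by rwa [mul_one]
        _ ≤ r * (K * n * φ (1 / t)) := by gcongr
        _ = _ := by ring
    exact le_of_mul_le_mul_left this hn
  calc C₀ / K / t * Real.exp (-(A / 8 * n)) = C₀ / t * (1 / K) * Real.exp (-(A / 8 * n)) := by ring
    _ ≤ C₀ / t * (r * φ (1 / t)) * Real.exp (-(r * φ (A * (n / t)))) := by gcongr
    _ ≤ _ := h3

end Density

/-- The exponential decay of the diffusion kernel compensates its singular volume factor at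
times below `n / F`. -/
lemma exists_volume_mul_exp_le {E : Type*} {V : E → ℝ → ℝ} {Φ Φinv : ℝ → ℝ}
    {α₁ α₂ cΦ cΦ' κ KV : ℝ} (hVpos : ∀ (x : E) (r : ℝ), 0 < r → 0 < V x r)
    (hΦinv : ∀ s : ℝ, 0 < s → 0 < Φinv s ∧ Φ (Φinv s) = s) (hκ : 0 ≤ κ) (hKV : 0 < KV)
    (hV : ∀ (x : E) (r s : ℝ), 0 < r → 0 < s →
      V x (Φinv r) ≤ KV * (1 + (r / s) ^ κ) * V x (Φinv s))
    (hα : 1 < α₁ ∧ α₁ ≤ α₂) (hcΦ : 0 < cΦ ∧ 0 < cΦ')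
    (hΦs : ∀ r R : ℝ, 0 < r → r ≤ R →
      cΦ * (R / r) ^ α₁ * Φ r ≤ Φ R ∧ Φ R ≤ cΦ' * (R / r) ^ α₂ * Φ r)
    {c c' a n₀ K : ℝ} (hc : 0 < c) (hc' : 0 < c') (ha : 0 < a) (hn₀ : 0 < n₀) (hK : 0 < K) :
    ∃ C k : ℝ, 0 < C ∧ 0 < k ∧ ∀ (x : E) (d n F T r m : ℝ), 0 < d → n₀ ≤ n → 0 < F → 0 < T →
      0 < r → 0 < m → F * T ≤ K * n → 1 / F ≤ c' * Φ (d / n) → c * Φ (d / m) ≤ r / m →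
      r * F ≤ n → V x (Φinv T) * Real.exp (-(a * m)) ≤ C * V x (Φinv r) * Real.exp (-(k * n)) := by
  obtain ⟨k, ε, hk, hε, hm⟩ := exists_mul_rpow_le_rate hα hcΦ hΦs hc hc'
  obtain ⟨C, hC, hCexp⟩ := exists_rpow_le_exp (κ := κ / ε) (c := a * k * n₀ / 2)
    (by positivity) (by positivity)
  refine ⟨KV * (1 + K ^ κ * C), a * k / 2, by positivity, by positivity, ?_⟩
  intro x d n F T r m hd hnn hF hT hr hm0 hFT h1 h2 hrF
  have hn : 0 < n := hn₀.trans_le hnn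
  have hVr := hVpos x _ (hΦinv r hr).1
  set ρ := n / (r * F) with hρ
  have hρ1 : 1 ≤ ρ := (one_le_div (by positivity)).2 hrF
  have hρ0 : 0 < ρ := by linarith
  have hmρ := hm d n F r m hd hn hF hr hm0 h1 h2 hrF
  rw [← hρ] at hmρ
  have hρε : 1 ≤ ρ ^ ε := Real.one_le_rpow hρ1 hε.le
  have hTr : (T / r) ^ κ ≤ K ^ κ * (C * Real.exp (a * k * n₀ / 2 * ρ ^ ε)) := by
    calc (T / r) ^ κ ≤ (K * ρ) ^ κ := by
          gcongr
          rw [hρ, mul_div_assoc', div_le_div_iff₀ hr (by positivity)]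
          calc T * (r * F) = F * T * r := by ring
            _ ≤ K * n * r := by gcongr
      _ = K ^ κ * (ρ ^ ε) ^ (κ / ε) := by
          rw [Real.mul_rpow hK.le hρ0.le, ← Real.rpow_mul hρ0.le, mul_div_cancel₀ _ hε.ne']
      _ ≤ _ := by gcongr; exact hCexp _ (by positivity)
  have hexp : Real.exp (-(a * m)) ≤
      Real.exp (-(a * k / 2 * n)) * Real.exp (-(a * k * n₀ / 2 * ρ ^ ε)) := by
    rw [← Real.exp_add]
    refine Real.exp_le_exp.2 ?_
    have e1 : a * (k * n * ρ ^ ε) ≤ a * m := by gcongr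
    have e2 : a * k / 2 * n * 1 ≤ a * k / 2 * n * ρ ^ ε := by gcongr
    have e3 : a * k * n₀ / 2 * ρ ^ ε ≤ a * k * n / 2 * ρ ^ ε := by gcongr
    linarith
  have h3 : 1 ≤ Real.exp (a * k * n₀ / 2 * ρ ^ ε) := Real.one_le_exp (by positivity)
  have h4 : Real.exp (a * k * n₀ / 2 * ρ ^ ε) * Real.exp (-(a * k * n₀ / 2 * ρ ^ ε)) = 1 := by
    rw [← Real.exp_add, add_neg_cancel, Real.exp_zero]
  calc V x (Φinv T) * Real.exp (-(a * m))
      ≤ KV * (1 + (T / r) ^ κ) * V x (Φinv r) *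
        (Real.exp (-(a * k / 2 * n)) * Real.exp (-(a * k * n₀ / 2 * ρ ^ ε))) := by
        have := hV x T r hT hr
        gcongr
    _ ≤ KV * (Real.exp (a * k * n₀ / 2 * ρ ^ ε) +
          K ^ κ * (C * Real.exp (a * k * n₀ / 2 * ρ ^ ε))) * V x (Φinv r) *
        (Real.exp (-(a * k / 2 * n)) * Real.exp (-(a * k * n₀ / 2 * ρ ^ ε))) := by gcongr
    _ = KV * (1 + K ^ κ * C) * V x (Φinv r) * Real.exp (-(a * k / 2 * n)) *
        (Real.exp (a * k * n₀ / 2 * ρ ^ ε) * Real.exp (-(a * k * n₀ / 2 * ρ ^ ε))) := by ring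
    _ = _ := by rw [h4, mul_one]

lemma lintegral_Ioi_const_mul_exp {B b : ℝ} (hB : 0 ≤ B) (hb : 0 < b) :
    ∫⁻ r in Ioi (0 : ℝ), ENNReal.ofReal (B * Real.exp (-(b * r))) = ENNReal.ofReal (B / b) := by
  have hInt : IntegrableOn (fun r : ℝ => B * Real.exp (-(b * r))) (Ioi 0) := by
    simp only [← neg_mul b]
    exact (integrableOn_exp_mul_Ioi (neg_neg_of_pos hb) 0).const_mul B
  rw [← ofReal_integral_eq_lintegral_ofReal hInt
    (Eventually.of_forall fun r => mul_nonneg hB (Real.exp_pos _).le), integral_const_mul]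
  have h := integral_exp_mul_Ioi (neg_neg_of_pos hb) 0
  simp only [neg_mul, mul_zero, Real.exp_zero] at h
  rw [h, neg_div_neg_eq, mul_one_div]

/-- Theorem 4.11(ii): diffusion case, off-diagonal regime.  Under
Assumption 4.1 on the subordinator and with `p⁰` enjoying two-sided diffusion-type heat
kernel estimates, if `n(t,r)` is positive, non-increasing in `t` and satisfies
`1/φ(n(t,r)/t) ≃ Φ(r/n(t,r))`, then for `Φ(d(x,y)) φ(1/t) ≥ 1`, with `n = n(t,d(x,y))`,
`q(t,x,y) ≍ (n/(t φ(n/t) V(x,Φ⁻¹(1/φ(1/t))))) exp(−c n)` with two-sided constants. -/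
theorem time_frac_stmt17
    {E : Type*} [MetricSpace E] [MeasurableSpace E] [BorelSpace E]
    [TopologicalSpace.SeparableSpace E] [LocallyCompactSpace E]
    (μ : Measure E)
    -- the volume function and its uniform weak scaling
    (V : E → ℝ → ℝ)
    (hV : ∀ (x : E) (r : ℝ), V x r = (μ (Metric.ball x r)).toReal)
    (hVpos : ∀ (x : E) (r : ℝ), 0 < r → 0 < V x r)
    (d₁ d₂ cV cV' : ℝ) (hd : 0 < d₁ ∧ d₁ ≤ d₂) (hcV : 0 < cV ∧ 0 < cV')
    (hVscale : ∀ (x : E) (r R : ℝ), 0 < r → r ≤ R →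
      cV * (R / r) ^ d₁ * V x r ≤ V x R ∧ V x R ≤ cV' * (R / r) ^ d₂ * V x r)
    -- the space scaling function Φ and its inverse
    (Φ : ℝ → ℝ) (hΦ0 : Φ 0 = 0) (hΦmono : StrictMonoOn Φ (Set.Ici (0:ℝ)))
    (hΦpos : ∀ r : ℝ, 0 < r → 0 < Φ r)
    (α₁ α₂ cΦ cΦ' : ℝ) (hα : 1 < α₁ ∧ α₁ ≤ α₂) (hcΦ : 0 < cΦ ∧ 0 < cΦ')
    (hΦscale : ∀ r R : ℝ, 0 < r → r ≤ R →
      cΦ * (R / r) ^ α₁ * Φ r ≤ Φ R ∧ Φ R ≤ cΦ' * (R / r) ^ α₂ * Φ r)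
    (Φinv : ℝ → ℝ)
    (hΦinv : ∀ s : ℝ, 0 < s → 0 < Φinv s ∧ Φ (Φinv s) = s)
    -- the space-time scaling function m(t,r) of the diffusion
    (m : ℝ → ℝ → ℝ)
    (hm_pos : ∀ t : ℝ, 0 < t → ∀ r : ℝ, 0 < r → 0 < m t r)
    (hm_anti : ∀ r : ℝ, 0 < r → AntitoneOn (fun t => m t r) (Set.Ioi (0:ℝ)))
    (cm cm' : ℝ) (hcm : 0 < cm ∧ 0 < cm')
    (hm_comp : ∀ t : ℝ, 0 < t → ∀ r : ℝ, 0 < r →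
      cm * Φ (r / m t r) ≤ t / m t r ∧ t / m t r ≤ cm' * Φ (r / m t r))
    -- the two-sided diffusion-type heat kernel estimate for p⁰
    (p0 : ℝ → E → E → ℝ)
    (hp0_nn : ∀ (r : ℝ) (x y : E), 0 ≤ p0 r x y)
    (hp0_meas : Measurable (fun z : ℝ × E × E => p0 z.1 z.2.1 z.2.2))
    (a₁ a₂ a₃ a₄ : ℝ) (ha : 0 < a₁ ∧ 0 < a₂ ∧ 0 < a₃ ∧ 0 < a₄)
    (hp0 : ∀ t : ℝ, 0 < t → ∀ x y : E,
      a₁ / V x (Φinv t) * Real.exp (-(a₂ * m t (dist x y))) ≤ p0 t x y ∧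
      p0 t x y ≤ a₃ / V x (Φinv t) * Real.exp (-(a₄ * m t (dist x y))))
    -- Assumption 4.1 for the subordinator
    (ν : Measure ℝ)
    (hν_loc : ∫⁻ x in Set.Ioi (0:ℝ), ENNReal.ofReal (min 1 x) ∂ν ≠ ⊤)
    (φ : ℝ → ℝ)
    (hφ : ∀ l : ℝ, 0 < l → φ l = ∫ x in Set.Ioi (0:ℝ), (1 - Real.exp (-l * x)) ∂ν)
    (β₁ β₂ cφ cφ' : ℝ)
    (hβ : 0 < β₁ ∧ β₁ < β₂ ∧ β₂ < 1) (hcφ : 0 < cφ ∧ 0 < cφ')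
    (hφscale : ∀ l : ℝ, 0 < l → ∀ κ : ℝ, 1 ≤ κ →
      cφ * κ ^ β₁ ≤ φ (κ * l) / φ l ∧ φ (κ * l) / φ l ≤ cφ' * κ ^ β₂)
    (νd : ℝ → ℝ)
    (hνd_nn : ∀ t : ℝ, 0 ≤ νd t)
    (hνd_meas : Measurable νd)
    (hν_dens : ∀ A : Set ℝ, MeasurableSet A →
      ν A = ∫⁻ x in A ∩ Set.Ioi 0, ENNReal.ofReal (νd x))
    (hself : AntitoneOn (fun t => t * νd t) (Set.Ioi (0:ℝ)))
    (μr : ℝ → Measure ℝ)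
    (hprob : ∀ r : ℝ, 0 < r → IsProbabilityMeasure (μr r))
    (hlap : ∀ r : ℝ, 0 < r → ∀ l : ℝ, 0 < l →
      ∫ s, Real.exp (-l * s) ∂(μr r) = Real.exp (-r * φ l))
    (pbar : ℝ → ℝ → ℝ)
    (hpbar_nn : ∀ r t : ℝ, 0 ≤ pbar r t)
    (hpbar_cont : ∀ r : ℝ, 0 < r → Continuous (pbar r))
    (hdens : ∀ r : ℝ, 0 < r → ∀ A : Set ℝ, MeasurableSet A →
      μr r A = ∫⁻ t in A ∩ Set.Ici 0, ENNReal.ofReal (pbar r t))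
    -- the scaling function n(t,r) determined by 1/φ(n/t) ≃ Φ(r/n)
    (n : ℝ → ℝ → ℝ)
    (hn_pos : ∀ t : ℝ, 0 < t → ∀ r : ℝ, 0 < r → 0 < n t r)
    (hn_anti : ∀ r : ℝ, 0 < r → AntitoneOn (fun t => n t r) (Set.Ioi (0:ℝ)))
    (cn cn' : ℝ) (hcn : 0 < cn ∧ 0 < cn')
    (hn_comp : ∀ t : ℝ, 0 < t → ∀ r : ℝ, 0 < r →
      cn * Φ (r / n t r) ≤ 1 / φ (n t r / t) ∧ 1 / φ (n t r / t) ≤ cn' * Φ (r / n t r))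
    -- the fundamental solution q of the time fractional Poisson equation
    (q : ℝ → E → E → ℝ≥0∞)
    (hq : ∀ (t : ℝ) (x y : E),
      q t x y = ∫⁻ r in Set.Ioi (0:ℝ), ENNReal.ofReal (p0 r x y * pbar r t)) :
    ∃ C₁ C₂ C₃ C₄ : ℝ, 0 < C₁ ∧ 0 < C₂ ∧ 0 < C₃ ∧ 0 < C₄ ∧
      ∀ t : ℝ, 0 < t → ∀ x y : E, 1 ≤ Φ (dist x y) * φ t⁻¹ →
        ENNReal.ofReal (C₁ * (n t (dist x y) /
              (t * φ (n t (dist x y) / t) * V x (Φinv (1 / φ t⁻¹)))) *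
            Real.exp (-(C₂ * n t (dist x y))))
          ≤ q t x y ∧
        q t x y ≤ ENNReal.ofReal (C₃ * (n t (dist x y) /
              (t * φ (n t (dist x y) / t) * V x (Φinv (1 / φ t⁻¹)))) *
            Real.exp (-(C₄ * n t (dist x y)))) := by
  obtain ⟨hφpos, hφs⟩ := laplaceExponent_pos_and_scaling hφ hcφ.1 hφscale
  obtain ⟨hφmono, ⟨C₀, hC₀, hpU⟩, c₀, hc₀, hpL⟩ := subordinator_density_bounds hν_loc hφ hβ hcφ
    hφscale hνd_nn hνd_meas hν_dens hself hprob hlap hpbar_nn hpbar_cont hdens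
  have hφs' := fun l hl κ hκ => (hφs l hl κ hκ).2
  have hβ0 : 0 < β₂ := hβ.1.trans hβ.2.1
  have hβ1 : 0 < 1 - β₂ := by linarith [hβ.2.2]
  have hΦs1 := fun r R hr hR => (hΦscale r R hr hR).1
  have hκ : 0 ≤ d₂ / α₁ := div_nonneg (hd.1.le.trans hd.2) (by linarith [hα.1])
  obtain ⟨n₀, K, hn₀, hK, hoff⟩ := exists_offDiagonal_bounds hα.1 hcΦ.1 hΦs1 hβ0 hβ.2.2 hcφ.2
    hφpos hφmono hφs' hcn.1
  obtain ⟨KV, hKV, hVol⟩ := exists_volume_le hVpos hd hcV hVscale hΦmono hα.1 hcΦ.1 hΦs1 hΦinv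
  obtain ⟨C₁, k₁, hC₁, hk₁, hVexp⟩ := exists_volume_mul_exp_le hVpos hΦinv hκ hKV hVol hα hcΦ
    hΦscale hcm.1 hcn.2 ha.2.2.2 hn₀ hK
  obtain ⟨C₂, hC₂, hsmall⟩ := exists_density_le_exp (γ := 1 / (1 - β₂)) hφpos (by positivity) hC₀ hK
    hpU (half_pos hk₁)
  obtain ⟨C₃, k₃, hC₃, hk₃, hlarge⟩ := exists_density_le_exp_neg (γ := 1 / (1 - β₂)) hβ.2.2 hcφ.2
    hφpos hφs' (by positivity) hC₀ hK hpU
  obtain ⟨C₄, k₄, hC₄, hk₄, hlow⟩ := exists_le_density hβ.2.2 hcφ.2 hφpos hφs' hc₀ hK hpL hn₀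
  obtain ⟨k₅, hk₅, hrate⟩ := exists_rate_le hα.1 hcΦ.1 hΦs1 hcn.1 hcm.2
  obtain ⟨C₆, hC₆, hpoly⟩ := exists_rpow_le_exp hκ one_pos
  set CV := KV * (1 + (2 * K) ^ (d₂ / α₁) * C₆) with hCV
  set CU := a₃ * C₁ * C₂ + a₃ * (KV * (1 + K ^ (d₂ / α₁))) * C₃ with hCU
  set k := min (k₁ / 4) (k₃ / 2) with hk
  obtain ⟨ha1, ha2, ha3, ha4⟩ := ha
  have hCVp : 0 < CV := by positivity
  have hCUp : 0 < CU := by positivity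
  have hkp : 0 < k := by positivity
  refine ⟨a₁ / CV * C₄, 1 + a₂ * k₅ + k₄, CU / (k * n₀), k, by positivity, by positivity,
    by positivity, hkp, fun t ht x y hxy => ?_⟩
  have hdist : 0 < dist x y := by
    refine lt_of_le_of_ne dist_nonneg fun h0 => ?_
    rw [← h0, hΦ0, zero_mul] at hxy
    linarith
  set d := dist x y with hddef
  have hn := hn_pos t ht d hdist
  obtain ⟨hnc1, hnc2⟩ := hn_comp t ht d hdist
  set N := n t d with hN
  rw [inv_eq_one_div] at hxy ⊢
  obtain ⟨hnn, hFK, hFK'⟩ := hoff t d N ht hdist hn hxy hnc1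
  have hφt := hφpos (1 / t) (by positivity)
  have hF := hφpos (N / t) (by positivity)
  set F := φ (N / t) with hFdef
  set T := 1 / φ (1 / t) with hT
  have hT0 : 0 < T := by positivity
  have hFT : F * T ≤ K * N := by
    rw [hT, mul_one_div, div_le_iff₀ hφt]; exact hFK
  have hFT' : 1 ≤ K * F * T := by
    rw [hT, mul_one_div, le_div_iff₀ hφt, one_mul]; exact hFK'
  have hW := hVpos x _ (hΦinv T hT0).1
  set W := V x (Φinv T) with hWdef
  rw [hq]
  constructor
  · set B := a₁ / (CV * W) * C₄ / t * Real.exp (-((1 + a₂ * k₅ + k₄) * N)) with hB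
    have hlower : ∀ r ∈ Ioc (N / F) (2 * (N / F)), B ≤ p0 r x y * pbar r t := by
      rintro r ⟨hr1, hr2⟩
      have hNF : 0 < N / F := by positivity
      have hr : 0 < r := hNF.trans hr1
      have hrF1 : N ≤ r * F := ((div_lt_iff₀ hF).1 hr1).le
      have hrF2 : r * F ≤ 2 * N := by rwa [← mul_div_assoc, le_div_iff₀ hF] at hr2
      have hm : m r d ≤ k₅ * N :=
        (hm_anti d hdist hNF hr hr1.le).trans (hrate d N F _ hdist hn hF (hm_pos _ hNF d hdist) hnc1
          (hm_comp _ hNF d hdist).2)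
      have hVr := hVpos x _ (hΦinv r hr).1
      have hVle : V x (Φinv r) ≤ CV * W * Real.exp N := by
        have h1 : (r / T) ^ (d₂ / α₁) ≤ (2 * K) ^ (d₂ / α₁) * (C₆ * Real.exp N) := by
          calc (r / T) ^ (d₂ / α₁) ≤ (2 * K * N) ^ (d₂ / α₁) := by
                gcongr
                rw [div_le_iff₀ hT0]
                calc r ≤ r * (K * F * T) := le_mul_of_one_le_right hr.le hFT'
                  _ = r * F * (K * T) := by ring
                  _ ≤ 2 * N * (K * T) := by gcongr
                  _ = _ := by ring
            _ = (2 * K) ^ (d₂ / α₁) * N ^ (d₂ / α₁) := Real.mul_rpow (by positivity) hn.le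
            _ ≤ _ := by
                have := hpoly N hn.le
                rw [one_mul] at this
                gcongr
        have h2 : 1 ≤ Real.exp N := Real.one_le_exp hn.le
        calc V x (Φinv r) ≤ KV * (1 + (r / T) ^ (d₂ / α₁)) * W := hVol x r T hr hT0
          _ ≤ KV * (Real.exp N + (2 * K) ^ (d₂ / α₁) * (C₆ * Real.exp N)) * W := by gcongr
          _ = _ := by rw [hCV]; ring
      have hp : a₁ / (CV * W) * Real.exp (-((1 + a₂ * k₅) * N)) ≤ p0 r x y := by
        refine le_trans ?_ (hp0 r hr x y).1
        calc a₁ / (CV * W) * Real.exp (-((1 + a₂ * k₅) * N))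
            = a₁ / (CV * W * Real.exp N) * Real.exp (-(a₂ * (k₅ * N))) := by
              rw [show -((1 + a₂ * k₅) * N) = -N + -(a₂ * (k₅ * N)) by ring, Real.exp_add,
                Real.exp_neg N]
              field_simp
          _ ≤ _ := by gcongr
      have hpb := hlow r t N hr ht hnn hFK hrF1 hrF2
      calc B = a₁ / (CV * W) * Real.exp (-((1 + a₂ * k₅) * N)) *
            (C₄ / t * Real.exp (-(k₄ * N))) := by
            rw [hB, show -((1 + a₂ * k₅ + k₄) * N) = -((1 + a₂ * k₅) * N) + -(k₄ * N) by ring,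
              Real.exp_add]
            ring
        _ ≤ _ := mul_le_mul hp hpb (by positivity) (hp0_nn r x y)
    have hB0 : 0 ≤ B := by positivity
    calc ENNReal.ofReal (a₁ / CV * C₄ * (N / (t * F * W)) * Real.exp (-((1 + a₂ * k₅ + k₄) * N)))
        = ENNReal.ofReal B * ENNReal.ofReal (2 * (N / F) - N / F) := by
          rw [← ENNReal.ofReal_mul hB0, hB]
          congr 1
          field_simp
          ring
      _ = ∫⁻ _ in Ioc (N / F) (2 * (N / F)), ENNReal.ofReal B := by
          rw [setLIntegral_const, Real.volume_Ioc]
      _ ≤ ∫⁻ r in Ioc (N / F) (2 * (N / F)), ENNReal.ofReal (p0 r x y * pbar r t) :=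
          setLIntegral_mono' measurableSet_Ioc fun r hr => ENNReal.ofReal_le_ofReal (hlower r hr)
      _ ≤ _ := lintegral_mono_set fun r hr => (div_pos hn hF).trans hr.1
  · set B := CU / (t * W) * Real.exp (-(k * N)) with hB
    have hB0 : 0 ≤ B := by positivity
    have hkmin1 : k ≤ k₁ / 4 := min_le_left _ _
    have hkmin2 : k ≤ k₃ / 2 := min_le_right _ _
    have hupper : ∀ r, 0 < r → p0 r x y * pbar r t ≤ B * Real.exp (-(k * F * r)) := by
      intro r hr
      have hpr := (hp0 r hr x y).2
      have hVr := hVpos x _ (hΦinv r hr).1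
      have hmr := hm_pos r hr d hdist
      have hfin : ∀ {c₁ e : ℝ}, c₁ ≤ CU → e ≤ -(k * N) + -(k * F * r) →
          c₁ / (t * W) * Real.exp e ≤ B * Real.exp (-(k * F * r)) := by
        intro c₁ e h2 h3
        rw [hB, mul_assoc, ← Real.exp_add]
        gcongr
      rcases le_total (r * F) N with hrF | hrF
      · have h1 := hVexp x d N F T r (m r d) hdist hnn hF hT0 hr hmr hFT hnc2
          (hm_comp r hr d hdist).1 hrF
        have h2 : p0 r x y ≤ a₃ * C₁ / W * Real.exp (-(k₁ * N)) := by
          refine hpr.trans ?_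
          rw [div_mul_eq_mul_div, div_mul_eq_mul_div, div_le_div_iff₀ hVr hW]
          calc a₃ * Real.exp (-(a₄ * m r d)) * W = a₃ * (W * Real.exp (-(a₄ * m r d))) := by ring
            _ ≤ a₃ * (C₁ * V x (Φinv r) * Real.exp (-(k₁ * N))) := by gcongr
            _ = _ := by ring
        have h3 : pbar r t ≤ C₂ / t * Real.exp (k₁ / 2 * N) := by
          refine hsmall r t N hr ht hn ?_
          have hFr : r ≤ N / F := (le_div_iff₀ hF).2 hrF
          calc r * φ (1 / t) ≤ r * (K * F) := by gcongr
            _ = K * (r * F) := by ring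
            _ ≤ K * N := by gcongr
        calc p0 r x y * pbar r t
            ≤ a₃ * C₁ / W * Real.exp (-(k₁ * N)) * (C₂ / t * Real.exp (k₁ / 2 * N)) :=
              mul_le_mul h2 h3 (hpbar_nn r t) (by positivity)
          _ = a₃ * C₁ * C₂ / (t * W) * Real.exp (-(k₁ * N) + k₁ / 2 * N) := by
              rw [Real.exp_add]; field_simp
          _ ≤ _ := by
              refine hfin ?_ ?_
              · rw [hCU]; exact le_add_of_nonneg_right (by positivity)
              · have e1 := mul_le_mul_of_nonneg_right hkmin1 hn.le
                have e2 := mul_le_mul_of_nonneg_left hrF hkp.le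
                linarith
      · have h2 : p0 r x y ≤ a₃ * (KV * (1 + K ^ (d₂ / α₁))) / W := by
          have h4 : W ≤ KV * (1 + K ^ (d₂ / α₁)) * V x (Φinv r) := by
            refine (hVol x T r hT0 hr).trans ?_
            gcongr
            rw [div_le_iff₀ hr]
            refine le_of_mul_le_mul_left ?_ hF
            calc F * T ≤ K * N := hFT
              _ ≤ K * (r * F) := by gcongr
              _ = _ := by ring
          calc p0 r x y ≤ a₃ / V x (Φinv r) * Real.exp (-(a₄ * m r d)) := hpr
            _ ≤ a₃ / V x (Φinv r) * 1 := by
                gcongr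
                exact Real.exp_le_one_iff.2 (neg_nonpos.2 (by positivity))
            _ ≤ _ := by
                rw [mul_one, div_le_div_iff₀ hVr hW, mul_assoc]
                gcongr
        have h3 := hlarge r t N hr ht hn hFK' hrF
        calc p0 r x y * pbar r t
            ≤ a₃ * (KV * (1 + K ^ (d₂ / α₁))) / W * (C₃ / t * Real.exp (-(k₃ * (r * F)))) :=
              mul_le_mul h2 h3 (hpbar_nn r t) (by positivity)
          _ = a₃ * (KV * (1 + K ^ (d₂ / α₁))) * C₃ / (t * W) * Real.exp (-(k₃ * (r * F))) := by
              field_simp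
          _ ≤ _ := by
              refine hfin ?_ ?_
              · rw [hCU]; exact le_add_of_nonneg_left (by positivity)
              · have e1 := mul_le_mul_of_nonneg_right hkmin2 (mul_pos hr hF).le
                have e2 := mul_le_mul_of_nonneg_left hrF hkp.le
                linarith
    calc ∫⁻ r in Ioi 0, ENNReal.ofReal (p0 r x y * pbar r t)
        ≤ ∫⁻ r in Ioi 0, ENNReal.ofReal (B * Real.exp (-(k * F * r))) :=
          setLIntegral_mono' measurableSet_Ioi fun r hr => ENNReal.ofReal_le_ofReal (hupper r hr)
      _ = ENNReal.ofReal (B / (k * F)) := lintegral_Ioi_const_mul_exp hB0 (by positivity)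
      _ ≤ _ := by
          refine ENNReal.ofReal_le_ofReal ?_
          calc B / (k * F) = B / (k * F) * 1 := (mul_one _).symm
            _ ≤ B / (k * F) * (N / n₀) := by gcongr; exact (one_le_div hn₀).2 hnn
            _ = _ := by rw [hB]; field_simp
end
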